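/- Let A, B ∈ ℚ with 4A³ + 27B² ≠ 0, let E be the elliptic curve y² = x³ + Ax + B over ℚ, and assume the cubic x³ + Ax + B has no root in ℚ (equivalently, E(ℚ)[2] = 0). Then there exist α ∈ (0,1), c > 0, and X₀ > 0 such that for all X ≥ X₀, the number of squarefree integers d with |d| < X for which the group E^{(d)}(ℚ) of rational points of the quadratic twist E^{(d)} is finite is at least c · X / (log X)^{1-α}. -/

import Mathlib

/-- The quadratic twist by `d` of the elliptic curve `y² = x³ + Ax + B` over `ℚ`,
given by the Weierstrass equation `y² = x³ + d²Ax + d³B`. -/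
def quadTwist (A B : ℚ) (d : ℤ) : WeierstrassCurve.Affine ℚ :=
  { a₁ := 0, a₂ := 0, a₃ := 0, a₄ := (d : ℚ) ^ 2 * A, a₆ := (d : ℚ) ^ 3 * B }

namespace Ono
@[ext] structure Cub (R : Type*) (A B : ℤ) where
  a : R
  b : R
  c : R
namespace Cub
variable {R S : Type*} [CommRing R] [CommRing S] {A B : ℤ}
instance : Zero (Cub R A B) := ⟨⟨0, 0, 0⟩⟩
instance : One (Cub R A B) := ⟨⟨1, 0, 0⟩⟩
instance : Add (Cub R A B) := ⟨fun x y => ⟨x.a + y.a, x.b + y.b, x.c + y.c⟩⟩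
instance : Neg (Cub R A B) := ⟨fun x => ⟨-x.a, -x.b, -x.c⟩⟩
instance : Sub (Cub R A B) := ⟨fun x y => ⟨x.a - y.a, x.b - y.b, x.c - y.c⟩⟩
instance : Mul (Cub R A B) := ⟨fun x y =>
  ⟨x.a * y.a - B * (x.b * y.c + x.c * y.b),
   x.a * y.b + x.b * y.a - A * (x.b * y.c + x.c * y.b) - B * (x.c * y.c),
   x.a * y.c + x.b * y.b + x.c * y.a - A * (x.c * y.c)⟩⟩
instance : NatCast (Cub R A B) := ⟨fun n => ⟨n, 0, 0⟩⟩
instance : IntCast (Cub R A B) := ⟨fun n => ⟨n, 0, 0⟩⟩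
instance : SMul ℕ (Cub R A B) := ⟨fun n x => ⟨n • x.a, n • x.b, n • x.c⟩⟩
instance : SMul ℤ (Cub R A B) := ⟨fun n x => ⟨n • x.a, n • x.b, n • x.c⟩⟩
@[simp] theorem zero_a : (0 : Cub R A B).a = 0 := rfl
@[simp] theorem zero_b : (0 : Cub R A B).b = 0 := rfl
@[simp] theorem zero_c : (0 : Cub R A B).c = 0 := rfl
@[simp] theorem one_a : (1 : Cub R A B).a = 1 := rfl
@[simp] theorem one_b : (1 : Cub R A B).b = 0 := rfl
@[simp] theorem one_c : (1 : Cub R A B).c = 0 := rfl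
@[simp] theorem add_a (x y : Cub R A B) : (x + y).a = x.a + y.a := rfl
@[simp] theorem add_b (x y : Cub R A B) : (x + y).b = x.b + y.b := rfl
@[simp] theorem add_c (x y : Cub R A B) : (x + y).c = x.c + y.c := rfl
@[simp] theorem neg_a (x : Cub R A B) : (-x).a = -x.a := rfl
@[simp] theorem neg_b (x : Cub R A B) : (-x).b = -x.b := rfl
@[simp] theorem neg_c (x : Cub R A B) : (-x).c = -x.c := rfl
@[simp] theorem sub_a (x y : Cub R A B) : (x - y).a = x.a - y.a := rfl
@[simp] theorem sub_b (x y : Cub R A B) : (x - y).b = x.b - y.b := rfl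
@[simp] theorem sub_c (x y : Cub R A B) : (x - y).c = x.c - y.c := rfl
@[simp] theorem mul_a (x y : Cub R A B) :
  (x * y).a = x.a * y.a - B * (x.b * y.c + x.c * y.b) := rfl
@[simp] theorem mul_b (x y : Cub R A B) : (x * y).b =
  x.a * y.b + x.b * y.a - A * (x.b * y.c + x.c * y.b) - B * (x.c * y.c) := rfl
@[simp] theorem mul_c (x y : Cub R A B) : (x * y).c =
  x.a * y.c + x.b * y.b + x.c * y.a - A * (x.c * y.c) := rfl
@[simp] theorem natCast_a (n : ℕ) : (n : Cub R A B).a = n := rfl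
@[simp] theorem natCast_b (n : ℕ) : (n : Cub R A B).b = 0 := rfl
@[simp] theorem natCast_c (n : ℕ) : (n : Cub R A B).c = 0 := rfl
@[simp] theorem intCast_a (n : ℤ) : (n : Cub R A B).a = n := rfl
@[simp] theorem intCast_b (n : ℤ) : (n : Cub R A B).b = 0 := rfl
@[simp] theorem intCast_c (n : ℤ) : (n : Cub R A B).c = 0 := rfl
instance : CommRing (Cub R A B) where
  add_assoc x y z := by ext <;> simp [add_assoc]
  zero_add x := by ext <;> simp
  add_zero x := by ext <;> simp
  add_comm x y := by ext <;> simp [add_comm]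
  left_distrib x y z := by ext <;> simp <;> ring
  right_distrib x y z := by ext <;> simp <;> ring
  zero_mul x := by ext <;> simp
  mul_zero x := by ext <;> simp
  mul_assoc x y z := by ext <;> simp <;> ring
  one_mul x := by ext <;> simp
  mul_one x := by ext <;> simp
  mul_comm x y := by ext <;> simp <;> ring
  neg_add_cancel x := by ext <;> simp
  sub_eq_add_neg x y := by ext <;> simp [sub_eq_add_neg]
  nsmul := (· • ·)
  nsmul_zero x := by ext <;> exact zero_nsmul _
  nsmul_succ n x := by ext <;> exact succ_nsmul _ _
  zsmul := (· • ·)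
  zsmul_zero' x := by ext <;> exact zero_zsmul _
  zsmul_succ' n x := by ext <;> exact SubNegMonoid.zsmul_succ' _ _
  zsmul_neg' n x := by ext <;> exact SubNegMonoid.zsmul_neg' _ _
  natCast_zero := by ext <;> simp
  natCast_succ n := by ext <;> simp
  intCast_ofNat n := by ext <;> simp
  intCast_negSucc n := by ext <;> simp [Int.negSucc_eq]
def of (A B : ℤ) : R →+* Cub R A B where
  toFun r := ⟨r, 0, 0⟩
  map_one' := rfl
  map_zero' := rfl
  map_mul' x y := by ext <;> simp
  map_add' x y := by ext <;> simp
@[simp] theorem of_a (r : R) : (of A B r).a = r := rfl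
@[simp] theorem of_b (r : R) : (of A B r).b = 0 := rfl
@[simp] theorem of_c (r : R) : (of A B r).c = 0 := rfl
def map (g : R →+* S) : Cub R A B →+* Cub S A B where
  toFun x := ⟨g x.a, g x.b, g x.c⟩
  map_one' := by ext <;> simp
  map_zero' := by ext <;> simp
  map_mul' x y := by ext <;> simp
  map_add' x y := by ext <;> simp
@[simp] theorem map_a (g : R →+* S) (x : Cub R A B) : (map g x).a = g x.a := rfl
@[simp] theorem map_b (g : R →+* S) (x : Cub R A B) : (map g x).b = g x.b := rfl
@[simp] theorem map_c (g : R →+* S) (x : Cub R A B) : (map g x).c = g x.c := rfl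
def ev (g : R →+* S) (r : S) (h : r ^ 3 + A * r + B = 0) : Cub R A B →+* S where
  toFun x := g x.a + g x.b * r + g x.c * r ^ 2
  map_one' := by simp
  map_zero' := by simp
  map_mul' x y := by
    simp
    grind
  map_add' x y := by simp; ring
theorem ev_apply (g : R →+* S) (r : S) (h : r ^ 3 + A * r + B = 0) (x : Cub R A B) :
    ev g r h x = g x.a + g x.b * r + g x.c * r ^ 2 := rfl
def N (x : Cub R A B) : R :=
  x.a ^ 3 - B * x.b ^ 3 + B ^ 2 * x.c ^ 3 - 2 * A * x.a ^ 2 * x.c + A * x.a * x.b ^ 2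
   + 3 * B * x.a * x.b * x.c + A ^ 2 * x.a * x.c ^ 2 - A * B * x.b * x.c ^ 2
def adj (x : Cub R A B) : Cub R A B :=
  ⟨x.a ^ 2 + A * x.b ^ 2 + A ^ 2 * x.c ^ 2 - 2 * A * x.a * x.c + B * x.b * x.c,
   -x.a * x.b - B * x.c ^ 2 , x.b ^ 2 - x.a * x.c + A * x.c ^ 2⟩
theorem mul_adj (x : Cub R A B) : x * adj x = of A B (N x) := by
  ext <;> simp only [mul_a, mul_b, mul_c, of_a, of_b, of_c, adj, N] <;> ring
@[simp] theorem N_mul (x y : Cub R A B) : N (x * y) = N x * N y := by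
  simp [N]; ring
@[simp] theorem N_one : N (1 : Cub R A B) = 1 := by simp [N]
@[simp] theorem N_of (r : R) : N (of A B r) = r ^ 3 := by simp [N]
theorem N_map (g : R →+* S) (x : Cub R A B) : N (map g x) = g (N x) := by
  simp [N, map_ofNat]
theorem N_pow (x : Cub R A B) (n : ℕ) : N (x ^ n) = N x ^ n := by
  induction n with
  | zero => simp
  | succ n ih => rw [pow_succ, N_mul, ih, pow_succ]
theorem isUnit_of_N {x : Cub R A B} (h : IsUnit (N x)) : IsUnit x := by
  have := (h.map (of A B)); rw [← mul_adj] at this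
  grind
theorem isUnit_iff {x : Cub R A B} : IsUnit x ↔ IsUnit (N x) := by
  refine ⟨fun ⟨u, hu⟩ => ?_, isUnit_of_N⟩
  have : N x * N (u⁻¹.1 : Cub R A B) = 1 := by rw [← N_mul, ← hu, Units.mul_inv, N_one]
  exact IsUnit.of_mul_eq_one _ this
def θ : Cub R A B := ⟨0, 1, 0⟩
@[simp] theorem θ_a : (θ : Cub R A B).a = 0 := rfl
@[simp] theorem θ_b : (θ : Cub R A B).b = 1 := rfl
@[simp] theorem θ_c : (θ : Cub R A B).c = 0 := rfl
theorem θ_eq : (θ : Cub R A B) ^ 3 + of A B (A : R) * θ + of A B (B : R) = 0 := by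
  ext <;> simp [pow_succ]
theorem map_of (g : R →+* S) (r : R) : map g (of A B r) = of A B (g r) := by ext <;> simp
theorem map_θ (g : R →+* S) : map g (θ : Cub R A B) = θ := by ext <;> simp
theorem map_map {T : Type*} [CommRing T] (g : R →+* S) (h : S →+* T) (x : Cub R A B) :
  map h (map g x) = map (h.comp g) x := by ext <;> simp
theorem eq_of (x : Cub R A B) : x = of A B x.a + of A B x.b * θ + of A B x.c * θ ^ 2 := by
  ext <;> simp [pow_succ]
theorem map_injective {g : R →+* S} (h : Function.Injective g) :
    Function.Injective (map g : Cub R A B →+* Cub S A B) := by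
  intro x y hxy
  have h1 := congrArg a hxy; have h2 := congrArg b hxy; have h3 := congrArg c hxy
  ext
  exacts [h h1, h h2, h h3]
section field
variable {F : Type*} [Field F]
theorem N_ne_zero (hf : ∀ x : F, x ^ 3 + A * x + B ≠ 0) {x : Cub F A B} (hx : x ≠ 0) :
    N x ≠ 0 := by
  have key : ∀ y : Cub F A B, y.c = 0 → N y = 0 → y = 0 := by
    intro y hy hN
    by_cases hb : y.b = 0
    · have : y.a = 0 := by simpa [N, hy, hb] using hN
      ext <;> simp [*]
    · exfalso
      apply hf (-y.a / y.b)
      simp only [N, hy] at hN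
      grind
  intro hN
  by_cases hc : x.c = 0
  · exact hx (key x hc hN)
  have := key (x * ⟨-x.b / x.c, 1, 0⟩) (by simp; field_simp; ring) (by simp [hN])
  have h1 := congrArg a this
  have h2 := congrArg b this
  simp at h1 h2
  apply hf (x.b / x.c)
  grind
end field
end Cub
end Ono

namespace Ono
open Cub Height
theorem halving {A B : ℤ} {D : ℚ} (hD : D ≠ 0)
    {X : ℚ} {z : Cub ℚ A B} (hz : z ^ 2 = of A B X - of A B D * θ) :
    ∃ x y : ℚ, y ^ 2 = x ^ 3 + D ^ 2 * A * x + D ^ 3 * B ∧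
      x ^ 4 - 2 * (D ^ 2 * A) * x ^ 2 - 8 * (D ^ 3 * B) * x + (D ^ 2 * A) ^ 2 =
        4 * (x ^ 3 + D ^ 2 * A * x + D ^ 3 * B) * X := by
  obtain ⟨a, b, c⟩ := z
  have h1 := congrArg Cub.a hz
  have h2 := congrArg Cub.b hz
  have h3 := congrArg Cub.c hz
  simp [pow_two] at h1 h2 h3
  have hc : c ≠ 0 := by
    grind
  have e2 : D = -(a * b + b * a - A * (b * c + c * b) - B * (c * c)) := by rw [h2, neg_neg]
  have e3 : a = (A * c ^ 2 - b ^ 2) / (2 * c) := by field_simp; linear_combination h3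
  have e1 : X = a * a - B * (b * c + c * b) := by linear_combination -h1
  clear h1 h2 h3 hz
  refine ⟨b * D / c, (D * (-a * b - B * c ^ 2) + (a * c - b ^ 2 - A * c ^ 2) * (b * D / c)) / c,
    ?_, ?_⟩ <;> subst e1 <;> subst e2 <;> subst e3 <;> field_simp <;> ring
theorem finite_of_dup {a b : ℚ} (hd : 4 * a ^ 3 + 27 * b ^ 2 ≠ 0)
    (hf : ∀ x, x ^ 3 + a * x + b ≠ 0)
    (h : ∀ X Y : ℚ, Y ^ 2 = X ^ 3 + a * X + b → ∃ x y : ℚ, y ^ 2 = x ^ 3 + a * x + b ∧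
      x ^ 4 - 2 * a * x ^ 2 - 8 * b * x + a ^ 2 = 4 * (x ^ 3 + a * x + b) * X) :
    {X : ℚ | ∃ Y, Y ^ 2 = X ^ 3 + a * X + b}.Finite := by
  set T := {X : ℚ | ∃ Y, Y ^ 2 = X ^ 3 + a * X + b} with hT
  have hh : ∀ X ∈ T, ∃ x, x ∈ T ∧
      x ^ 4 - 2 * a * x ^ 2 - 8 * b * x + a ^ 2 = 4 * (x ^ 3 + a * x + b) * X := by
    rintro X ⟨Y, hY⟩
    grind
  choose! g hg1 hg2 using hh
  let W : WeierstrassCurve ℚ := ⟨0, 0, 0, a, b⟩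
  have hW : W.IsElliptic := ⟨by
    have : W.Δ = -16 * (4 * a ^ 3 + 27 * b ^ 2) := by
      simp [W, WeierstrassCurve.Δ, WeierstrassCurve.b₂, WeierstrassCurve.b₄,
        WeierstrassCurve.b₆, WeierstrassCurve.b₈]; ring
    rw [this, isUnit_iff_ne_zero]
    grind⟩
  obtain ⟨C, hC⟩ := W.abs_logHeight_addSubMap_sub_two_mul_logHeight_le
  obtain ⟨C₁, h1⟩ := logHeight_sym2_le ℚ
  obtain ⟨C₂, h2⟩ := logHeight_sym2_ge ℚ
  have hne : ∀ x : ℚ, ![x, 1] ≠ 0 := fun x e => by simpa using congrFun e 1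
  obtain ⟨M, hM⟩ : ∃ M, ∀ X ∈ T, 4 * logHeight₁ (g X) ≤ logHeight₁ X + M := by
    refine ⟨C₁ + logHeight ![(1 : ℚ), 0] + C - 2 * C₂, fun X hX => ?_⟩
    have e := hg2 X hX
    set x := g X
    have k1 := h1 X 1 1 0
    have k2 := @h2 x 1 x 1 (hne x) (hne x)
    have k3 := hC ![x * x, x * 1 + 1 * x, 1 * 1]
    have : (fun i ↦ MvPolynomial.eval ![x * x, x * 1 + 1 * x, 1 * 1] (W.addSubMap i)) =
        (4 * (x ^ 3 + a * x + b)) • ![X * 1, X * 0 + 1 * 1, 1 * 0] := by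
      ext i; fin_cases i
      · simp [WeierstrassCurve.addSubMap, W, WeierstrassCurve.b₂, WeierstrassCurve.b₄,
          WeierstrassCurve.b₆, WeierstrassCurve.b₈]
        linear_combination e
      · simp [WeierstrassCurve.addSubMap, W, WeierstrassCurve.b₂, WeierstrassCurve.b₄,
          WeierstrassCurve.b₆, WeierstrassCurve.b₈]
        ring
      · simp [WeierstrassCurve.addSubMap]
        ring
    rw [this, logHeight_smul_eq_logHeight _ (mul_ne_zero (by norm_num) (hf x))] at k3
    rw [logHeight₁_eq_logHeight, logHeight₁_eq_logHeight]
    have := (abs_le.1 k3).1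
    linarith
  have hinj : Set.InjOn g T := fun X hX Y hY e => by
    grind
  have hfin (b : ℝ) : {x : ℚ | logHeight₁ x ≤ b}.Finite := NumberField.finite_setOfPred_logHeight₁_le ℚ b
  refine (hfin (M / 3)).subset fun P hP => ?_
  by_contra hlt
  simp only [Set.mem_ofPred_eq, not_le] at hlt
  set m := logHeight₁ P
  let S := T ∩ {x : ℚ | logHeight₁ x ≤ m}
  have hS : S.Finite := (hfin m).subset Set.inter_subset_right
  have hPS : P ∈ S := ⟨hP, le_refl m⟩
  obtain ⟨Q, hQ, hmax⟩ := hS.exists_maximalFor logHeight₁ S ⟨P, hPS⟩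
  have hQP : m ≤ logHeight₁ Q := by
    grind
  have hmaps : Set.MapsTo g S S := fun X hX => ⟨hg1 X hX.1, by
    have := hM X hX.1
    have := hX.2
    grind⟩
  obtain ⟨R, hR, hRQ⟩ := (Set.surj_on_of_inj_on_of_ncard_le (s := S) (t := S) (fun x _ => g x) (fun x hx => hmaps hx)
    (fun x y hx hy => hinj hx.1 hy.1) le_rfl hS) Q hQ
  have := hM R hR.1
  rw [← hRQ] at this
  have := hR.2
  grind
theorem finite_point (A B : ℚ) (d : ℤ)
    (h : {X : ℚ | ∃ Y, Y ^ 2 = X ^ 3 + d ^ 2 * A * X + d ^ 3 * B}.Finite) :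
    Finite (quadTwist A B d).Point := by
  have h2 : {P : ℚ × ℚ | P.2 ^ 2 = P.1 ^ 3 + d ^ 2 * A * P.1 + d ^ 3 * B}.Finite := by
    refine Set.Finite.of_finite_fibers Prod.fst (h.subset ?_) fun x _ => ?_
    · grind
    · rcases Set.eq_empty_or_nonempty ({P : ℚ × ℚ | P.2 ^ 2 = P.1 ^ 3 + d ^ 2 * A * P.1 + d ^ 3 * B} ∩ Prod.fst ⁻¹' {x}) with h | ⟨⟨u, y⟩, h1, h2⟩
      · grind
      · refine (Set.toFinite {(x, y), (x, -y)}).subset ?_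
        rintro ⟨u', y'⟩ ⟨h1', h2'⟩
        simp at h1 h2 h1' h2' ⊢
        grind
  have := h2.to_subtype
  refine Finite.of_injective (β := Option {P : ℚ × ℚ | P.2 ^ 2 = P.1 ^ 3 + d ^ 2 * A * P.1 + d ^ 3 * B})
    (fun P => match P with
      | .zero => none
      | .some x y h => some ⟨(x, y), by
          have := ((quadTwist A B d).equation_iff x y).1 h.1
          simpa [quadTwist] using this⟩) ?_
  rintro (_ | ⟨x, y, h⟩) (_ | ⟨x', y', h'⟩) e <;> simp_all
theorem finite_of_image_trivial {A B : ℤ} (hΔ : 4 * A ^ 3 + 27 * B ^ 2 ≠ 0)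
    (hf : ∀ x : ℚ, x ^ 3 + A * x + B ≠ 0) {D : ℤ} (hD : D ≠ 0)
    (h : ∀ X Y : ℚ, Y ^ 2 = X ^ 3 + D ^ 2 * A * X + D ^ 3 * B →
      ∃ z : Cub ℚ A B, z ^ 2 = of A B X - of A B (D : ℚ) * θ) :
    {X : ℚ | ∃ Y, Y ^ 2 = X ^ 3 + D ^ 2 * A * X + D ^ 3 * B}.Finite := by
  have hD' : (D : ℚ) ≠ 0 := by exact_mod_cast hD
  refine finite_of_dup ?_ ?_ ?_
  · have : (4 * A ^ 3 + 27 * B ^ 2 : ℚ) ≠ 0 := by exact_mod_cast hΔ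
    grind
  · intro x hx
    apply hf (x / D); grind
  · intro X Y hY
    obtain ⟨z, hz⟩ := h X Y hY
    exact halving hD' hz
end Ono

namespace Ono
open Filter Topology Nat
noncomputable def psum (h : ℕ → ℝ) (X : ℝ) : ℝ :=
  ∑ p ∈ primesLE ⌊X⌋₊, h p * (Real.log p / p)
def HasD (h : ℕ → ℝ) (κ : ℝ) : Prop :=
  Tendsto (fun X : ℝ => psum h X / Real.log X) atTop (𝓝 κ)
theorem one_div_log_tendsto (C : ℝ) : Tendsto (fun X : ℝ => C / Real.log X) atTop (𝓝 0) :=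
  tendsto_const_nhds.div_atTop Real.tendsto_log_atTop
theorem hasD_of_count {S L : ℝ → ℝ} {a : ℕ → ℝ} {ρ n C : ℝ} (hρ : 0 < ρ)
    (hS : Tendsto (fun y => S y / y) atTop (𝓝 ρ)) (hmono : Monotone S) (hS0 : ∀ y, 0 ≤ S y)
    (ha : ∀ p, 0 ≤ a p) (han : ∀ p, a p ≤ n) 
    (hL1 : ∀ X, 1 ≤ X → L X ≤ S X * Real.log X)
    (hL2 : ∀ X Y, 1 ≤ Y → Y ≤ X → (S X - S Y) * Real.log Y ≤ L X)
    (hL3 : ∀ X, 1 ≤ X → |L X - ∑ p ∈ primesLE ⌊X⌋₊, a p * Real.log p * S (X / p)| ≤ C * X) :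
    HasD a 1 := by
  set G : ℝ → ℝ := fun X => ∑ p ∈ primesLE ⌊X⌋₊, a p * Real.log p * S (X / p) with hG
  have hn : 0 ≤ n := (ha 0).trans (han 0)
  have hlog : ∀ᶠ X : ℝ in atTop, 1 < Real.log X := by
    filter_upwards [Real.tendsto_log_atTop.eventually_gt_atTop 1] with X h using h
  have h1 : Tendsto (fun X => L X / (X * Real.log X)) atTop (𝓝 ρ) := by
    have lo : Tendsto (fun X : ℝ => (S X / X - S (X / Real.log X) / (X / Real.log X) * (1 / Real.log X)) *
        (1 - Real.log (Real.log X) / Real.log X)) atTop (𝓝 ((ρ - ρ * 0) * (1 - 0))) := by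
      have e2 : Tendsto (fun X : ℝ => X / Real.log X) atTop atTop := by
        have := (Real.isLittleO_log_id_atTop).tendsto_div_nhds_zero
        have h2 : Tendsto (fun X : ℝ => Real.log X / X) atTop (𝓝[>] 0) := by
          refine tendsto_nhdsWithin_iff.2 ⟨this, ?_⟩
          filter_upwards [hlog, eventually_gt_atTop 0] with X h h'
          exact div_pos (by linarith) h'
        refine h2.inv_tendsto_nhdsGT_zero.congr fun X => by simp
      have e3 : Tendsto (fun X : ℝ => Real.log (Real.log X) / Real.log X) atTop (𝓝 0) :=
        ((Real.isLittleO_log_id_atTop).tendsto_div_nhds_zero).comp Real.tendsto_log_atTop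
      exact (hS.sub ((hS.comp e2).mul (one_div_log_tendsto 1))).mul (tendsto_const_nhds.sub e3)
    simp only [mul_zero, sub_zero, mul_one] at lo
    refine tendsto_of_tendsto_of_tendsto_of_le_of_le' lo hS ?_ ?_
    · filter_upwards [hlog, eventually_gt_atTop 1] with X h hX
      have hl : 0 < Real.log X := by linarith
      have hX0 : 0 < X := by linarith
      have hle : Real.log X ≤ X := (Real.log_le_sub_one_of_pos hX0).trans (by linarith)
      have := hL2 X (X / Real.log X) (by rwa [le_div_iff₀ hl, one_mul])
        (div_le_self hX0.le h.le)
      rw [Real.log_div hX0.ne' hl.ne'] at this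
      rw [le_div_iff₀ (by positivity)]
      refine le_trans (le_of_eq ?_) this
      field_simp
    · filter_upwards [hlog, eventually_gt_atTop 1] with X h hX
      have hl : 0 < Real.log X := by linarith
      rw [div_le_div_iff₀ (by positivity) (by positivity)]
      nlinarith [hL1 X hX.le]
  have h2 : Tendsto (fun X => G X / (X * Real.log X)) atTop (𝓝 ρ) := by
    have hz : Tendsto (fun X => (L X - G X) / (X * Real.log X)) atTop (𝓝 0) := by
      refine squeeze_zero_norm' ?_ (one_div_log_tendsto C)
      filter_upwards [hlog, eventually_gt_atTop 1] with X h hX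
      have hl : 0 < Real.log X := by linarith
      rw [norm_div, Real.norm_eq_abs, Real.norm_eq_abs, abs_of_pos (a := X * _) (by positivity),
        div_le_div_iff₀ (by positivity) (by positivity)]
      nlinarith [hL3 X hX.le]
    simpa [sub_div] using h1.sub hz
  have hB : ∀ η > 0, ∃ C', 0 ≤ C' ∧ ∀ y, 0 < y → |S y - ρ * y| ≤ η * y + C' := by
    intro η hη
    obtain ⟨Y, hY⟩ := eventually_atTop.1 ((Metric.tendsto_nhds.1 hS) η hη)
    set Z := max Y 1
    refine ⟨S Z + ρ * Z, by have := hS0 Z; positivity, fun y hy => ?_⟩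
    rcases le_total Z y with h | h
    · have := hY y ((le_max_left _ _).trans h)
      rw [Real.dist_eq] at this
      have e : S y - ρ * y = (S y / y - ρ) * y := by field_simp
      rw [e, abs_mul, abs_of_pos hy]
      have : 0 ≤ S Z + ρ * Z := by have := hS0 Z; positivity
      nlinarith
    · rw [abs_le]
      have := hmono h; have := hS0 y; have := hS0 Z
      constructor <;> nlinarith [mul_pos hη hy, mul_le_mul_of_nonneg_left h hρ.le, mul_pos hρ hy]
  have hC : ∀ η > 0, ∃ C', ∀ X, 1 < X → |G X - ρ * X * psum a X| ≤ η * X * psum a X + C' * X := by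
    intro η hη
    obtain ⟨C', hC0, hC'⟩ := hB η hη
    refine ⟨C' * n * Real.log 4, fun X hX => ?_⟩
    have hX0 : 0 < X := by linarith
    have hθ := Chebyshev.theta_le_log4_mul_x hX0.le
    rw [Chebyshev.theta_eq_sum_primesLE] at hθ
    calc |G X - ρ * X * psum a X|
        = |∑ p ∈ primesLE ⌊X⌋₊, a p * Real.log p * (S (X / p) - ρ * (X / p))| := by
          simp only [hG, psum, Finset.mul_sum, ← Finset.sum_sub_distrib]
          congr 1; refine Finset.sum_congr rfl fun p _ => by ring
      _ ≤ ∑ p ∈ primesLE ⌊X⌋₊, (η * X * (a p * (Real.log p / p)) + C' * n * Real.log p) := by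
          refine (Finset.abs_sum_le_sum_abs _ _).trans (Finset.sum_le_sum fun p hp => ?_)
          have hp := prime_of_mem_primesLE hp
          have hp1 : 0 < (p : ℝ) := by exact_mod_cast hp.pos
          have hlp : 0 ≤ Real.log p := Real.log_natCast_nonneg p
          rw [abs_mul, abs_of_nonneg (mul_nonneg (ha p) hlp)]
          refine (mul_le_mul_of_nonneg_left (hC' (X / p) (by positivity))
            (mul_nonneg (ha p) hlp)).trans ?_
          have : a p * (C' * Real.log p) ≤ n * (C' * Real.log p) :=
            mul_le_mul_of_nonneg_right (han p) (by positivity)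
          grind
      _ ≤ _ := by
          rw [Finset.sum_add_distrib, ← Finset.mul_sum, ← Finset.mul_sum]
          have := mul_le_mul_of_nonneg_left hθ (mul_nonneg hC0 hn)
          unfold psum; linarith
  obtain ⟨M, hM0, hM⟩ : ∃ M, 0 < M ∧ ∀ᶠ X in atTop, psum a X / Real.log X ≤ M := by
    obtain ⟨C', hC'⟩ := hC (ρ / 2) (by positivity)
    refine ⟨(ρ + 1 + |C'|) / (ρ / 2), by positivity, ?_⟩
    filter_upwards [hlog, eventually_gt_atTop 1, h2.eventually_lt_const (lt_add_one ρ)]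
      with X h hX h3
    have hX0 : 0 < X := by linarith
    have hl : 0 < Real.log X := by linarith
    rw [div_lt_iff₀ (by positivity)] at h3
    have := (abs_le.1 (hC' X hX)).1
    rw [div_le_div_iff₀ (by positivity) (by positivity)]
    have h5 : X * (ρ / 2 * psum a X) ≤ X * ((ρ + 1) * Real.log X + |C'|) := by
      nlinarith [mul_le_mul_of_nonneg_right (le_abs_self C') hX0.le]
    have := le_of_mul_le_mul_left h5 hX0
    nlinarith [abs_nonneg C', mul_le_mul_of_nonneg_left h.le (abs_nonneg C')]
  have h3 : Tendsto (fun X => G X / (X * Real.log X) - ρ * (psum a X / Real.log X)) atTop (𝓝 0) := by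
    rw [Metric.tendsto_nhds]
    intro ε hε
    obtain ⟨C', hC'⟩ := hC (ε / (2 * M)) (by positivity)
    filter_upwards [hlog, eventually_gt_atTop 1, hM,
      (one_div_log_tendsto (C' )).eventually_lt_const (half_pos hε)] with X h hX h3 h4
    rw [Real.dist_eq, sub_zero]
    have e : G X / (X * Real.log X) - ρ * (psum a X / Real.log X) =
      (G X - ρ * X * psum a X) / (X * Real.log X) := by field_simp
    rw [e, abs_div, abs_of_pos (a := X * _) (by positivity)]
    calc _ ≤ (ε / (2 * M) * X * psum a X + C' * X) / (X * Real.log X) := by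
          gcongr; exact hC' X hX
      _ = ε / (2 * M) * (psum a X / Real.log X) + C' / Real.log X := by field_simp
      _ < ε / (2 * M) * M + ε / 2 := by
          have := mul_le_mul_of_nonneg_left h3 (by positivity : 0 ≤ ε / (2 * M))
          linarith
      _ = ε := by field_simp; ring
  have h4 := ((h2.sub h3).const_mul ρ⁻¹)
  rw [sub_zero, inv_mul_cancel₀ hρ.ne'] at h4
  refine h4.congr fun X => ?_
  field_simp
  ring
end Ono

namespace Ono
open Filter Topology Nat NumberField Ideal
open scoped nonZeroDivisors
variable (L : Type*) [Field L] [NumberField L]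
noncomputable def FI (X : ℝ) : Finset (Ideal (𝓞 L)) :=
  (show {I : Ideal (𝓞 L) | I ≠ ⊥ ∧ absNorm I ≤ ⌊X⌋₊}.Finite from
    Set.Finite.subset (Ideal.finite_setOfPred_absNorm_le (S := 𝓞 L) ⌊X⌋₊) fun _ h => h.2).toFinset
variable {L} in
theorem mem_FI {X : ℝ} {I : Ideal (𝓞 L)} : I ∈ FI L X ↔ I ≠ ⊥ ∧ absNorm I ≤ ⌊X⌋₊ := by
  simp [FI]
variable {L} in
theorem norm_pos {I : Ideal (𝓞 L)} (h : I ≠ ⊥) : 0 < absNorm I :=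
  Nat.pos_of_ne_zero (by simpa [absNorm_eq_zero_iff] using h)
variable {L} in
theorem two_le_norm {P : Ideal (𝓞 L)} (h : P ≠ ⊥) (hP : P.IsPrime) : 2 ≤ absNorm P := by
  have h1 := norm_pos h
  have h2 : absNorm P ≠ 1 := by rw [Ne, absNorm_eq_one_iff]; exact hP.ne_top
  omega
theorem tendsto_FI : Tendsto (fun y : ℝ => ((FI L y).card : ℝ) / y) atTop
    (𝓝 (dedekindZeta_residue L)) := by
  refine (Ideal.tendsto_norm_le_div_atTop₀ L).congr' ?_
  filter_upwards [eventually_ge_atTop 0] with y hy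
  congr 2
  rw [← Nat.card_eq_finsetCard]
  norm_cast
  refine Nat.card_congr ⟨fun I => ⟨I.1.1, mem_FI.2 ⟨nonZeroDivisors.ne_zero I.1.2, (Nat.le_floor_iff hy).2 I.2⟩⟩,
    fun I => ⟨⟨I.1, mem_nonZeroDivisors_of_ne_zero (mem_FI.1 I.2).1⟩,
      (Nat.le_floor_iff hy).1 (mem_FI.1 I.2).2⟩, fun _ => rfl, fun _ => rfl⟩
open scoped Classical in
variable {L} in
theorem log_norm_eq {X : ℝ} {I : Ideal (𝓞 L)} (hI : I ∈ FI L X) :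
    Real.log (absNorm I) = ∑ P ∈ FI L X with P.IsPrime, ∑ k ∈ Finset.Icc 1 ⌊X⌋₊,
      if P ^ k ∣ I then Real.log (absNorm P) else 0 := by
  obtain ⟨h0, hX⟩ := mem_FI.1 hI
  open UniqueFactorizationMonoid in
  have hs : (normalizedFactors I).toFinset ⊆ (FI L X).filter (·.IsPrime) := by
    intro P hP
    rw [Multiset.mem_toFinset] at hP
    have hp := prime_of_normalized_factor P hP
    refine Finset.mem_filter.2 ⟨mem_FI.2 ⟨hp.ne_zero, le_trans ?_ hX⟩, isPrime_of_prime hp⟩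
    exact Nat.le_of_dvd (norm_pos h0) (_root_.map_dvd absNorm (dvd_of_mem_normalizedFactors hP))
  have h1 : Real.log (absNorm I) = ∑ P ∈ (normalizedFactors I).toFinset,
      ((normalizedFactors I).count P : ℝ) * Real.log (absNorm P) := by
    conv_lhs => rw [← Ideal.prod_normalizedFactors_eq_self h0, map_multiset_prod, Finset.prod_multiset_map_count]
    push_cast
    rw [Real.log_prod]
    · simp
    · intro P hP
      have := (Finset.mem_filter.1 (hs hP)).1
      exact pow_ne_zero _ (by exact_mod_cast (norm_pos (mem_FI.1 this).1).ne')
  rw [h1, Finset.sum_subset hs]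
  · refine Finset.sum_congr rfl fun P hP => ?_
    obtain ⟨hP1, hP2⟩ := Finset.mem_filter.1 hP
    have hP0 := (mem_FI.1 hP1).1
    have hp : Prime P := prime_of_isPrime hP0 hP2
    rw [← Finset.sum_filter, Finset.sum_const, nsmul_eq_mul]
    congr 2
    have key : ∀ k, P ^ k ∣ I ↔ k ≤ (normalizedFactors I).count P := fun k => by
      rw [pow_dvd_iff_le_emultiplicity, emultiplicity_eq_count_normalizedFactors hp.irreducible h0, normalize_eq]
      simp
    have : (Finset.Icc 1 ⌊X⌋₊).filter (fun k => P ^ k ∣ I) = Finset.Icc 1 ((normalizedFactors I).count P) := by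
      ext k
      simp only [Finset.mem_filter, Finset.mem_Icc, key]
      refine ⟨fun h => ⟨h.1.1, h.2⟩, fun h => ⟨⟨h.1, ?_⟩, h.2⟩⟩
      have := Nat.le_of_dvd (norm_pos h0) (_root_.map_dvd absNorm ((key k).2 h.2))
      rw [map_pow] at this
      have := Nat.pow_le_pow_left (two_le_norm hP0 hP2) k
      have := Nat.lt_two_pow_self (n := k)
      omega
    rw [this]; simp
  · intro P _ hP
    rw [Multiset.mem_toFinset] at hP
    simp [Multiset.count_eq_zero_of_notMem hP]
open scoped Classical in
variable {L} in
theorem card_dvd {X : ℝ} {J : Ideal (𝓞 L)} (hJ : J ≠ ⊥) :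
    ((FI L X).filter (J ∣ ·)).card = (FI L (X / absNorm J)).card := by
  symm
  have hn := norm_pos hJ
  refine Finset.card_nbij (J * ·) ?_ ?_ ?_
  · intro I hI
    obtain ⟨h0, h1⟩ := mem_FI.1 hI
    refine Finset.mem_coe.2 (Finset.mem_filter.2 ⟨mem_FI.2 ⟨mul_ne_zero hJ h0, ?_⟩, dvd_mul_right _ _⟩)
    rw [map_mul]
    rw [Nat.floor_div_natCast, Nat.le_div_iff_mul_le hn] at h1
    linarith
  · intro I _ I' _ h
    exact mul_left_cancel₀ hJ h
  · intro I hI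
    obtain ⟨h1, K, rfl⟩ := Finset.mem_filter.1 (Finset.mem_coe.1 hI)
    obtain ⟨h0, h1⟩ := mem_FI.1 h1
    refine ⟨K, mem_FI.2 ⟨right_ne_zero_of_mul h0, ?_⟩, rfl⟩
    rw [map_mul] at h1
    rw [Nat.floor_div_natCast, Nat.le_div_iff_mul_le hn]
    linarith
open scoped Classical in
theorem sum_log_norm (X : ℝ) : ∑ I ∈ FI L X, Real.log (absNorm I) =
    ∑ P ∈ FI L X with P.IsPrime, ∑ k ∈ Finset.Icc 1 ⌊X⌋₊,
      Real.log (absNorm P) * ((FI L (X / (absNorm P : ℝ) ^ k)).card : ℝ) := by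
  rw [Finset.sum_congr rfl fun I hI => log_norm_eq hI, Finset.sum_comm]
  refine Finset.sum_congr rfl fun P hP => ?_
  rw [Finset.sum_comm]
  refine Finset.sum_congr rfl fun k _ => ?_
  rw [← Finset.sum_filter, Finset.sum_const, nsmul_eq_mul, mul_comm,
    card_dvd (pow_ne_zero _ (mem_FI.1 (Finset.mem_filter.1 hP).1).1)]
  simp
variable {L} in
theorem minFac_mem {P : Ideal (𝓞 L)} (h : P ≠ ⊥) (hP : P.IsPrime) :
    ((absNorm P).minFac : 𝓞 L) ∈ P := by
  have key : ∀ n : ℕ, n ≠ 0 → (n : 𝓞 L) ∈ P → ∃ p : ℕ, p.Prime ∧ (p : 𝓞 L) ∈ P := by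
    intro n
    induction n using Nat.recOnMul with
    | zero => simp
    | one => intro _ h; exact absurd ((eq_top_iff_one P).2 (by simpa using h)) hP.ne_top
    | prime p hp => grind
    | mul a b iha ihb =>
      intro h0 h
      rw [Nat.cast_mul] at h
      rcases hP.mem_or_mem h with h | h
      · grind
      grind
  obtain ⟨p, hp, hmem⟩ := key _ (norm_pos h).ne' (absNorm_mem P)
  have h1 : absNorm P ∣ p ^ Module.finrank ℤ (𝓞 L) := by
    have := absNorm_dvd_absNorm_of_le ((span_singleton_le_iff_mem P).2 hmem)
    rwa [absNorm_span_singleton, ← map_natCast (algebraMap ℤ (𝓞 L)), Algebra.norm_algebraMap,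
      Int.natAbs_pow, Int.natAbs_natCast] at this
  obtain ⟨k, -, hk⟩ := (Nat.dvd_prime_pow hp).1 h1
  have : k ≠ 0 := by rintro rfl; rw [pow_zero] at hk; have := two_le_norm h hP; omega
  rwa [hk, hp.pow_minFac this]
theorem card_over (p : ℕ) (hp : p.Prime) (F : Finset (Ideal (𝓞 L)))
    (hF : ∀ P ∈ F, P ≠ ⊥ ∧ P.IsPrime ∧ (absNorm P).minFac = p) :
    F.card ≤ Module.finrank ℤ (𝓞 L) := by
  have h1 : ∏ P ∈ F, P ∣ span {(p : 𝓞 L)} := by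
    refine Finset.prod_primes_dvd _ (fun P hP => prime_of_isPrime (hF P hP).1 (hF P hP).2.1) fun P hP => ?_
    obtain ⟨h, h', h''⟩ := hF P hP
    rw [dvd_span_singleton, ← h'']
    exact minFac_mem h h'
  have h2 := _root_.map_dvd absNorm h1
  rw [map_prod, absNorm_span_singleton, ← map_natCast (algebraMap ℤ (𝓞 L)), Algebra.norm_algebraMap,
      Int.natAbs_pow, Int.natAbs_natCast] at h2
  have h3 : p ^ F.card ∣ ∏ P ∈ F, absNorm P := by
    rw [← Finset.prod_const]
    refine Finset.prod_dvd_prod_of_dvd _ _ fun P hP => ?_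
    rw [← (hF P hP).2.2]; exact Nat.minFac_dvd _
  exact (Nat.pow_dvd_pow_iff_le_right hp.one_lt).1 (h3.trans h2)
end Ono

namespace Ono
open Filter Topology Nat NumberField Ideal
open scoped nonZeroDivisors
variable (L : Type*) [Field L] [NumberField L]
noncomputable def aL (p : ℕ) : ℝ :=
  if p.Prime then (((FI L p).filter (absNorm · = p)).card : ℝ) else 0
theorem FI_mono : Monotone (fun y : ℝ => ((FI L y).card : ℝ)) := fun a b h => by
  refine Nat.cast_le.2 (Finset.card_le_card fun I hI => ?_)
  rw [mem_FI] at *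
  exact ⟨hI.1, hI.2.trans (Nat.floor_mono h)⟩
theorem FI_le : ∃ C : ℝ, 0 < C ∧ ∀ y : ℝ, 0 < y → ((FI L y).card : ℝ) ≤ C * y := by
  have h := (tendsto_FI L).eventually_lt_const (lt_add_one _)
  obtain ⟨y0, h0⟩ := eventually_atTop.1 (h.and (eventually_ge_atTop 1))
  set r := dedekindZeta_residue L
  have hr : 0 < r := dedekindZeta_residue_pos L
  have hy0 : 1 ≤ y0 := (h0 y0 le_rfl).2
  refine ⟨(r + 1) * (y0 + 1), by positivity, fun y hy => ?_⟩
  rcases lt_or_ge y 1 with h1 | h1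
  · have : FI L y = ∅ := Finset.eq_empty_of_forall_notMem fun I hI => by
      obtain ⟨h2, h3⟩ := mem_FI.1 hI
      rw [Nat.floor_eq_zero.2 h1] at h3
      have := norm_pos h2
      omega
    rw [this]; simp; positivity
  · have key : ∀ z, y0 ≤ z → ((FI L z).card : ℝ) ≤ (r + 1) * z := fun z hz => by
      have := (h0 z hz).1
      rw [div_lt_iff₀ (by linarith)] at this
      exact this.le
    rcases le_total y0 y with h2 | h2
    · refine (key y h2).trans ?_
      have : 0 ≤ (r+1) * y0 * y := by positivity
      nlinarith
    · refine (FI_mono L h2).trans ((key y0 le_rfl).trans ?_)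
      have : 0 < r + 1 := by linarith
      rw [mul_assoc]
      gcongr
      nlinarith
theorem geom_bd {q : ℝ} (hq : 2 ≤ q) (a K : ℕ) : ∑ k ∈ Finset.Icc a K, (1 / q) ^ k ≤ 2 * (1 / q) ^ a := by
  have h1 : 1 / q ≤ 1 / 2 := one_div_le_one_div_of_le two_pos hq
  have h0 : 0 ≤ 1 / q := by positivity
  have := geom_sum_Ico_le_of_lt_one (m := a) (n := K + 1) h0 (by linarith)
  have h2 : Finset.Icc a K = Finset.Ico a (K+1) := by grind
  rw [h2]
  refine this.trans ?_
  rw [div_le_iff₀ (by linarith)]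
  have := pow_nonneg h0 a
  nlinarith
theorem log_bd {q m : ℕ} (hq : 2 ≤ q) (hm : m = q.minFac) (K : ℕ) :
    ∑ k ∈ Finset.Icc 1 K, (if k = 1 ∧ q.Prime then 0 else Real.log q * (1 / (q:ℝ)) ^ k)
      ≤ 8 * (m : ℝ) ^ (-(3/2) : ℝ) := by
  have hq' : (2:ℝ) ≤ q := by exact_mod_cast hq
  have hq0 : (0:ℝ) < q := by linarith
  have hl : Real.log q ≤ 4 * (q:ℝ) ^ (1/4 : ℝ) := by
    refine (Real.log_le_rpow_div hq0.le (by norm_num : (0:ℝ) < 1/4)).trans (le_of_eq (by ring))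
  have hl0 : 0 ≤ Real.log q := Real.log_nonneg (by linarith)
  by_cases hp : q.Prime
  · have h1 : ∑ k ∈ Finset.Icc 1 K, (if k = 1 ∧ q.Prime then 0 else Real.log q * (1 / (q:ℝ)) ^ k)
      ≤ ∑ k ∈ Finset.Icc 2 K, Real.log q * (1 / (q:ℝ)) ^ k := by
      rw [← Finset.sum_filter_of_ne (p := fun k => k ≠ 1) (by
        grind)]
      refine le_trans (Finset.sum_le_sum_of_subset_of_nonneg (t := Finset.Icc 2 K) ?_ ?_) (Finset.sum_le_sum ?_)
      · grind
      · grind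
      grind
    refine h1.trans ?_
    rw [← Finset.mul_sum]
    refine (mul_le_mul hl (geom_bd hq' 2 K) (Finset.sum_nonneg fun _ _ => by positivity) (by positivity)).trans ?_
    have hmq : m = q := by rw [hm, hp.minFac_eq]
    have e1 : (1 / (q:ℝ)) ^ 2 = (q:ℝ) ^ (-2 : ℝ) := by
      rw [Real.rpow_neg hq0.le]; simp
    have e2 : (q:ℝ) ^ (1/4 : ℝ) * (q:ℝ) ^ (-2 : ℝ) ≤ (q:ℝ) ^ (-(3/2) : ℝ) := by
      rw [← Real.rpow_add hq0]
      exact Real.rpow_le_rpow_of_exponent_le (by linarith) (by norm_num)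
    rw [e1, hmq]; nlinarith
  · simp only [hp, and_false, if_false]
    rw [← Finset.mul_sum]
    refine (mul_le_mul hl (geom_bd hq' 1 K) (Finset.sum_nonneg fun _ _ => by positivity) (by positivity)).trans ?_
    have hm0 : (0:ℝ) < m := by rw [hm]; exact_mod_cast Nat.minFac_pos q
    have hmq : (m:ℝ) ^ (2:ℝ) ≤ q := by
      rw [Real.rpow_two, hm]; exact_mod_cast Nat.minFac_sq_le_self (by omega) hp
    have e1 : (1 / (q:ℝ)) ^ 1 = (q:ℝ) ^ (-1 : ℝ) := by
      rw [Real.rpow_neg hq0.le]; simp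
    have e2 : (q:ℝ) ^ (1/4 : ℝ) * (q:ℝ) ^ (-1 : ℝ) ≤ (m:ℝ) ^ (-(3/2) : ℝ) := by
      rw [← Real.rpow_add hq0]
      calc _ ≤ ((m:ℝ) ^ (2:ℝ)) ^ (-(3/4) : ℝ) := by
            rw [show (1/4 + -1 : ℝ) = -(3/4) by norm_num]
            exact Real.rpow_le_rpow_of_nonpos (by positivity) hmq (by norm_num)
        _ = _ := by rw [← Real.rpow_mul hm0.le]; norm_num
    rw [e1]; nlinarith
open scoped Classical in
theorem hasD_aL : HasD (aL L) 1 := by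
  obtain ⟨C, hC, hS⟩ := FI_le L
  set n : ℝ := (Module.finrank ℤ (𝓞 L) : ℝ)
  set Z : ℝ := ∑' p : ℕ, (p:ℝ) ^ (-(3/2) : ℝ)
  have hZ : Summable (fun p : ℕ => (p:ℝ) ^ (-(3/2) : ℝ)) := Real.summable_nat_rpow.2 (by norm_num)
  have hP : ∀ {X : ℝ} {I}, I ∈ FI L X → (absNorm I).Prime → I.IsPrime := fun _ h =>
    Ideal.isPrime_of_irreducible_absNorm h
  refine hasD_of_count (S := fun y => ((FI L y).card : ℝ)) (n := n)
    (L := fun X => ∑ I ∈ FI L X, Real.log (absNorm I)) (C := 8 * C * n * Z)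
    (dedekindZeta_residue_pos L) (tendsto_FI L) (FI_mono L) (fun _ => by positivity) ?_ ?_ ?_ ?_ ?_
  · intro p; unfold aL; grind
  · intro p; unfold aL; split_ifs with h
    · refine Nat.cast_le.2 (card_over L p h _ fun P hP => ?_)
      obtain ⟨h1, h2⟩ := Finset.mem_filter.1 hP
      have h2' : (absNorm P).Prime := by rwa [h2]
      exact ⟨(mem_FI.1 h1).1, Ideal.isPrime_of_irreducible_absNorm h2', by rw [h2, h.minFac_eq]⟩
    · positivity
  · intro X hX
    rw [← nsmul_eq_mul]
    refine Finset.sum_le_card_nsmul _ _ _ fun I hI => ?_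
    obtain ⟨h1, h2⟩ := mem_FI.1 hI
    exact Real.log_le_log (by exact_mod_cast norm_pos h1) ((Nat.le_floor_iff (by linarith)).1 h2)
  · intro X Y hY hXY
    have hsub : FI L Y ⊆ FI L X := fun I hI => by
      rw [mem_FI] at *; exact ⟨hI.1, hI.2.trans (Nat.floor_mono hXY)⟩
    have h1 : ((FI L X).card : ℝ) - (FI L Y).card = ((FI L X \ FI L Y).card : ℝ) := by
      rw [Finset.cast_card_sdiff hsub]
    rw [h1, ← nsmul_eq_mul]
    refine (Finset.card_nsmul_le_sum _ (fun I => Real.log (absNorm I)) _ fun I hI => ?_).trans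
      (Finset.sum_le_sum_of_subset_of_nonneg Finset.sdiff_subset fun I hI _ => Real.log_natCast_nonneg _)
    obtain ⟨h1, h2⟩ := Finset.mem_sdiff.1 hI
    rw [mem_FI] at h1 h2
    have h3 : ⌊Y⌋₊ < absNorm I := by grind
    exact Real.log_le_log (by linarith) ((Nat.floor_lt (by linarith)).1 h3).le
  · intro X hX
    have hX1 : 1 ≤ ⌊X⌋₊ := (Nat.one_le_floor_iff X).2 hX
    set T := (FI L X).filter (·.IsPrime)
    set t : Ideal (𝓞 L) → ℕ → ℝ := fun P k => Real.log (absNorm P) * ((FI L (X / (absNorm P : ℝ) ^ k)).card : ℝ)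
    have ht0 : ∀ P k, 0 ≤ t P k := fun P k => mul_nonneg (Real.log_natCast_nonneg _) (by positivity)
    have hgood : ∑ p ∈ primesLE ⌊X⌋₊, aL L p * Real.log p * ((FI L (X / p)).card : ℝ) =
        ∑ P ∈ T, ∑ k ∈ Finset.Icc 1 ⌊X⌋₊, if k = 1 ∧ (absNorm P).Prime then t P k else 0 := by
      have e1 : ∀ P ∈ T, (∑ k ∈ Finset.Icc 1 ⌊X⌋₊, if k = 1 ∧ (absNorm P).Prime then t P k else 0) =
          if (absNorm P).Prime then t P 1 else 0 := fun P _ => by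
        rw [Finset.sum_eq_single 1 (fun k _ hk => by simp [hk]) (fun h => absurd (Finset.mem_Icc.2 ⟨le_rfl, hX1⟩) h)]
        simp
      rw [Finset.sum_congr rfl e1, ← Finset.sum_filter,
        ← Finset.sum_fiberwise_of_maps_to (t := primesLE ⌊X⌋₊) (g := fun P => absNorm P)]
      · refine Finset.sum_congr rfl fun p hp => ?_
        obtain ⟨hp1, hp2⟩ := Nat.mem_primesLE.1 hp
        rw [Finset.sum_congr rfl (g := fun _ => Real.log p * ((FI L (X / p)).card : ℝ)), Finset.sum_const, nsmul_eq_mul,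
          mul_assoc]
        · congr 2
          rw [aL, if_pos hp2]
          congr 2
          ext P
          simp only [Finset.mem_filter, mem_FI, T, Nat.floor_natCast]
          constructor
          · rintro ⟨⟨h1, h2⟩, rfl⟩
            exact ⟨⟨⟨⟨h1, hp1⟩, Ideal.isPrime_of_irreducible_absNorm hp2⟩, hp2⟩, rfl⟩
          grind
        grind
      · intro P hP
        simp only [Finset.mem_filter, mem_FI, T] at hP
        exact Nat.mem_primesLE.2 ⟨hP.1.1.2, hP.2⟩
    rw [sum_log_norm, hgood, ← Finset.sum_sub_distrib]
    simp only [← Finset.sum_sub_distrib]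
    set b : Ideal (𝓞 L) → ℝ := fun P => ∑ k ∈ Finset.Icc 1 ⌊X⌋₊, (t P k - if k = 1 ∧ (absNorm P).Prime then t P k else 0)
    have hb0 : ∀ P, 0 ≤ b P := fun P => Finset.sum_nonneg fun k _ => by
      grind
    change |∑ P ∈ T, b P| ≤ _
    rw [abs_of_nonneg (Finset.sum_nonneg fun P _ => hb0 P)]
    have hb : ∀ P ∈ T, b P ≤ 8 * C * X * ((absNorm P).minFac : ℝ) ^ (-(3/2) : ℝ) := fun P hP => by
      obtain ⟨h1, h2⟩ := Finset.mem_filter.1 hP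
      have hq := two_le_norm (mem_FI.1 h1).1 h2
      refine (Finset.sum_le_sum (g := fun k => C * X * (if k = 1 ∧ (absNorm P).Prime then 0 else Real.log (absNorm P) * (1 / (absNorm P:ℝ)) ^ k)) fun k _ => ?_).trans ?_
      · split_ifs
        · simp
        · have h0 : (0:ℝ) < absNorm P := by exact_mod_cast (by omega : 0 < absNorm P)
          have := mul_le_mul_of_nonneg_left (hS (X / (absNorm P:ℝ) ^ k) (by positivity)) (Real.log_natCast_nonneg (absNorm P))
          refine (sub_zero (t P k)).le.trans (this.trans (le_of_eq ?_))
          rw [one_div, inv_pow]; ring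
      · rw [← Finset.mul_sum]
        have := mul_le_mul_of_nonneg_left (log_bd hq rfl ⌊X⌋₊) (by positivity : 0 ≤ C * X)
        linarith
    refine (Finset.sum_le_sum hb).trans ?_
    rw [← Finset.sum_fiberwise_of_maps_to (t := primesLE ⌊X⌋₊) (g := fun P => (absNorm P).minFac)]
    · have : ∀ p ∈ primesLE ⌊X⌋₊, ∑ P ∈ T with (absNorm P).minFac = p, 8 * C * X * ((absNorm P).minFac : ℝ) ^ (-(3/2) : ℝ)
          ≤ 8 * C * X * n * (p:ℝ) ^ (-(3/2) : ℝ) := fun p hp => by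
        rw [Finset.sum_congr rfl (g := fun _ => 8 * C * X * (p:ℝ) ^ (-(3/2) : ℝ)), Finset.sum_const, nsmul_eq_mul]
        · have : (((T.filter fun P => (absNorm P).minFac = p).card : ℕ) : ℝ) ≤ n := Nat.cast_le.2 (card_over L p (Nat.mem_primesLE.1 hp).2 _ fun P hP => by
            simp only [Finset.mem_filter, mem_FI, T] at hP
            grind)
          have h0 : 0 ≤ 8 * C * X * (p:ℝ) ^ (-(3/2) : ℝ) := by positivity
          nlinarith
        grind
      refine (Finset.sum_le_sum this).trans ?_
      rw [← Finset.mul_sum]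
      have h2 := hZ.sum_le_tsum (primesLE ⌊X⌋₊) (fun p _ => by positivity)
      have := mul_le_mul_of_nonneg_left h2 (by positivity : 0 ≤ 8 * C * X * n)
      linarith
    · intro P hP
      simp only [Finset.mem_filter, mem_FI, T] at hP
      have := two_le_norm hP.1.1 hP.2
      exact Nat.mem_primesLE.2 ⟨(Nat.minFac_le (by omega)).trans hP.1.2, Nat.minFac_prime (by omega)⟩
end Ono

namespace Ono
open Filter Topology Nat NumberField Ideal
theorem psum_congr {h h' : ℕ → ℝ} {X : ℝ} (H : ∀ p : ℕ, p.Prime → h p = h' p) : psum h X = psum h' X :=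
  Finset.sum_congr rfl fun p hp => by rw [H p (Nat.mem_primesLE.1 hp).2]
theorem HasD.congr_off {h h' : ℕ → ℝ} {κ : ℝ} (H : HasD h κ) (M : ℕ) (hM : M ≠ 0)
    (e : ∀ p : ℕ, p.Prime → ¬ p ∣ M → h p = h' p) : HasD h' κ := by
  set C := ∑ p ∈ Finset.range (M + 1), |h' p - h p| * |Real.log p / p|
  have h1 : ∀ X, |psum h' X - psum h X| ≤ C := fun X => by
    unfold psum
    rw [← Finset.sum_sub_distrib, ← Finset.sum_filter_of_ne (p := fun p => p ∈ Finset.range (M+1))]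
    · refine (Finset.abs_sum_le_sum_abs _ _).trans ?_
      refine (Finset.sum_le_sum fun p _ => ?_).trans (Finset.sum_le_sum_of_subset_of_nonneg
        (fun p hp => (Finset.mem_filter.1 hp).2) fun _ _ _ => by positivity)
      rw [← sub_mul, abs_mul]
    · intro p hp hne
      by_contra hlt
      refine hne ?_
      rw [e p (Nat.mem_primesLE.1 hp).2 fun hd => hlt ?_, sub_self]
      exact Finset.mem_range.2 (Nat.lt_succ_of_le (Nat.le_of_dvd (Nat.pos_of_ne_zero hM) hd))
  have h2 : Tendsto (fun X : ℝ => (psum h' X - psum h X) / Real.log X) atTop (𝓝 0) := by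
    refine squeeze_zero_norm' ?_ (one_div_log_tendsto C)
    filter_upwards [eventually_ge_atTop 1] with X hX
    rw [Real.norm_eq_abs, abs_div, abs_of_nonneg (Real.log_nonneg hX)]
    exact div_le_div_of_nonneg_right (h1 X) (Real.log_nonneg hX)
  have := h2.add H
  rw [zero_add] at this
  refine this.congr fun X => ?_
  ring
theorem HasD.add {h h' : ℕ → ℝ} {κ κ' : ℝ} (H : HasD h κ) (H' : HasD h' κ') :
    HasD (fun p => h p + h' p) (κ + κ') := by
  refine (Tendsto.add H H').congr fun X => ?_
  simp only [psum, add_mul, Finset.sum_add_distrib, add_div]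
theorem HasD.const_mul {h : ℕ → ℝ} {κ : ℝ} (H : HasD h κ) (c : ℝ) : HasD (fun p => c * h p) (c * κ) := by
  refine (Tendsto.const_mul c H).congr fun X => ?_
  simp only [psum, mul_assoc, ← Finset.mul_sum, mul_div_assoc]
theorem HasD.sum {ι : Type*} (s : Finset ι) {h : ι → ℕ → ℝ} {κ : ι → ℝ} (H : ∀ i ∈ s, HasD (h i) (κ i)) :
    HasD (fun p => ∑ i ∈ s, h i p) (∑ i ∈ s, κ i) := by
  refine (tendsto_finsetSum s H).congr fun X => ?_
  simp only [psum, Finset.sum_mul]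
  rw [Finset.sum_comm, Finset.sum_div]
theorem aL_eq (L : Type*) [Field L] [NumberField L] (p : ℕ) (hp : p.Prime) :
    aL L p = Nat.card (𝓞 L →+* ZMod p) := by
  have := Fact.mk hp
  rw [aL, if_pos hp, ← Nat.card_eq_finsetCard]
  congr 1
  symm
  have key : ∀ f : 𝓞 L →+* ZMod p, absNorm (RingHom.ker f) = p := fun f => by
    rw [absNorm_apply, Submodule.cardQuot_apply,
      Nat.card_congr (RingHom.quotientKerEquivOfSurjective (ZMod.ringHom_surjective f)).toEquiv, Nat.card_zmod]
  refine Nat.card_congr (Equiv.ofBijective (fun f => ⟨RingHom.ker f, Finset.mem_filter.2 ⟨mem_FI.2 ⟨?_, ?_⟩, key f⟩⟩) ⟨?_, ?_⟩)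
  · intro h
    have := key f
    rw [h, absNorm_bot] at this
    exact hp.ne_zero this.symm
  · rw [key f, Nat.floor_natCast]
  · intro f g h
    exact ZMod.ringHom_eq_of_ker_eq f g (congrArg Subtype.val h)
  · rintro ⟨I, hI⟩
    have h1 := (Finset.mem_filter.1 hI).2
    have h0 : Nat.card (𝓞 L ⧸ I) = p := by rw [← h1, absNorm_apply, Submodule.cardQuot_apply]
    have : Finite (𝓞 L ⧸ I) := Nat.finite_of_card_ne_zero (by rw [h0]; exact hp.ne_zero)
    have := Fintype.ofFinite (𝓞 L ⧸ I)
    let e := ZMod.ringEquivOfPrime (𝓞 L ⧸ I) hp (by rw [← Nat.card_eq_fintype_card, h0])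
    refine ⟨(e.symm : (𝓞 L ⧸ I) →+* ZMod p).comp (Ideal.Quotient.mk I), Subtype.ext ?_⟩
    ext x
    rw [RingHom.mem_ker]
    simp [Ideal.Quotient.eq_zero_iff_mem]
structure Ord (R L : Type*) [CommRing R] [Field L] (j : R →+* L) : Prop where
  inj : Function.Injective j
  int : ∀ r, IsIntegral ℤ (j r)
  den : ∀ x : L, ∃ n : ℕ, n ≠ 0 ∧ ∃ r, j r = n * x
theorem Ord.exists_M {R L : Type*} [CommRing R] [Field L] [NumberField L] {j : R →+* L} (h : Ord R L j) :
    ∃ M : ℕ, M ≠ 0 ∧ ∀ x : 𝓞 L, ∃ r, j r = M * (x : L) := by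
  classical
  obtain ⟨s, hs⟩ := (inferInstance : Module.Finite ℤ (𝓞 L)).fg_top
  choose n hn r hr using h.den
  refine ⟨∏ y ∈ s, n y, Finset.prod_ne_zero_iff.2 fun y _ => hn _, fun x => ?_⟩
  have hx : x ∈ Submodule.span ℤ (s : Set (𝓞 L)) := by rw [hs]; trivial
  induction hx using Submodule.span_induction with
  | mem y hy =>
    refine ⟨(∏ z ∈ s.erase y, n z : ℕ) * r y, ?_⟩
    rw [map_mul, hr, map_natCast, ← mul_assoc, ← Nat.cast_mul, Finset.prod_erase_mul _ _ hy]
  | zero => exact ⟨0, by simp⟩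
  | add y z _ _ h1 h2 =>
    obtain ⟨a, ha⟩ := h1
    obtain ⟨b, hb⟩ := h2
    exact ⟨a + b, by grind⟩
  | smul c y _ h1 =>
    obtain ⟨a, ha⟩ := h1
    exact ⟨c * a, by rw [map_mul, ha]; simp; ring⟩
theorem Ord.hasD {R L : Type*} [CommRing R] [Field L] [NumberField L] {j : R →+* L} (h : Ord R L j) :
    HasD (fun p => (Nat.card (R →+* ZMod p) : ℝ)) 1 := by
  obtain ⟨M, hM, hr⟩ := h.exists_M
  choose r hr using hr
  refine (hasD_aL L).congr_off M hM fun p hp hpM => ?_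
  have := Fact.mk hp
  rw [aL_eq L p hp]
  congr 1
  let j' : R →+* 𝓞 L := j.codRestrict (integralClosure ℤ L) h.int
  have hj' : ∀ x, j' (r x) = M * x := fun x => by
    apply RingOfIntegers.ext
    push_cast
    exact hr x
  have hM' : (M : ZMod p) ≠ 0 := by rwa [Ne, ZMod.natCast_eq_zero_iff]
  refine Nat.card_congr (Equiv.ofBijective (fun f => f.comp j') ⟨?_, ?_⟩)
  · intro f g hfg
    ext1 x
    have h1 := RingHom.congr_fun hfg (r x)
    simp only [RingHom.comp_apply, hj', map_mul, map_natCast] at h1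
    grind
  · intro ψ
    have hinj : ∀ a b, j a = j b → a = b := fun a b => @h.inj a b
    have e : ∀ a (x : 𝓞 L), j a = M * M * (x : L) → ψ a = M * ψ (r x) := fun a x ha => by
      rw [← map_natCast ψ, ← map_mul]
      congr 1
      apply hinj
      rw [map_mul, hr, ha, map_natCast, mul_assoc]
    refine ⟨RingHom.mk' ⟨⟨fun x => (M : ZMod p)⁻¹ * ψ (r x), ?_⟩, ?_⟩ ?_, ?_⟩
    · have : r 1 = M := hinj _ _ (by rw [hr]; simp)
      rw [this, map_natCast, inv_mul_cancel₀ hM']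
    · intro x y
      have := e (r x * r y) (x * y) (by grind)
      grind
    · intro x y
      have : r (x + y) = r x + r y := hinj _ _ (by grind)
      change (M : ZMod p)⁻¹ * ψ (r (x + y)) = _
      rw [this, map_add, mul_add]; rfl
    · ext a
      change (M : ZMod p)⁻¹ * ψ (r (j' a)) = ψ a
      have : r (j' a) = M * a := hinj _ _ (by rw [hr]; simp; left; rfl)
      rw [this, map_mul, map_natCast, inv_mul_cancel_left₀ hM']
theorem ord_int : Ord ℤ ℚ (Int.castRingHom ℚ) where
  inj := Int.cast_injective
  int r := by simpa using isIntegral_algebraMap (R := ℤ) (A := ℚ) (x := r)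
  den x := ⟨x.den, x.den_nz, x.num, by simp [mul_comm, Rat.mul_den_eq_num]⟩
theorem ord_quad {R L : Type*} [CommRing R] [Field L] [NumberField L] {j : R →+* L} (h : Ord R L j)
    {δ : R} (hδ : ∀ x : L, x ^ 2 ≠ j δ) :
    HasD (fun p => (Nat.card (QuadraticAlgebra R δ 0 →+* ZMod p) : ℝ)) 1 := by
  have : Fact (∀ r : L, r ^ 2 ≠ j δ + 0 * r) := ⟨by simpa using hδ⟩
  let g : L × L →+ QuadraticAlgebra L (j δ) 0 :=
    ⟨⟨fun x => ⟨x.1, x.2⟩, rfl⟩, fun x y => by ext <;> simp⟩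
  have hc : CharZero (QuadraticAlgebra L (j δ) 0) := ⟨fun a b hab => by
    simpa using congrArg QuadraticAlgebra.re hab⟩
  have : NumberField (QuadraticAlgebra L (j δ) 0) := 
    { to_charZero := hc
      to_finiteDimensional := Module.Finite.of_surjective g.toRatLinearMap fun x => ⟨(x.re, x.im), rfl⟩ }
  let j2 : QuadraticAlgebra R δ 0 →+* QuadraticAlgebra L (j δ) 0 :=
    ⟨⟨⟨fun x => ⟨j x.re, j x.im⟩, by ext <;> simp [QuadraticAlgebra.re_one, QuadraticAlgebra.im_one]⟩, fun x y => by ext <;> simp⟩, by ext <;> simp,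
      fun x y => by ext <;> simp⟩
  have hC : ∀ x : L, IsIntegral ℤ x → IsIntegral ℤ (algebraMap L (QuadraticAlgebra L (j δ) 0) x) :=
    fun x hx => hx.map ((algebraMap L (QuadraticAlgebra L (j δ) 0)).toIntAlgHom)
  have o : Ord _ _ j2 := by
    refine ⟨fun x y hxy => ?_, fun x => ?_, fun x => ?_⟩
    · ext
      · exact h.inj (congrArg QuadraticAlgebra.re hxy)
      · exact h.inj (congrArg QuadraticAlgebra.im hxy)
    · have : j2 x = algebraMap L _ (j x.re) + algebraMap L _ (j x.im) * QuadraticAlgebra.omega := by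
        ext <;> simp [j2]
      rw [this]
      refine (hC _ (h.int _)).add ((hC _ (h.int _)).mul (IsIntegral.of_pow two_pos ?_))
      rw [pow_two, QuadraticAlgebra.omega_mul_omega_eq_add]
      simpa [Algebra.smul_def] using hC _ (h.int δ)
    · obtain ⟨n, hn, r, hr⟩ := h.den x.re
      obtain ⟨m, hm, s, hs⟩ := h.den x.im
      refine ⟨n * m, mul_ne_zero hn hm, ⟨m * r, n * s⟩, ?_⟩
      ext
      · simp [j2, hr]; ring
      · simp [j2, hs]; ring
  exact o.hasD
theorem card_quad {R : Type*} [CommRing R] (δ : R) (p : ℕ) [Fact p.Prime] [Fintype (R →+* ZMod p)] (hp : p ≠ 2) :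
    (Nat.card (QuadraticAlgebra R δ 0 →+* ZMod p) : ℤ) = ∑ u : R →+* ZMod p, (quadraticChar (ZMod p) (u δ) + 1) := by
  have e : (QuadraticAlgebra R δ 0 →+* ZMod p) ≃ Σ u : R →+* ZMod p, {y : ZMod p // y ^ 2 = u δ} :=
    { toFun := fun f => ⟨f.comp (algebraMap R _), f QuadraticAlgebra.omega, by
        rw [← map_pow, pow_two, QuadraticAlgebra.omega_mul_omega_eq_add]; simp [Algebra.smul_def]⟩
      invFun := fun x => ⟨⟨⟨fun z => x.1 z.re + x.1 z.im * x.2.1, by simp [QuadraticAlgebra.re_one, QuadraticAlgebra.im_one]⟩, fun z w => by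
          simp; grind⟩, by simp, fun z w => by simp; ring⟩
      left_inv := fun f => by
        ext z
        have : z = algebraMap R _ z.re + algebraMap R _ z.im * QuadraticAlgebra.omega := by ext <;> simp
        conv_rhs => rw [this, map_add, map_mul]
        rfl
      right_inv := fun ⟨u, y, hy⟩ => by
        have : ∀ (ψ : R →+* ZMod p) (w : {y : ZMod p // y ^ 2 = ψ δ}), ψ = u → w.1 = y →
          (⟨ψ, w⟩ : Σ u : R →+* ZMod p, {y : ZMod p // y ^ 2 = u δ}) = ⟨u, y, hy⟩ := by
            grind
        apply this
        · ext r; simp [QuadraticAlgebra.algebraMap_eq]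
        · simp }
  rw [Nat.card_congr e, Nat.card_sigma]
  push_cast
  refine Finset.sum_congr rfl fun u _ => ?_
  rw [← quadraticChar_card_sqrts (by rwa [ZMod.ringChar_zmod_n]) (u δ)]
  rw [Nat.card_eq_fintype_card, Set.toFinset_card]
  norm_cast
end Ono

namespace Ono
open Filter Topology NumberField
open scoped NumberTheorySymbols
open Cub
variable {A B : ℤ}
@[reducible] noncomputable def cubField (hf : ∀ x : ℚ, x ^ 3 + A * x + B ≠ 0) : Field (Cub ℚ A B) :=
  { (inferInstance : CommRing (Cub ℚ A B)) with
    inv := fun x => of A B (N x)⁻¹ * adj x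
    exists_pair_ne := ⟨0, 1, fun h => by simpa using congrArg Cub.a h⟩
    mul_inv_cancel := fun x hx => by
      change x * (of A B (N x)⁻¹ * adj x) = 1
      rw [mul_left_comm, mul_adj, ← map_mul, inv_mul_cancel₀ (N_ne_zero hf hx), map_one]
    inv_zero := by change of A B (N 0)⁻¹ * adj 0 = 0; simp [N, adj]
    nnqsmul := _
    qsmul := _ }
theorem cub_numberField (hf : ∀ x : ℚ, x ^ 3 + A * x + B ≠ 0) :
    letI := cubField hf; NumberField (Cub ℚ A B) := by
  letI := cubField hf
  let g : ℚ × ℚ × ℚ →+ Cub ℚ A B :=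
    ⟨⟨fun x => ⟨x.1, x.2.1, x.2.2⟩, rfl⟩, fun x y => by ext <;> simp⟩
  have hc : CharZero (Cub ℚ A B) := ⟨fun a b hab => by
    have := congrArg Cub.a hab
    simp only [natCast_a] at this
    exact_mod_cast this⟩
  exact { to_charZero := hc
          to_finiteDimensional := Module.Finite.of_surjective g.toRatLinearMap
            fun x => ⟨(x.a, x.b, x.c), rfl⟩ }
theorem cub_ord (hf : ∀ x : ℚ, x ^ 3 + A * x + B ≠ 0) :
    letI := cubField hf; Ord (Cub ℤ A B) (Cub ℚ A B) (Cub.map (Int.castRingHom ℚ)) := by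
  letI := cubField hf
  refine ⟨Cub.map_injective Int.cast_injective, fun r => ?_, fun x => ?_⟩
  · have hC : ∀ n : ℤ, IsIntegral ℤ (of A B (n : ℚ)) := fun n => by
      have := isIntegral_algebraMap (R := ℤ) (A := Cub ℚ A B) (x := n)
      convert this using 1
      simp
    have hθ : IsIntegral ℤ (θ : Cub ℚ A B) := by
      refine ⟨Polynomial.X ^ 3 + Polynomial.C A * Polynomial.X + Polynomial.C B, by monicity!, ?_⟩
      rw [← Polynomial.aeval_def]
      have := θ_eq (R := ℚ) (A := A) (B := B)
      simpa using this
    rw [eq_of (Cub.map _ r)]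
    exact ((hC _).add ((hC _).mul hθ)).add ((hC _).mul (hθ.pow 2))
  · refine ⟨x.a.den * x.b.den * x.c.den, by simp, ⟨x.a.num * x.b.den * x.c.den, x.a.den * x.b.num * x.c.den, x.a.den * x.b.den * x.c.num⟩, ?_⟩
    have e1 := Rat.mul_den_eq_num x.a
    have e2 := Rat.mul_den_eq_num x.b
    have e3 := Rat.mul_den_eq_num x.c
    ext <;> simp only [map_a, map_b, map_c, mul_a, mul_b, mul_c, natCast_a, natCast_b, natCast_c, eq_intCast] <;> push_cast
    · grind
    · grind
    grind
def evr {S : Type*} [CommRing S] (r : S) (x : Cub ℤ A B) : S := x.a + x.b * r + x.c * r ^ 2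
theorem evr_mul {S : Type*} [CommRing S] {r : S} (h : r ^ 3 + A * r + B = 0) (x y : Cub ℤ A B) :
    evr r (x * y) = evr r x * evr r y := (ev (Int.castRingHom S) r h).map_mul x y
theorem evr_of {S : Type*} [CommRing S] (r : S) (n : ℤ) : evr r (of A B n) = n := by simp [evr]
def homEquiv (p : ℕ) : (Cub ℤ A B →+* ZMod p) ≃ {r : ZMod p // r ^ 3 + A * r + B = 0} where
  toFun f := ⟨f θ, by
    have := congrArg f (θ_eq (R := ℤ) (A := A) (B := B))
    simpa using this⟩
  invFun r := ev (Int.castRingHom _) r.1 r.2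
  left_inv f := by
    ext x
    rw [ev_apply]
    conv_rhs => rw [eq_of x]
    have : ∀ n : ℤ, f (of A B n) = n := fun n => by simp
    simp [this]
  right_inv r := by ext; simp [ev_apply]
def rts (A B : ℤ) (p : ℕ) [NeZero p] : Finset (ZMod p) := Finset.univ.filter fun r => r ^ 3 + A * r + B = 0
theorem mem_rts {p : ℕ} [NeZero p] {r : ZMod p} : r ∈ rts A B p ↔ r ^ 3 + A * r + B = 0 := by simp [rts]
open scoped Classical in
noncomputable def Tc (δ : Cub ℤ A B) (p : ℕ) : ℤ :=
  if h : p.Prime then haveI := Fact.mk h; ∑ r ∈ rts A B p, quadraticChar (ZMod p) (evr r δ) else 0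
theorem Tc_eq (δ : Cub ℤ A B) (p : ℕ) [h : Fact p.Prime] :
    Tc δ p = ∑ r ∈ rts A B p, quadraticChar (ZMod p) (evr r δ) := by
  rw [Tc, dif_pos h.out]
noncomputable def nf (A B : ℤ) (p : ℕ) : ℕ := Nat.card {r : ZMod p // r ^ 3 + A * r + B = 0}
theorem nf_eq (p : ℕ) [h : Fact p.Prime] : nf A B p = (rts A B p).card := by
  rw [nf, rts, ← Nat.card_eq_finsetCard]; simp
theorem hasD_one : HasD (fun _ => 1) 1 := by
  refine ord_int.hasD.congr_off 1 one_ne_zero fun p hp _ => ?_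
  letI : Unique (ℤ →+* ZMod p) := ⟨⟨Int.castRingHom _⟩, fun _ => RingHom.ext_int _ _⟩
  simp
theorem hasD_nf (hf : ∀ x : ℚ, x ^ 3 + A * x + B ≠ 0) : HasD (fun p => (nf A B p : ℝ)) 1 := by
  letI := cubField hf
  haveI := cub_numberField hf
  have := (cub_ord hf).hasD
  simpa only [nf, Nat.card_congr (homEquiv _)] using this
theorem hasD_jac {d : ℤ} (hd : ¬ IsSquare d) : HasD (fun p => (J(d | p) : ℝ)) 0 := by
  have h := ord_quad ord_int (δ := d) (fun x hx => hd ?_)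
  · have h2 := h.add (hasD_one.const_mul (-1))
    rw [show (1:ℝ) + -1 * 1 = 0 by norm_num] at h2
    refine h2.congr_off 2 two_ne_zero fun p hp hp2 => ?_
    haveI := Fact.mk hp
    letI : Unique (ℤ →+* ZMod p) := ⟨⟨Int.castRingHom _⟩, fun _ => RingHom.ext_int _ _⟩
    have := card_quad (R := ℤ) d p (by rintro rfl; simp at hp2)
    have h3 : (Nat.card (QuadraticAlgebra ℤ d 0 →+* ZMod p) : ℝ) = ((quadraticChar (ZMod p) d + 1 : ℤ) : ℝ) := by
      rw [← Int.cast_natCast, this]; simp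
    rw [h3, ← jacobiSym.legendreSym.to_jacobiSym, legendreSym]
    push_cast; ring
  · rw [← Rat.isSquare_intCast_iff]; exact ⟨x, by rw [← pow_two, hx]; simp⟩
theorem hasD_Tc (hf : ∀ x : ℚ, x ^ 3 + A * x + B ≠ 0) {δ : Cub ℤ A B}
    (hδ : ∀ z : Cub ℚ A B, z ^ 2 ≠ Cub.map (Int.castRingHom ℚ) δ) : HasD (fun p => (Tc δ p : ℝ)) 0 := by
  letI := cubField hf
  haveI := cub_numberField hf
  have h := ord_quad (cub_ord hf) (δ := δ) hδ
  have h2 := h.add ((hasD_nf hf).const_mul (-1))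
  rw [show (1:ℝ) + -1 * 1 = 0 by norm_num] at h2
  refine h2.congr_off 2 two_ne_zero fun p hp hp2 => ?_
  haveI := Fact.mk hp
  letI : Fintype (Cub ℤ A B →+* ZMod p) := Fintype.ofEquiv _ (homEquiv p).symm
  have := card_quad (R := Cub ℤ A B) δ p (by rintro rfl; simp at hp2)
  have h3 : (Nat.card (QuadraticAlgebra (Cub ℤ A B) δ 0 →+* ZMod p) : ℤ) = Tc δ p + nf A B p := by
    rw [this, Tc_eq, nf_eq, ← (homEquiv p).symm.sum_comp, Finset.sum_add_distrib]
    congr 1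
    · exact (Finset.sum_subtype (rts A B p) (fun r => mem_rts) (fun r => quadraticChar (ZMod p) (evr r δ))).symm
    · simp [rts, Fintype.card_subtype]
  have h4 : (Nat.card (QuadraticAlgebra (Cub ℤ A B) δ 0 →+* ZMod p) : ℝ) = Tc δ p + nf A B p := by exact_mod_cast h3
  rw [h4]; ring
end Ono

namespace Ono
open Filter Topology
open scoped NumberTheorySymbols
open Cub
variable {A B : ℤ}
theorem HasD.exists_pos {F : ℕ → ℝ} {κ : ℝ} (H : HasD F κ) (hκ : 0 < κ) (M : ℕ) (hM : M ≠ 0) :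
    ∃ p : ℕ, p.Prime ∧ ¬ p ∣ M ∧ 0 < F p := by
  classical
  by_contra! hc
  have h1 : HasD (fun p => if p ∣ M then 0 else F p) κ :=
    H.congr_off M hM fun p _ hpM => by simp [hpM]
  refine absurd (le_of_tendsto h1 ?_) (not_le.2 hκ)
  filter_upwards [eventually_ge_atTop 1] with X hX
  refine div_nonpos_of_nonpos_of_nonneg (Finset.sum_nonpos fun p hp => ?_) (Real.log_nonneg hX)
  refine mul_nonpos_of_nonpos_of_nonneg ?_ (div_nonneg (Real.log_natCast_nonneg p) (by positivity))
  beta_reduce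
  split_ifs with h
  · rfl
  · exact hc p (Nat.mem_primesLE.1 hp).2 h
def Cd (η : ℤ) (N p : ℕ) : Prop := J(-1 | p) = η ∧ ∀ q ∈ N.primeFactors, J(q | p) = 1
def SS (N : ℕ) : Finset ℤ := insert (-1) (N.primeFactors.image fun q : ℕ => (q : ℤ))
def sg (η m : ℤ) : ℤ := if m = -1 then η else 1
noncomputable def W (η : ℤ) (N p : ℕ) : ℝ := ∏ m ∈ SS N, (1 + (sg η m * J(m | p) : ℤ))
theorem not_isSquare_prod {N : ℕ} {s : Finset ℤ} (hs : s ⊆ SS N) (hne : s.Nonempty) :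
    ¬ IsSquare (∏ m ∈ s, m) := by
  classical
  have hpr : ∀ m ∈ s, m ≠ -1 → ∃ q : ℕ, q.Prime ∧ m = q := fun m hm h1 => by
    rcases Finset.mem_insert.1 (hs hm) with h | h
    · exact absurd h h1
    grind
  by_cases h1 : (-1 : ℤ) ∈ s
  · rintro ⟨y, hy⟩
    rw [← Finset.mul_prod_erase s _ h1] at hy
    have : 0 < ∏ m ∈ s.erase (-1), m := Finset.prod_pos fun m hm => by
      obtain ⟨q, hq, rfl⟩ := hpr m (Finset.mem_of_mem_erase hm) (Finset.ne_of_mem_erase hm)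
      exact_mod_cast hq.pos
    nlinarith [mul_self_nonneg y]
  · obtain ⟨m, hm⟩ := hne
    obtain ⟨q, hq, rfl⟩ := hpr m hm (fun h => h1 (h ▸ hm))
    have hqp := Nat.prime_iff_prime_int.1 hq
    rintro ⟨y, hy⟩
    rw [← Finset.mul_prod_erase s _ hm] at hy
    have h2 : (q : ℤ) ∣ y := by
      have : (q : ℤ) ∣ y * y := ⟨_, hy.symm⟩
      exact (hqp.dvd_or_dvd this).elim id id
    obtain ⟨z, rfl⟩ := h2
    have h3 : ∏ m ∈ s.erase (q : ℤ), m = q * (z * z) := mul_left_cancel₀ hqp.ne_zero (by rw [hy]; ring)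
    obtain ⟨m, hm', hd⟩ := (hqp.dvd_finset_prod_iff _).1 ⟨_, h3⟩
    obtain ⟨q', hq', rfl⟩ := hpr m (Finset.mem_of_mem_erase hm') (fun h => h1 (h ▸ Finset.mem_of_mem_erase hm'))
    rw [Int.natCast_dvd_natCast, Nat.prime_dvd_prime_iff_eq hq hq'] at hd
    grind
theorem J_ne_zero {m : ℤ} {p : ℕ} (hp : p.Prime) (h : ¬ (p : ℤ) ∣ m) : J(m | p) = 1 ∨ J(m | p) = -1 := by
  refine jacobiSym.eq_one_or_neg_one ?_
  rw [Int.gcd_comm]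
  exact (Int.isCoprime_iff_gcd_eq_one.1 ((Nat.prime_iff_prime_int.1 hp).coprime_iff_not_dvd.2 h))
theorem W_eq {η : ℤ} (hη : η = 1 ∨ η = -1) {N p : ℕ} (hp : p.Prime) (hN : ¬ p ∣ N) :
    (Cd η N p → W η N p = 2 ^ (SS N).card) ∧ (¬ Cd η N p → W η N p = 0) := by
  have hne : ∀ q ∈ N.primeFactors, ¬ (p : ℤ) ∣ q := fun q hq h => hN (by
    rw [Int.natCast_dvd_natCast] at h
    exact h.trans (Nat.dvd_of_mem_primeFactors hq))
  constructor
  · rintro ⟨h1, h2⟩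
    rw [W, ← Finset.prod_const]
    refine Finset.prod_congr rfl fun m hm => ?_
    rcases Finset.mem_insert.1 hm with rfl | h
    · rw [h1]; rcases hη with rfl | rfl <;> simp [sg] <;> norm_num
    · obtain ⟨q, hq, rfl⟩ := Finset.mem_image.1 h
      rw [h2 q hq]; simp [sg]; norm_num
  · intro h
    rw [Cd, not_and_or] at h
    rw [W, Finset.prod_eq_zero_iff]
    rcases h with h | h
    · refine ⟨-1, Finset.mem_insert_self _ _, ?_⟩
      have := J_ne_zero (m := -1) hp (fun h => by
        rw [dvd_neg] at h; exact (Nat.prime_iff_prime_int.1 hp).not_dvd_one h)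
      rcases hη with rfl | rfl <;> rcases this with h' | h' <;> simp_all [sg]
    · push Not at h
      obtain ⟨q, hq, h'⟩ := h
      refine ⟨q, Finset.mem_insert_of_mem (Finset.mem_image_of_mem _ hq), ?_⟩
      have := (J_ne_zero hp (hne q hq)).resolve_left h'
      rw [this]; simp [sg]
theorem hasD_W_mul {η : ℤ} {N : ℕ} {h : ℕ → ℝ} {κ : ℝ} (H : HasD h κ)
    (H' : ∀ m : ℤ, ¬ IsSquare m → HasD (fun p => J(m | p) * h p) 0) : HasD (fun p => W η N p * h p) κ := by
  classical
  have e : ∀ p, W η N p * h p = ∑ s ∈ (SS N).powerset, (∏ m ∈ s, (sg η m : ℝ)) * (J(∏ m ∈ s, m | p) * h p) := fun p => by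
    rw [W, Finset.prod_one_add, Finset.sum_mul]
    refine Finset.sum_congr rfl fun s hs => ?_
    clear hs
    push_cast
    rw [Finset.prod_mul_distrib, mul_assoc]
    congr 2
    induction s using Finset.induction_on with
    | empty => simp
    | insert a s ha ih => rw [Finset.prod_insert ha, Finset.prod_insert ha, jacobiSym.mul_left, ih]; push_cast; rfl
  simp only [e]
  have := HasD.sum (SS N).powerset (h := fun s p => (∏ m ∈ s, (sg η m : ℝ)) * (J(∏ m ∈ s, m | p) * h p))
    (κ := fun s => if s = ∅ then κ else 0) fun s hs => ?_
  · simpa using this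
  · rcases s.eq_empty_or_nonempty with rfl | hne
    · simpa using H
    · rw [if_neg hne.ne_empty]
      simpa using (H' _ (not_isSquare_prod (Finset.mem_powerset.1 hs) hne)).const_mul (∏ m ∈ s, (sg η m : ℝ))
theorem Tc_of_mul (m : ℤ) (δ : Cub ℤ A B) {p : ℕ} (hp : p.Prime) : Tc (of A B m * δ) p = J(m | p) * Tc δ p := by
  haveI := Fact.mk hp
  rw [Tc_eq, Tc_eq, Finset.mul_sum, ← jacobiSym.legendreSym.to_jacobiSym, legendreSym]
  refine Finset.sum_congr rfl fun r hr => ?_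
  rw [evr_mul (mem_rts.1 hr), evr_of, map_mul]
theorem Tc_one {p : ℕ} (hp : p.Prime) : Tc (1 : Cub ℤ A B) p = nf A B p := by
  haveI := Fact.mk hp
  rw [Tc_eq, nf_eq]; simp [evr]
theorem hasD_W (η : ℤ) (N : ℕ) : HasD (fun p => W η N p) 1 := by
  simpa using hasD_W_mul (η := η) (N := N) hasD_one (fun m hm => by simpa using hasD_jac hm)
theorem hasD_W_Tc (hf : ∀ x : ℚ, x ^ 3 + A * x + B ≠ 0) (η : ℤ) (N : ℕ) {δ : Cub ℤ A B} {n : ℚ} (hn : n ≠ 0)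
    (hδ : ((Cub.N δ : ℤ) : ℚ) = n ^ 2) {κ : ℝ} (H : HasD (fun p => (Tc δ p : ℝ)) κ) :
    HasD (fun p => W η N p * Tc δ p) κ := by
  refine hasD_W_mul H fun m hm => ?_
  refine (hasD_Tc hf (δ := of A B m * δ) fun z hz => hm ?_).congr_off 1 one_ne_zero fun p hp _ => ?_
  · have h1 := congrArg Cub.N hz
    rw [N_pow, N_map, N_mul, N_of] at h1
    push_cast [hδ] at h1
    simp only [eq_intCast] at h1
    push_cast at h1
    rw [hδ] at h1
    have hm0 : (m : ℚ) ≠ 0 := by rintro h; apply hm; simp [Int.cast_eq_zero.1 h]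
    rw [← Rat.isSquare_intCast_iff]
    refine ⟨Cub.N z / (n * m), ?_⟩
    field_simp
    linear_combination -h1
  · rw [Tc_of_mul m δ hp]; push_cast; rfl
theorem hasD_W_nf (hf : ∀ x : ℚ, x ^ 3 + A * x + B ≠ 0) (η : ℤ) (N : ℕ) : HasD (fun p => W η N p * nf A B p) 1 := by
  refine (hasD_W_Tc hf η N (δ := 1) one_ne_zero (by simp) ((hasD_nf hf).congr_off 1 one_ne_zero fun p hp _ => ?_)).congr_off 1 one_ne_zero fun p hp _ => ?_
  · rw [Tc_one hp]; simp
  · rw [Tc_one hp]; simp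
def Dis (A B : ℤ) : ℤ := -4 * A ^ 3 - 27 * B ^ 2
theorem jac_eq_one {N p : ℕ} {η : ℤ} (h : Cd η N p) (n : ℕ) (hn : ∀ q : ℕ, q.Prime → q ∣ n → q ∣ N) (hN : N ≠ 0)
    (hn0 : n ≠ 0) : J(n | p) = 1 := by
  induction n using Nat.recOnMul with
  | zero => exact absurd rfl hn0
  | one => simp
  | prime q hq => exact h.2 q (Nat.mem_primeFactors.2 ⟨hq, hn q hq dvd_rfl, hN⟩)
  | mul a b iha ihb =>
    push_cast
    rw [jacobiSym.mul_left, iha (fun q hq hd => hn q hq (hd.mul_right b)) (left_ne_zero_of_mul hn0),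
      ihb (fun q hq hd => hn q hq (hd.mul_left a)) (right_ne_zero_of_mul hn0), one_mul]
theorem jac_Dis {N p : ℕ} {η : ℤ} (h : Cd η N p) (hN : N ≠ 0) (hD : Dis A B ≠ 0) (hDN : Dis A B ∣ N) :
    J(Dis A B | p) = if 0 < Dis A B then 1 else η := by
  have h1 : J((Dis A B).natAbs | p) = 1 := jac_eq_one h _ (fun q _ hd => hd.trans (by
    rw [← Int.natCast_dvd_natCast]; simpa using hDN)) hN (by simpa using hD)
  split_ifs with h0
  · grind
  · rw [Int.natCast_natAbs, abs_of_nonpos (not_lt.1 h0)] at h1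
    rw [← neg_neg (Dis A B), neg_eq_neg_one_mul, jacobiSym.mul_left, h1, h.1, mul_one]
theorem Dis_root {F : Type*} [CommRing F] {r : F} (h : r ^ 3 + A * r + B = 0) :
    (Dis A B : F) = (-3 * r ^ 2 - 4 * A) * (3 * r ^ 2 + A) ^ 2 := by
  have : (B : F) = - r ^ 3 - A * r := by linear_combination h
  simp only [Dis]; grind
theorem three_roots {F : Type*} [Field F] (h2 : (2 : F) ≠ 0) {r : F} (h : r ^ 3 + A * r + B = 0)
    (hD : IsSquare (Dis A B : F)) (hD0 : (Dis A B : F) ≠ 0) :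
    ∃ s t : F, s ≠ r ∧ t ≠ r ∧ s ≠ t ∧ s ^ 3 + A * s + B = 0 ∧ t ^ 3 + A * t + B = 0 ∧ r + s + t = 0 := by
  have e := Dis_root h
  obtain ⟨d, hd⟩ := hD
  have h3 : (3 * r ^ 2 + A : F) ≠ 0 := by grind
  have hd0 : d ≠ 0 := by grind
  set w := d / (3 * r ^ 2 + A) with hw
  have hw0 : w ≠ 0 := div_ne_zero hd0 h3
  have hw2 : w ^ 2 = -3 * r ^ 2 - 4 * A := by
    grind
  have hsq : ∀ v : F, v ^ 2 = -3 * r ^ 2 - 4 * A → ((-r + v) / 2) ≠ r ∧ ((-r + v) / 2) ^ 3 + A * ((-r + v) / 2) + B = 0 := fun v hv => by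
    refine ⟨fun hh => h3 ?_, ?_⟩
    · grind
    grind
  refine ⟨(-r + w) / 2, (-r + -w) / 2, (hsq w hw2).1, (hsq (-w) (by rw [neg_sq, hw2])).1, fun hh => hw0 ?_, (hsq w hw2).2, (hsq (-w) (by rw [neg_sq, hw2])).2, ?_⟩
  · grind
  · field_simp; ring
theorem nf_three {p : ℕ} [Fact p.Prime] (h2 : p ≠ 2) (hD : J(Dis A B | p) = 1) : nf A B p = 0 ∨
    ∃ r s t : ZMod p, s ≠ r ∧ t ≠ r ∧ s ≠ t ∧ r + s + t = 0 ∧ rts A B p = {r, s, t} := by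
  rw [← jacobiSym.legendreSym.to_jacobiSym] at hD
  have hD0 : ((Dis A B : ℤ) : ZMod p) ≠ 0 := by
    intro h; rw [(legendreSym.eq_zero_iff p _).2 h] at hD; simp at hD
  have hsq := (legendreSym.eq_one_iff p hD0).1 hD
  have h2' : (2 : ZMod p) ≠ 0 := by
    intro h
    have : ((2:ℕ) : ZMod p) = 0 := by exact_mod_cast h
    rw [ZMod.natCast_eq_zero_iff, Nat.prime_dvd_prime_iff_eq Fact.out Nat.prime_two] at this
    exact h2 this
  rcases (rts A B p).eq_empty_or_nonempty with h | ⟨r, hr⟩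
  · left; rw [nf_eq, h]; rfl
  · right
    rw [mem_rts] at hr
    obtain ⟨s, t, h1, h3, h4, h5, h6, h7⟩ := three_roots h2' hr hsq hD0
    refine ⟨r, s, t, h1, h3, h4, h7, ?_⟩
    ext x
    simp only [mem_rts, Finset.mem_insert, Finset.mem_singleton]
    grind
end Ono

namespace Ono
open Filter Topology
open scoped NumberTheorySymbols
open Cub
variable {A B : ℤ}
theorem prime_ne_two {N p : ℕ} (h : ¬ p ∣ N) (h2 : 2 ∣ N) : p ≠ 2 := by rintro rfl; exact h h2
def Inert (A B η : ℤ) (N p : ℕ) : Prop := p.Prime ∧ ¬ p ∣ N ∧ Cd η N p ∧ nf A B p = 0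
open scoped Classical in
theorem inert_hasD (hf : ∀ x : ℚ, x ^ 3 + A * x + B ≠ 0) {η : ℤ} {N : ℕ} (hη : η = 1 ∨ (0 < Dis A B ∧ η = -1))
    (hN : N ≠ 0) (hD : Dis A B ≠ 0) (hDN : Dis A B ∣ N) (h2 : 2 ∣ N) :
    HasD (fun p => if Inert A B η N p then 1 else 0) ((2 ^ (SS N).card)⁻¹ * (2 / 3)) := by
  have h := ((hasD_W η N).add ((hasD_W_nf hf η N).const_mul (-(1/3)))).const_mul (2 ^ (SS N).card)⁻¹
  rw [show (1:ℝ) + -(1/3) * 1 = 2/3 by norm_num] at h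
  refine h.congr_off N hN fun p hp hpN => ?_
  have hη' : η = 1 ∨ η = -1 := hη.imp id fun h => h.2
  by_cases hc : Cd η N p
  · rw [(W_eq hη' hp hpN).1 hc]
    have hJ : J(Dis A B | p) = 1 := by
      rw [jac_Dis hc hN hD hDN]; grind
    haveI := Fact.mk hp
    rcases nf_three (prime_ne_two hpN h2) hJ with h0 | ⟨r, s, t, h1, h3, h4, h5, h6⟩
    · have : Inert A B η N p := ⟨hp, hpN, hc, h0⟩
      simp [this, h0]
    · have h7 : nf A B p = 3 := by
        rw [nf_eq, h6, Finset.card_eq_three.2 ⟨r, s, t, h1.symm, h3.symm, h4, rfl⟩]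
      have : ¬ Inert A B η N p := fun h => by have := h.2.2.2; omega
      simp [this, h7]; ring
  · rw [(W_eq hη' hp hpN).2 hc]
    have : ¬ Inert A B η N p := fun h => hc h.2.2.1
    simp [this]
theorem prod_evr {F : Type*} [CommRing F] [IsDomain F] {r s t : F} (hr : r ^ 3 + A * r + B = 0) (hs : s ^ 3 + A * s + B = 0)
    (h : s ≠ r) (hst : r + s + t = 0) (δ : Cub ℤ A B) : evr r δ * evr s δ * evr t δ = (Cub.N δ : ℤ) := by
  have e1 : (s - r) * (s ^ 2 + s * r + r ^ 2 + A) = 0 := by grind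
  have e2 := (mul_eq_zero.1 e1).resolve_left (sub_ne_zero.2 h)
  have eA : (A : F) = -(s ^ 2 + s * r + r ^ 2) := by linear_combination e2
  have eB : (B : F) = r * s * (r + s) := by grind
  have et : t = -r - s := by linear_combination hst
  simp only [evr, Cub.N]; push_cast; rw [eA, eB, et]; ring
theorem char_bash {a b c a' b' c' : ℤ} (ha : a = 0 ∨ a = 1 ∨ a = -1) (hb : b = 0 ∨ b = 1 ∨ b = -1) (hc : c = 0 ∨ c = 1 ∨ c = -1)
    (ha' : a' = 0 ∨ a' = 1 ∨ a' = -1) (hb' : b' = 0 ∨ b' = 1 ∨ b' = -1) (hc' : c' = 0 ∨ c' = 1 ∨ c' = -1)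
    (q : a * b * c = 1) (q' : a' * b' * c' = 1) (h : a + b + c + (a' + b' + c') + (a * a' + b * b' + c * c') < 1) :
    ((a = -1 ∨ a' = -1) ∧ (b = -1 ∨ b' = -1) ∧ (c = -1 ∨ c' = -1)) ∧ (a = -1 ∨ b = -1 ∨ c = -1) ∧
    (a' = -1 ∨ b' = -1 ∨ c' = -1) ∧ (a * a' = -1 ∨ b * b' = -1 ∨ c * c' = -1) := by
  rcases ha with rfl | rfl | rfl <;> rcases hb with rfl | rfl | rfl <;> rcases hc with rfl | rfl | rfl <;>
  grind <;> rcases ha' with rfl | rfl | rfl <;> rcases hb' with rfl | rfl | rfl <;>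
  rcases hc' with rfl | rfl | rfl <;> grind <;> grind <;> norm_num
theorem split_exists (hf : ∀ x : ℚ, x ^ 3 + A * x + B ≠ 0) {N : ℕ} (hN : N ≠ 0) (hD : Dis A B ≠ 0)
    (hDN : Dis A B ∣ N) (h2 : 2 ∣ N) {s₁ s₂ : Cub ℤ A B} {n₁ n₂ : ℤ} (hn₁ : n₁ ≠ 0) (hn₂ : n₂ ≠ 0)
    (e₁ : Cub.N s₁ = n₁ ^ 2) (e₂ : Cub.N s₂ = n₂ ^ 2)
    (h₁ : ∀ z : Cub ℚ A B, z ^ 2 ≠ Cub.map (Int.castRingHom ℚ) s₁)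
    (h₂ : ∀ z : Cub ℚ A B, z ^ 2 ≠ Cub.map (Int.castRingHom ℚ) s₂)
    (h₃ : ∀ z : Cub ℚ A B, z ^ 2 ≠ Cub.map (Int.castRingHom ℚ) (s₁ * s₂)) :
    ∃ p : ℕ, ∃ _ : Fact p.Prime, ¬ p ∣ N ∧ ¬ (p:ℤ) ∣ n₁ ∧ ¬ (p:ℤ) ∣ n₂ ∧ Cd 1 N p ∧ ∃ r s t : ZMod p, s ≠ r ∧ t ≠ r ∧ s ≠ t ∧ r + s + t = 0 ∧
      rts A B p = {r, s, t} ∧ (∀ x ∈ rts A B p, ¬ IsSquare (evr x s₁) ∨ ¬ IsSquare (evr x s₂)) ∧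
      (∃ x ∈ rts A B p, ¬ IsSquare (evr x s₁)) ∧ (∃ x ∈ rts A B p, ¬ IsSquare (evr x s₂)) ∧
      (∃ x ∈ rts A B p, ¬ IsSquare (evr x (s₁ * s₂))) := by
  have e₃ : Cub.N (s₁ * s₂) = (n₁ * n₂) ^ 2 := by rw [N_mul, e₁, e₂]; ring
  have hn₃ := mul_ne_zero hn₁ hn₂
  have key : ∀ {s : Cub ℤ A B} {n : ℤ} (hn : n ≠ 0) (e : Cub.N s = n ^ 2) (h : ∀ z : Cub ℚ A B, z ^ 2 ≠ Cub.map (Int.castRingHom ℚ) s),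
    HasD (fun p => W 1 N p * Tc s p) 0 := fun {s n} hn e h => hasD_W_Tc hf 1 N (n := n) (by exact_mod_cast hn) (by rw [e]; push_cast; rfl) (hasD_Tc hf h)
  have H := ((hasD_W_nf hf 1 N).const_mul (1/12)).add ((((key hn₁ e₁ h₁).add (key hn₂ e₂ h₂)).add (key hn₃ e₃ h₃)).const_mul (-(1/4)))
  obtain ⟨p, hp, hpM, hF⟩ := H.exists_pos (by norm_num) (N * (n₁ * n₂).natAbs) (mul_ne_zero hN (Int.natAbs_ne_zero.2 hn₃))
  haveI := Fact.mk hp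
  have hpN : ¬ p ∣ N := fun h => hpM (h.mul_right _)
  have hpn : ¬ (p : ℤ) ∣ n₁ * n₂ := fun h => hpM (Dvd.dvd.mul_left (by rwa [← Int.natCast_dvd]) _)
  have hp₁ : ¬ (p : ℤ) ∣ n₁ := fun h => hpn (h.mul_right _)
  have hp₂ : ¬ (p : ℤ) ∣ n₂ := fun h => hpn (h.mul_left _)
  have hc : Cd 1 N p := by
    by_contra hc
    rw [(W_eq (Or.inl rfl) hp hpN).2 hc] at hF; simp at hF
  have hJ : J(Dis A B | p) = 1 := by rw [jac_Dis hc hN hD hDN]; simp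
  rcases nf_three (prime_ne_two hpN h2) hJ with h0 | ⟨r, s, t, h1, h3, h4, h5, h6⟩
  · exfalso
    have hr : rts A B p = ∅ := by rwa [nf_eq, Finset.card_eq_zero] at h0
    simp [h0, Tc_eq, hr] at hF
  · have h7 : nf A B p = 3 := by
      rw [nf_eq, h6, Finset.card_eq_three.2 ⟨r, s, t, h1.symm, h3.symm, h4, rfl⟩]
    have hr : r ∈ rts A B p := by rw [h6]; simp
    have hs : s ∈ rts A B p := by rw [h6]; simp
    have ht : t ∈ rts A B p := by rw [h6]; simp
    have pr : ∀ {δ : Cub ℤ A B} {n : ℤ}, Cub.N δ = n ^ 2 → ¬ (p : ℤ) ∣ n →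
        quadraticChar (ZMod p) (evr r δ) * quadraticChar (ZMod p) (evr s δ) * quadraticChar (ZMod p) (evr t δ) = 1 := fun {δ n} e hn => by
      rw [← map_mul, ← map_mul, prod_evr (mem_rts.1 hr) (mem_rts.1 hs) h1 h5, e]
      push_cast
      exact quadraticChar_sq_one' (by rwa [Ne, ZMod.intCast_zmod_eq_zero_iff_dvd])
    have vals : ∀ x : ZMod p, quadraticChar (ZMod p) x = 0 ∨ quadraticChar (ZMod p) x = 1 ∨ quadraticChar (ZMod p) x = -1 := fun x => by
      by_cases hx : x = 0
      · left; simp [hx]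
      · right; exact quadraticChar_dichotomy hx
    have nsq : ∀ x : ZMod p, quadraticChar (ZMod p) x = -1 → ¬ IsSquare x := fun x hx =>
      quadraticChar_neg_one_iff_not_isSquare.1 hx
    have hT : ∀ δ : Cub ℤ A B, Tc δ p = quadraticChar (ZMod p) (evr r δ) + quadraticChar (ZMod p) (evr s δ) + quadraticChar (ZMod p) (evr t δ) := fun δ => by
      rw [Tc_eq, h6, Finset.sum_insert (by simp [h1.symm, h3.symm]), Finset.sum_insert (by simp [h4]), Finset.sum_singleton, add_assoc]
    have hW : (0:ℝ) < W 1 N p := by rw [(W_eq (Or.inl rfl) hp hpN).1 hc]; positivity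
    have hlt : Tc s₁ p + Tc s₂ p + Tc (s₁ * s₂) p < 1 := by
      have : (0:ℝ) < W 1 N p * ((1 - (Tc s₁ p + Tc s₂ p + Tc (s₁ * s₂) p)) / 4) := by
        rw [h7] at hF
        grind
      have := pos_of_mul_pos_right this hW.le
      have h' : ((Tc s₁ p + Tc s₂ p + Tc (s₁ * s₂) p : ℤ) : ℝ) < (1:ℤ) := by push_cast; linarith
      exact_mod_cast h'
    have q₁ := pr e₁ hp₁
    have q₂ := pr e₂ hp₂
    rw [hT, hT, hT] at hlt
    have m₃ : ∀ x ∈ rts A B p, quadraticChar (ZMod p) (evr x (s₁ * s₂)) = quadraticChar (ZMod p) (evr x s₁) * quadraticChar (ZMod p) (evr x s₂) :=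
      fun x hx => by rw [evr_mul (mem_rts.1 hx), map_mul]
    refine ⟨p, ‹_›, hpN, hp₁, hp₂, hc, r, s, t, h1, h3, h4, h5, h6, ?_⟩
    have a1 := m₃ r hr
    have a2 := m₃ s hs
    have a3 := m₃ t ht
    have fin : (∀ x ∈ rts A B p, quadraticChar (ZMod p) (evr x s₁) = -1 ∨ quadraticChar (ZMod p) (evr x s₂) = -1) ∧
      (∃ x ∈ rts A B p, quadraticChar (ZMod p) (evr x s₁) = -1) ∧ (∃ x ∈ rts A B p, quadraticChar (ZMod p) (evr x s₂) = -1) ∧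
      (∃ x ∈ rts A B p, quadraticChar (ZMod p) (evr x (s₁ * s₂)) = -1) := by
      rw [h6]
      simp only [Finset.forall_mem_insert, Finset.exists_mem_insert, Finset.mem_singleton, forall_eq, exists_eq_left]
      rw [a1, a2, a3] at hlt ⊢
      exact char_bash (vals _) (vals _) (vals _) (vals _) (vals _) (vals _) q₁ q₂ hlt
    exact ⟨fun x hx => (fin.1 x hx).imp (nsq _) (nsq _), fin.2.1.imp fun x h => ⟨h.1, nsq _ h.2⟩,
      fin.2.2.1.imp fun x h => ⟨h.1, nsq _ h.2⟩, fin.2.2.2.imp fun x h => ⟨h.1, nsq _ h.2⟩⟩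
theorem transp_exists (hf : ∀ x : ℚ, x ^ 3 + A * x + B ≠ 0) {N : ℕ} (hN : N ≠ 0) (hD : Dis A B < 0)
    (hDN : Dis A B ∣ N) {s : Cub ℤ A B} {n : ℤ} (hn : n ≠ 0)
    (e : Cub.N s = n ^ 2) (h : ∀ z : Cub ℚ A B, z ^ 2 ≠ Cub.map (Int.castRingHom ℚ) s) :
    ∃ p : ℕ, ∃ _ : Fact p.Prime, ¬ p ∣ N ∧ ¬ (p:ℤ) ∣ n ∧ Cd (-1) N p ∧ ∃ r : ZMod p,
      rts A B p = {r} ∧ ¬ IsSquare (evr r s) ∧ 3 * r ^ 2 + A ≠ 0 := by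
  have H := (hasD_W_nf hf (-1) N).add ((hasD_W_Tc hf (-1) N (δ := s) (n := n) (by exact_mod_cast hn) (by rw [e]; push_cast; rfl) (hasD_Tc hf h)).const_mul (-1))
  obtain ⟨p, hp, hpM, hF⟩ := H.exists_pos (by norm_num) (N * n.natAbs) (mul_ne_zero hN (Int.natAbs_ne_zero.2 hn))
  haveI := Fact.mk hp
  have hpN : ¬ p ∣ N := fun h => hpM (h.mul_right _)
  have hpn : ¬ (p : ℤ) ∣ n := fun h => hpM (Dvd.dvd.mul_left (by rwa [← Int.natCast_dvd]) _)
  have hc : Cd (-1) N p := by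
    by_contra hc
    rw [(W_eq (Or.inr rfl) hp hpN).2 hc] at hF; simp at hF
  have hJ : J(Dis A B | p) = -1 := by rw [jac_Dis hc hN hD.ne hDN, if_neg (by omega)]
  rw [← jacobiSym.legendreSym.to_jacobiSym, legendreSym.eq_neg_one_iff] at hJ
  have hW : (0:ℝ) < W (-1) N p := by rw [(W_eq (Or.inr rfl) hp hpN).1 hc]; positivity
  have hlt : Tc s p < nf A B p := by
    have : (0:ℝ) < W (-1) N p * (nf A B p - Tc s p) := by
      grind
    have := pos_of_mul_pos_right this hW.le
    have h' : ((Tc s p : ℤ) : ℝ) < ((nf A B p : ℤ) : ℝ) := by push_cast; linarith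
    exact_mod_cast h'
  have hex : ∃ r ∈ rts A B p, quadraticChar (ZMod p) (evr r s) < 1 := by
    by_contra! hcon
    have := Finset.card_nsmul_le_sum (rts A B p) (fun r => quadraticChar (ZMod p) (evr r s)) 1 hcon
    rw [← Tc_eq, ← nf_eq] at this
    simp at this; omega
  obtain ⟨r, hr, hlt1⟩ := hex
  have hr' := mem_rts.1 hr
  have h3 : (3 * r ^ 2 + A : ZMod p) ≠ 0 := fun h0 => hJ (by rw [Dis_root hr', h0]; exact ⟨0, by ring⟩)
  have hone : rts A B p = {r} := by
    ext x
    rw [mem_rts, Finset.mem_singleton]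
    refine ⟨fun hx => by_contra fun hne => hJ ?_, by rintro rfl; exact hr'⟩
    have e1 : (x - r) * (x ^ 2 + x * r + r ^ 2 + A) = 0 := by grind
    have e2 := (mul_eq_zero.1 e1).resolve_left (sub_ne_zero.2 hne)
    exact ⟨(2 * x + r) * (3 * r ^ 2 + A), by rw [Dis_root hr']; grind⟩
  refine ⟨p, ‹_›, hpN, hpn, hc, r, hone, fun hsq => ?_, h3⟩
  have hz : evr r s = 0 := by
    by_contra h0
    rw [(quadraticChar_one_iff_isSquare h0).2 hsq] at hlt1
    exact lt_irrefl _ hlt1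
  have hdv : evr r s * evr r (adj s) = (Cub.N s : ℤ) := by
    rw [← evr_mul hr', mul_adj, evr_of]
  rw [hz, zero_mul, e] at hdv
  have : ((n ^ 2 : ℤ) : ZMod p) = 0 := hdv.symm
  rw [ZMod.intCast_zmod_eq_zero_iff_dvd] at this
  exact hpn ((Nat.prime_iff_prime_int.1 hp).dvd_of_dvd_pow this)
end Ono

namespace Ono
open Filter Topology Finset
def Gd (P : ℕ → Prop) (n : ℕ) : Prop := Squarefree n ∧ ∀ p, p.Prime → p ∣ n → P p
open scoped Classical in
noncomputable def NC (P : ℕ → Prop) (X : ℝ) : ℝ := #{n ∈ Icc 1 ⌊X⌋₊ | Gd P n}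
open scoped Classical in
noncomputable def shl (P : ℕ → Prop) (Y Z : ℝ) : Finset ℕ := {p ∈ Ioc ⌊Y⌋₊ ⌊Z⌋₊ | p.Prime ∧ P p}
theorem mem_shl {P : ℕ → Prop} {Y Z : ℝ} (hY : 0 ≤ Y) (hZ : 0 ≤ Z) {p : ℕ} : p ∈ shl P Y Z ↔ (Y < p ∧ p ≤ Z) ∧ p.Prime ∧ P p := by
  simp [shl, Nat.floor_lt hY, Nat.le_floor_iff hZ]
theorem NC_rec {P : ℕ → Prop} {X : ℝ} (hX : 1 ≤ X) :
    ∑ p ∈ shl P (√X) X, Real.log p * NC P (X / p) ≤ NC P X * Real.log X := by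
  classical
  set G := {n ∈ Icc 1 ⌊X⌋₊ | Gd P n}
  have hX0 : (0:ℝ) ≤ X := by linarith
  have hG : ∀ n ∈ G, n ≠ 0 ∧ (n:ℝ) ≤ X ∧ Gd P n := fun n hn => by
    simp only [G, mem_filter, mem_Icc] at hn
    exact ⟨by omega, (Nat.le_floor_iff hX0).1 hn.1.2, hn.2⟩
  have h1 : ∑ n ∈ G, ∑ p ∈ shl P (√X) X, (if p ∣ n then Real.log p else 0) ≤ NC P X * Real.log X := by
    rw [show NC P X * Real.log X = ∑ n ∈ G, Real.log X by simp [NC, G]]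
    refine sum_le_sum fun n hn => ?_
    obtain ⟨h0, hle, hg⟩ := hG n hn
    calc _ = ∑ p ∈ shl P (√X) X with p ∣ n, Real.log p := by rw [sum_filter]
      _ ≤ ∑ p ∈ n.primeFactors, Real.log p := by
          refine sum_le_sum_of_subset_of_nonneg (fun p hp => ?_) fun p hp _ => Real.log_natCast_nonneg _
          rw [mem_filter, mem_shl (Real.sqrt_nonneg _) hX0] at hp
          grind
      _ = Real.log n := by
          conv_rhs => rw [← Nat.prod_primeFactors_of_squarefree hg.1]
          push_cast
          rw [Real.log_prod]
          intro p hp; exact_mod_cast (Nat.prime_of_mem_primeFactors hp).ne_zero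
      _ ≤ _ := Real.log_le_log (by exact_mod_cast Nat.pos_of_ne_zero h0) hle
  refine le_trans ?_ h1
  rw [sum_comm]
  refine sum_le_sum fun p hp => ?_
  rw [mem_shl (Real.sqrt_nonneg _) hX0] at hp
  obtain ⟨⟨hp1, hp2⟩, hpp, hpP⟩ := hp
  have hp0 : (0:ℝ) < p := by exact_mod_cast hpp.pos
  rw [← sum_filter, sum_const, nsmul_eq_mul, mul_comm]
  refine mul_le_mul_of_nonneg_right ?_ (Real.log_natCast_nonneg _)
  unfold NC
  norm_cast
  refine card_le_card_of_injOn (fun m => p * m) (fun m hm => ?_) (fun a _ b _ h => Nat.eq_of_mul_eq_mul_left hpp.pos h)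
  have hm' := mem_filter.1 hm
  rw [mem_Icc, Nat.le_floor_iff (by positivity), le_div_iff₀ hp0] at hm'
  obtain ⟨⟨hm1, hm2⟩, hsq, hmP⟩ := hm'
  have hpm : ¬ p ∣ m := fun h => by
    have h3 := Nat.le_of_dvd hm1 h
    have h4 : (p:ℝ) ≤ m := by exact_mod_cast h3
    have h5 : X < p * p := by rw [← sq]; exact (Real.sqrt_lt' hp0).1 hp1
    nlinarith
  simp only [coe_filter, Set.mem_ofPred_eq, G, mem_filter, mem_Icc, dvd_mul_right, and_true]
  refine ⟨⟨Nat.mul_pos hpp.pos hm1, (Nat.le_floor_iff hX0).2 (by push_cast; linarith)⟩, ?_, fun q hq hqd => ?_⟩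
  · rw [Nat.squarefree_mul ((Nat.Prime.coprime_iff_not_dvd hpp).2 hpm)]
    exact ⟨hpp.prime.squarefree, hsq⟩
  · rcases (hq.dvd_mul).1 hqd with h | h
    · rwa [(Nat.prime_dvd_prime_iff_eq hq hpp).1 h]
    · exact hmP q hq h
open scoped Classical in
theorem psum_shl {P : ℕ → Prop} {Y Z : ℝ} (h : Y ≤ Z) :
    psum (fun p => if P p then 1 else 0) Z - psum (fun p => if P p then 1 else 0) Y = ∑ p ∈ shl P Y Z, Real.log p / p := by
  have hf := Nat.floor_le_floor h
  have hsub : Nat.primesLE ⌊Y⌋₊ ⊆ Nat.primesLE ⌊Z⌋₊ := fun p hp => by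
    rw [Nat.mem_primesLE] at hp ⊢; grind
  unfold psum
  rw [← sum_sdiff hsub, add_sub_cancel_right]
  simp only [ite_mul, one_mul, zero_mul]
  rw [← sum_filter]
  refine sum_congr ?_ fun _ _ => rfl
  ext p
  simp only [mem_filter, Finset.mem_sdiff, Nat.mem_primesLE, shl, mem_Ioc]
  grind
open scoped Classical in
theorem shl_ev {P : ℕ → Prop} {κ : ℝ} (hκ : 0 < κ) (H : HasD (fun p => if P p then 1 else 0) κ) {u v : ℝ} (hu : 0 < u) (huv : u < v) :
    ∀ᶠ X : ℝ in atTop, κ * (v - u) / 2 * Real.log X ≤ ∑ p ∈ shl P (X ^ u) (X ^ v), Real.log p / p := by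
  have key : ∀ {w : ℝ}, 0 < w → Tendsto (fun X : ℝ => psum (fun p => if P p then 1 else 0) (X ^ w) / Real.log X) atTop (𝓝 (κ * w)) := fun {w} hw => by
    refine ((H.comp (tendsto_rpow_atTop hw)).mul_const w).congr' ?_
    filter_upwards [eventually_gt_atTop 1] with X hX
    simp only [Function.comp, Real.log_rpow (by linarith : 0 < X)]
    grind
  have h := ((key (hu.trans huv)).sub (key hu)).eventually_const_lt (u := κ * (v - u) / 2) (by nlinarith [mul_pos hκ (sub_pos.2 huv)])
  filter_upwards [h, eventually_gt_atTop 1] with X h hX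
  rw [← psum_shl (Real.rpow_le_rpow_of_exponent_le hX.le huv.le)]
  have := Real.log_pos hX
  rw [← sub_div, lt_div_iff₀ this] at h
  exact h.le
open scoped Classical in
theorem count_lower {P : ℕ → Prop} {κ : ℝ} (hκ : 0 < κ) (H : HasD (fun p => if P p then 1 else 0) κ) :
    ∃ β : ℝ, 0 < β ∧ β < 1 ∧ ∃ c : ℝ, 0 < c ∧ ∀ X : ℝ, 1 ≤ X → c * X * (1 + Real.log X) ^ (-β) ≤ NC P X := by
  obtain ⟨J, hJ⟩ := exists_nat_gt (16 / κ + 1)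
  have hJ1 : (1:ℝ) < J := lt_of_le_of_lt (by have := div_pos (by norm_num : (0:ℝ) < 16) hκ; linarith) hJ
  have hJ16 : 16 ≤ J * κ := by rw [← div_le_iff₀ hκ]; linarith
  set β : ℝ := 1 - 1 / J
  have hJi : 1 / (J:ℝ) < 1 := by rw [div_lt_one (by linarith)]; exact hJ1
  have hJp : 0 < 1 / (J:ℝ) := by positivity
  have hβ0 : 0 < β := by grind
  have hβ1 : β < 1 := by grind
  let u : ℕ → ℝ := fun k => 1 - (1/2) ^ k
  have hpw : ∀ k : ℕ, (0:ℝ) < (1/2) ^ k := fun k => by positivity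
  have hu0 : ∀ k ∈ Icc 1 J, 1/2 ≤ u k := fun k hk => by
    have := pow_le_pow_of_le_one (by norm_num : (0:ℝ) ≤ 1/2) (by norm_num) (mem_Icc.1 hk).1
    grind
  have hu1 : ∀ k, u (k + 1) - u k = (1/2) ^ (k + 1) := fun k => by grind
  have humono : Monotone u := monotone_nat_of_le_succ fun k => by grind
  have ev : ∀ᶠ X : ℝ in atTop, ∀ k ∈ Icc 1 J, κ * (1/2) ^ (k + 2) * Real.log X ≤ ∑ p ∈ shl P (X ^ u k) (X ^ u (k + 1)), Real.log p / p := by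
    rw [Filter.eventually_all_finset]
    intro k hk
    have := shl_ev hκ H (by linarith [hu0 k hk]) (show u k < u (k + 1) by grind)
    filter_upwards [this] with X hX
    rw [hu1] at hX
    refine le_trans (le_of_eq ?_) hX
    rw [pow_succ]; ring
  obtain ⟨X₁, hX₁⟩ := eventually_atTop.1 (ev.and ((Real.tendsto_log_atTop.eventually_ge_atTop (2 ^ J)).and (eventually_ge_atTop 1)))
  have hX₁1 : 1 ≤ X₁ := (hX₁ X₁ le_rfl).2.2
  refine ⟨β, hβ0, hβ1, X₁⁻¹, by positivity, ?_⟩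
  have main : ∀ k : ℕ, ∀ X : ℝ, 1 ≤ X → X ≤ 2 ^ k * X₁ → X₁⁻¹ * X * (1 + Real.log X) ^ (-β) ≤ NC P X := by
    have base : ∀ X : ℝ, 1 ≤ X → X ≤ X₁ → X₁⁻¹ * X * (1 + Real.log X) ^ (-β) ≤ NC P X := fun X h1 h2 => by
      have hl := Real.log_nonneg h1
      have ha : (1 + Real.log X) ^ (-β) ≤ 1 := Real.rpow_le_one_of_one_le_of_nonpos (by linarith) (by linarith)
      have hb : X₁⁻¹ * X ≤ 1 := by rw [inv_mul_le_iff₀ (by linarith)]; linarith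
      have hc : (1:ℝ) ≤ NC P X := by
        unfold NC
        norm_cast
        refine card_pos.2 ⟨1, mem_filter.2 ⟨mem_Icc.2 ⟨le_rfl, Nat.le_floor (by simpa using h1)⟩, squarefree_one, fun p hp h => absurd (Nat.dvd_one.1 h) hp.ne_one⟩⟩
      exact (mul_le_one₀ hb (by positivity) ha).trans hc
    intro k
    induction k with
    | zero => grind
    | succ k ih =>
      intro X h1 h2
      by_cases hXX : X ≤ X₁
      · exact base X h1 hXX
      push Not at hXX
      obtain ⟨hsh, hL, -⟩ := hX₁ X hXX.le
      have hX0 : 0 < X := by linarith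
      set L := Real.log X
      have hL0 : 0 < L := lt_of_lt_of_le (by positivity) hL
      have hsub : (Icc 1 J).biUnion (fun k => shl P (X ^ u k) (X ^ u (k + 1))) ⊆ shl P (√X) X := fun p hp => by
        obtain ⟨k, hk, hp⟩ := mem_biUnion.1 hp
        rw [mem_shl (by positivity) (by positivity)] at hp ⊢
        refine ⟨⟨lt_of_le_of_lt ?_ hp.1.1, hp.1.2.trans ?_⟩, hp.2⟩
        · rw [Real.sqrt_eq_rpow]; exact Real.rpow_le_rpow_of_exponent_le h1 (hu0 k hk)
        · conv_rhs => rw [← Real.rpow_one X]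
          exact Real.rpow_le_rpow_of_exponent_le h1 (by grind)
      have hdisj : ∀ k l : ℕ, k < l → Disjoint (shl P (X ^ u k) (X ^ u (k + 1))) (shl P (X ^ u l) (X ^ u (l + 1))) := fun k l hkl => by
        rw [Finset.disjoint_left]
        intro p hp hp'
        rw [mem_shl (by positivity) (by positivity)] at hp hp'
        have := Real.rpow_le_rpow_of_exponent_le h1 (humono (Nat.succ_le_of_lt hkl))
        grind
      have step : ∀ k ∈ Icc 1 J, X₁⁻¹ * X * (1 + L) ^ (-β) * L * (κ / 16) ≤ ∑ p ∈ shl P (X ^ u k) (X ^ u (k + 1)), Real.log p * NC P (X / p) := fun k hk => by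
        have e1 : ∀ p ∈ shl P (X ^ u k) (X ^ u (k + 1)), X₁⁻¹ * X * (1 + (1/2) ^ k * L) ^ (-β) * (Real.log p / p) ≤ Real.log p * NC P (X / p) := fun p hp => by
          have hp' := hsub (mem_biUnion.2 ⟨k, hk, hp⟩)
          rw [mem_shl (by positivity) (by positivity)] at hp hp'
          have hp2 : (2:ℝ) ≤ p := by exact_mod_cast hp.2.1.two_le
          have hp0 : (0:ℝ) < p := by linarith
          have hXp : 1 ≤ X / p := by rw [le_div_iff₀ hp0]; linarith [hp'.1.2]
          have h3 := ih (X / p) hXp (by rw [div_le_iff₀ hp0]; rw [pow_succ] at h2; nlinarith [mul_pos (pow_pos two_pos k : (0:ℝ) < 2 ^ k) (by linarith : 0 < X₁)])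
          have h4 : Real.log (X / p) ≤ (1/2) ^ k * L := by
            rw [Real.log_div hX0.ne' hp0.ne']
            have := Real.log_le_log (by positivity) hp.1.1.le
            rw [Real.log_rpow hX0] at this
            grind
          have h5 := Real.log_nonneg hXp
          have h6 : (1 + (1/2) ^ k * L) ^ (-β) ≤ (1 + Real.log (X / p)) ^ (-β) :=
            Real.rpow_le_rpow_of_nonpos (by linarith) (by linarith) (by linarith)
          have h7 := Real.log_natCast_nonneg p
          calc _ = Real.log p * (X₁⁻¹ * (X / p) * (1 + (1/2) ^ k * L) ^ (-β)) := by ring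
            _ ≤ Real.log p * (X₁⁻¹ * (X / p) * (1 + Real.log (X / p)) ^ (-β)) := by gcongr
            _ ≤ _ := by gcongr
        refine le_trans ?_ (sum_le_sum e1)
        rw [← mul_sum]
        refine le_trans ?_ (mul_le_mul_of_nonneg_left (hsh k hk) (by positivity))
        have hk1 := (mem_Icc.1 hk).1
        have hk2 := (mem_Icc.1 hk).2
        have h8 : (2:ℝ) ^ k ≤ L := (pow_le_pow_right₀ (by norm_num) hk2).trans hL
        have h9 : (1/2 : ℝ) ^ k * 2 ^ k = 1 := by rw [← mul_pow]; norm_num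
        have h10 : (2:ℝ) ^ k / 2 * (1 + (1/2) ^ k * L) ≤ 1 + L := by nlinarith
        have h11 : (1 + L) ^ (-β) ≤ ((2:ℝ) ^ k / 2) ^ (-β) * (1 + (1/2) ^ k * L) ^ (-β) := by
          rw [← Real.mul_rpow (by positivity) (by positivity)]
          exact Real.rpow_le_rpow_of_nonpos (by positivity) h10 (by linarith)
        have h12 : ((2:ℝ) ^ k / 2) ^ (-β) ≤ 4 * (1/2) ^ k := by
          have : ((2:ℝ) ^ k / 2) ^ (1 / (J:ℝ)) ≤ 2 := by
            calc _ ≤ ((2:ℝ) ^ J) ^ (1 / (J:ℝ)) := by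
                  refine Real.rpow_le_rpow (by positivity) ?_ hJp.le
                  have := pow_le_pow_right₀ (by norm_num : (1:ℝ) ≤ 2) hk2
                  have := pow_pos (two_pos : (0:ℝ) < 2) k
                  linarith
              _ = 2 := by rw [← Real.rpow_natCast, ← Real.rpow_mul (by norm_num), mul_one_div_cancel (by linarith), Real.rpow_one]
          rw [show -β = -1 + 1 / J by simp only [β]; ring, Real.rpow_add (by positivity), Real.rpow_neg_one, inv_div]
          calc 2 / (2:ℝ) ^ k * ((2:ℝ) ^ k / 2) ^ (1 / (J:ℝ)) ≤ 2 / (2:ℝ) ^ k * 2 := by gcongr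
            _ = _ := by rw [div_pow, one_pow]; ring
        calc X₁⁻¹ * X * (1 + L) ^ (-β) * L * (κ / 16) ≤ X₁⁻¹ * X * (4 * (1/2) ^ k * (1 + (1/2) ^ k * L) ^ (-β)) * L * (κ / 16) := by
              gcongr; exact h11.trans (by gcongr)
          _ = _ := by rw [pow_add]; ring
      have h20 : X₁⁻¹ * X * (1 + L) ^ (-β) * L ≤ NC P X * L := by
        refine le_trans ?_ (NC_rec h1)
        refine le_trans ?_ (sum_le_sum_of_subset_of_nonneg hsub fun p _ _ => mul_nonneg (Real.log_natCast_nonneg _) (by unfold NC; positivity))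
        rw [sum_biUnion (fun k _ l _ hne => by
          grind)]
        refine le_trans ?_ (sum_le_sum step)
        rw [sum_const, Nat.card_Icc, nsmul_eq_mul, Nat.add_sub_cancel]
        have : 0 ≤ X₁⁻¹ * X * (1 + L) ^ (-β) * L := by positivity
        nlinarith
      exact le_of_mul_le_mul_right h20 hL0
  intro X hX
  obtain ⟨k, hk⟩ := pow_unbounded_of_one_lt X (by norm_num : (1:ℝ) < 2)
  exact main k X hX (by nlinarith [pow_pos (two_pos : (0:ℝ) < 2) k])
end Ono

namespace Ono
open scoped NumberTheorySymbols
section hensel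
variable {p : ℕ} [Fact p.Prime]
theorem sq_of_near {u a : ℤ_[p]} (h : ‖a ^ 2 - u‖ < ‖2 * a‖ ^ 2) : IsSquare u := by
  obtain ⟨z, hz, -⟩ := hensels_lemma (F := Polynomial.X ^ 2 - Polynomial.C u) (a := a) (by simpa [Polynomial.derivative_pow] using h)
  exact ⟨z, by simp at hz; linear_combination -hz⟩
theorem isSquare_of_res (h2 : p ≠ 2) {u : ℤ_[p]} (hu : ‖u‖ = 1) (h : IsSquare (PadicInt.toZMod u)) : IsSquare u := by
  obtain ⟨r, hr⟩ := h
  obtain ⟨a, rfl⟩ := ZMod.ringHom_surjective (PadicInt.toZMod (p := p)) r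
  have hlt : ‖a ^ 2 - u‖ < 1 := by
    rw [PadicInt.norm_lt_one_iff_dvd, ← Ideal.mem_span_singleton, ← PadicInt.maximalIdeal_eq_span_p, ← PadicInt.ker_toZMod, RingHom.mem_ker]
    simp [hr, sq]
  have h2' : ‖(2 : ℤ_[p])‖ = 1 := by
    have := (PadicInt.norm_int_lt_one_iff_dvd (p := p) 2).not
    refine le_antisymm (PadicInt.norm_le_one _) (not_lt.1 fun h => this.2 ?_ (by exact_mod_cast h))
    intro h
    exact h2 ((Nat.prime_dvd_prime_iff_eq Fact.out Nat.prime_two).1 (by exact_mod_cast h))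
  have ha : ‖a‖ = 1 := by
    have : ‖a ^ 2‖ = 1 := by
      rw [show a ^ 2 = (a ^ 2 - u) + u by ring, PadicInt.norm_add_eq_max_of_ne (by rw [hu]; exact hlt.ne), hu, max_eq_right hlt.le]
    rw [norm_pow] at this
    exact (pow_eq_one_iff_of_nonneg (norm_nonneg _) two_ne_zero).1 this
  exact sq_of_near (a := a) (by rw [norm_mul, h2', ha]; simpa using hlt)
theorem lift_int {x : ℚ_[p]} (h : ‖x‖ ≤ 1) : ∃ x' : ℤ_[p], (x' : ℚ_[p]) = x := ⟨⟨x, h⟩, rfl⟩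
theorem primitive3 {x y z : ℚ_[p]} (h : ¬ (x = 0 ∧ y = 0 ∧ z = 0)) : ∃ (k : ℚ_[p]) (x' y' z' : ℤ_[p]), k ≠ 0 ∧
    x = k * x' ∧ y = k * y' ∧ z = k * z' ∧ (‖x'‖ = 1 ∨ ‖y'‖ = 1 ∨ ‖z'‖ = 1) := by
  have key : ∀ k : ℚ_[p], k ≠ 0 → ‖x‖ ≤ ‖k‖ → ‖y‖ ≤ ‖k‖ → ‖z‖ ≤ ‖k‖ → (k = x ∨ k = y ∨ k = z) → ∃ (k : ℚ_[p]) (x' y' z' : ℤ_[p]), k ≠ 0 ∧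
    x = k * x' ∧ y = k * y' ∧ z = k * z' ∧ (‖x'‖ = 1 ∨ ‖y'‖ = 1 ∨ ‖z'‖ = 1) := by
    intro k hk h1 h2 h3 h4
    have hk' := norm_pos_iff.2 hk
    have l : ∀ w : ℚ_[p], ‖w‖ ≤ ‖k‖ → ∃ w' : ℤ_[p], w = k * w' ∧ (k = w → ‖w'‖ = 1) := fun w hw => by
      obtain ⟨w', hw'⟩ := lift_int (x := w / k) (by rw [norm_div]; exact div_le_one_of_le₀ hw hk'.le)
      refine ⟨w', by rw [hw']; field_simp, fun h => ?_⟩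
      rw [PadicInt.norm_def, hw', ← h, div_self hk, norm_one]
    obtain ⟨x', a1, a2⟩ := l x h1
    obtain ⟨y', b1, b2⟩ := l y h2
    obtain ⟨z', c1, c2⟩ := l z h3
    exact ⟨k, x', y', z', hk, a1, b1, c1, h4.imp a2 (Or.imp b2 c2)⟩
  have ne : ∀ k : ℚ_[p], ‖x‖ ≤ ‖k‖ → ‖y‖ ≤ ‖k‖ → ‖z‖ ≤ ‖k‖ → k ≠ 0 := fun k h1 h2 h3 hk => by
    rw [hk, norm_zero] at h1 h2 h3
    exact h ⟨norm_le_zero_iff.1 h1, norm_le_zero_iff.1 h2, norm_le_zero_iff.1 h3⟩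
  rcases le_total ‖x‖ ‖y‖ with h1 | h1
  · rcases le_total ‖y‖ ‖z‖ with h2 | h2
    · exact key z (ne _ (h1.trans h2) h2 le_rfl) (h1.trans h2) h2 le_rfl (by simp)
    · exact key y (ne _ h1 le_rfl h2) h1 le_rfl h2 (by simp)
  · rcases le_total ‖x‖ ‖z‖ with h2 | h2
    · exact key z (ne _ h2 (h1.trans h2) le_rfl) h2 (h1.trans h2) le_rfl (by simp)
    · exact key x (ne _ le_rfl h1 h2) le_rfl h1 h2 (by simp)
end hensel
def Iso (F : Type*) [Field F] (a b c : ℤ) : Prop := ∃ x y z : F, ¬ (x = 0 ∧ y = 0 ∧ z = 0) ∧ a * x ^ 2 + b * y ^ 2 + c * z ^ 2 = 0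
section iso
variable {F : Type*} [Field F] {a b c : ℤ}
theorem Iso.rot (h : Iso F a b c) : Iso F b c a := by
  obtain ⟨x, y, z, h0, h⟩ := h
  exact ⟨y, z, x, by tauto, by linear_combination h⟩
theorem Iso.swap (h : Iso F a b c) : Iso F b a c := by
  obtain ⟨x, y, z, h0, h⟩ := h
  exact ⟨y, x, z, by tauto, by linear_combination h⟩
theorem iso_sq [CharZero F] {l : ℤ} (hl : l ≠ 0) : Iso F (l ^ 2 * a) b c ↔ Iso F a b c := by
  have hl' : (l : F) ≠ 0 := by exact_mod_cast hl
  constructor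
  · rintro ⟨x, y, z, h0, h⟩
    refine ⟨l * x, y, z, by simpa [hl'] using h0, ?_⟩
    grind
  · rintro ⟨x, y, z, h0, h⟩
    refine ⟨x / l, y, z, by simpa [hl'] using h0, ?_⟩
    grind
theorem iso_mul [CharZero F] {l : ℤ} (hl : l ≠ 0) : Iso F (l * a) (l * b) c ↔ Iso F a b (l * c) := by
  have hl' : (l : F) ≠ 0 := by exact_mod_cast hl
  constructor
  · rintro ⟨x, y, z, h0, h⟩
    refine ⟨l * x, l * y, z, by simpa [hl'] using h0, ?_⟩
    grind
  · rintro ⟨x, y, z, h0, h⟩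
    refine ⟨x, y, l * z, by simpa [hl'] using h0, ?_⟩
    grind
end iso
end Ono

namespace Ono
open scoped NumberTheorySymbols
theorem iso_two {a b c : ℤ} (h : Iso ℚ_[2] a b c) : ∃ X Y Z : ℤ, (X = 0 ∨ X = 1 ∨ X = 4) ∧ (Y = 0 ∨ Y = 1 ∨ Y = 4) ∧ (Z = 0 ∨ Z = 1 ∨ Z = 4) ∧
    (X = 1 ∨ Y = 1 ∨ Z = 1) ∧ 8 ∣ a * X + b * Y + c * Z := by
  obtain ⟨x, y, z, h0, h⟩ := h
  obtain ⟨k, x, y, z, hk, rfl, rfl, rfl, hu⟩ := primitive3 h0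
  have h1 : (a * x ^ 2 + b * y ^ 2 + c * z ^ 2 : ℤ_[2]) = 0 := by
    apply PadicInt.ext
    push_cast
    grind
  have h2 := congrArg (PadicInt.toZModPow (p := 2) 3) h1
  simp only [map_add, map_mul, map_pow, map_intCast, map_zero] at h2
  have sq : ∀ w : ℤ_[2], ∃ W : ℤ, (W = 0 ∨ W = 1 ∨ W = 4) ∧ PadicInt.toZModPow (p := 2) 3 w ^ 2 = W ∧ (‖w‖ = 1 → W = 1) := fun w => by
    have d1 : ∀ v : ZMod (2 ^ 3), IsUnit v → v ^ 2 = 1 := by decide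
    have d2 : ∀ v : ZMod (2 ^ 3), v ^ 2 = 0 ∨ v ^ 2 = 1 ∨ v ^ 2 = 4 := by decide
    by_cases hw : ‖w‖ = 1
    · exact ⟨1, by simp, by simpa using d1 _ ((PadicInt.isUnit_iff.2 hw).map _), fun _ => rfl⟩
    · rcases d2 (PadicInt.toZModPow (p := 2) 3 w) with h | h | h
      · exact ⟨0, by simp, by simpa using h, fun h => absurd h hw⟩
      · exact ⟨1, by simp, by simpa using h, fun h => absurd h hw⟩
      · exact ⟨4, by simp, by simpa using h, fun h => absurd h hw⟩
  obtain ⟨X, hX, eX, uX⟩ := sq x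
  obtain ⟨Y, hY, eY, uY⟩ := sq y
  obtain ⟨Z, hZ, eZ, uZ⟩ := sq z
  refine ⟨X, Y, Z, hX, hY, hZ, hu.imp uX (Or.imp uY uZ), ?_⟩
  rw [eX, eY, eZ] at h2
  have h3 : ((a * X + b * Y + c * Z : ℤ) : ZMod (2 ^ 3)) = 0 := by push_cast; exact h2
  rw [ZMod.intCast_zmod_eq_zero_iff_dvd] at h3
  exact_mod_cast h3
theorem norm_int_eq_one {p : ℕ} [Fact p.Prime] {a : ℤ} (h : ¬ (p : ℤ) ∣ a) : ‖(a : ℤ_[p])‖ = 1 :=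
  le_antisymm (PadicInt.norm_le_one _) (not_lt.1 fun h' => h ((PadicInt.norm_int_lt_one_iff_dvd a).1 h'))
theorem dvd_iff_toZMod {p : ℕ} [Fact p.Prime] {x : ℤ_[p]} : (p : ℤ_[p]) ∣ x ↔ PadicInt.toZMod x = 0 := by
  rw [← RingHom.mem_ker, PadicInt.ker_toZMod, PadicInt.maximalIdeal_eq_span_p, Ideal.mem_span_singleton]
theorem norm_eq_one_iff {p : ℕ} [Fact p.Prime] {x : ℤ_[p]} : ‖x‖ = 1 ↔ PadicInt.toZMod x ≠ 0 := by
  rw [Ne, ← dvd_iff_toZMod, ← PadicInt.norm_lt_one_iff_dvd, not_lt]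
  exact ⟨fun h => h.ge, fun h => le_antisymm (PadicInt.norm_le_one _) h⟩
theorem toZMod_int {p : ℕ} [Fact p.Prime] {a : ℤ} : PadicInt.toZMod (a : ℤ_[p]) = 0 ↔ (p : ℤ) ∣ a := by
  rw [map_intCast, ZMod.intCast_zmod_eq_zero_iff_dvd]
theorem iso_odd {p : ℕ} [Fact p.Prime] {a b c : ℤ} (h : Iso ℚ_[p] a b c) (ha : (p : ℤ) ∣ a) (hb : ¬ (p : ℤ) ∣ b) (hc : ¬ (p : ℤ) ∣ c)
    (ha2 : ¬ (p : ℤ) * p ∣ a) : J(-(b * c) | p) = 1 := by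
  obtain ⟨x, y, z, h0, h⟩ := h
  obtain ⟨k, x, y, z, hk, rfl, rfl, rfl, hu⟩ := primitive3 h0
  have h1 : (a * x ^ 2 + b * y ^ 2 + c * z ^ 2 : ℤ_[p]) = 0 := by
    apply PadicInt.ext
    push_cast
    grind
  have hpp : Prime (p : ℤ_[p]) := PadicInt.prime_p
  have h2 := congrArg (PadicInt.toZMod (p := p)) h1
  simp only [map_add, map_mul, map_pow, map_zero, toZMod_int.2 ha, zero_mul, zero_add] at h2
  have hb' := mt toZMod_int.1 hb
  have hc' := mt toZMod_int.1 hc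
  simp only [map_intCast] at h2 hb' hc'
  set Y := PadicInt.toZMod y
  set Z := PadicInt.toZMod z
  have hY : Y ≠ 0 := by
    intro hY
    have hZ : Z = 0 := by grind
    obtain ⟨y', rfl⟩ := dvd_iff_toZMod.2 hY
    obtain ⟨z', rfl⟩ := dvd_iff_toZMod.2 hZ
    obtain ⟨a', rfl⟩ := ha
    have ha' : ¬ (p : ℤ) ∣ a' := fun h => ha2 (mul_dvd_mul_left _ h)
    have h3 : (p : ℤ_[p]) ∣ a' * x ^ 2 := by
      refine ⟨-(b * y' ^ 2 + c * z' ^ 2), mul_left_cancel₀ hpp.ne_zero ?_⟩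
      push_cast at h1
      linear_combination h1
    rcases hpp.dvd_or_dvd h3 with h4 | h4
    · exact ha' (toZMod_int.1 (dvd_iff_toZMod.1 h4))
    · have h5 := hpp.dvd_of_dvd_pow h4
      rcases hu with h | h | h
      · exact norm_eq_one_iff.1 h (dvd_iff_toZMod.1 h5)
      · exact norm_eq_one_iff.1 h hY
      · exact norm_eq_one_iff.1 h hZ
  rw [← jacobiSym.legendreSym.to_jacobiSym, legendreSym.eq_one_iff]
  · exact ⟨c * Z / Y, by grind⟩
  grind
theorem iso_of_J {p : ℕ} [Fact p.Prime] (h2 : p ≠ 2) {a b c : ℤ} (hb : ¬ (p : ℤ) ∣ b) (hc : ¬ (p : ℤ) ∣ c) (h : J(-(b * c) | p) = 1) :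
    Iso ℚ_[p] a b c := by
  have hp : Prime (p : ℤ) := Nat.prime_iff_prime_int.1 Fact.out
  have hbc : ¬ (p : ℤ) ∣ -(b * c) := by rw [dvd_neg]; exact fun h => (hp.dvd_or_dvd h).elim hb hc
  rw [← jacobiSym.legendreSym.to_jacobiSym, legendreSym.eq_one_iff _ (by rwa [Ne, ZMod.intCast_zmod_eq_zero_iff_dvd])] at h
  obtain ⟨w, hw⟩ := isSquare_of_res h2 (norm_int_eq_one hbc) (by rwa [map_intCast])
  have hw' := congrArg (fun x : ℤ_[p] => (x : ℚ_[p])) hw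
  push_cast at hw'
  refine ⟨0, w, b, fun h => hb ?_, ?_⟩
  · have := h.2.2; have : b = 0 := by exact_mod_cast this
    rw [this]; exact dvd_zero _
  grind
theorem iso_of_units {p : ℕ} [Fact p.Prime] (h2 : p ≠ 2) {a b c : ℤ} (ha : ¬ (p : ℤ) ∣ a) (hb : ¬ (p : ℤ) ∣ b) (hc : ¬ (p : ℤ) ∣ c) :
    Iso ℚ_[p] a b c := by
  have ha' : (a : ZMod p) ≠ 0 := by rwa [Ne, ZMod.intCast_zmod_eq_zero_iff_dvd]
  have hb' : (b : ZMod p) ≠ 0 := by rwa [Ne, ZMod.intCast_zmod_eq_zero_iff_dvd]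
  have hc' : (c : ZMod p) ≠ 0 := by rwa [Ne, ZMod.intCast_zmod_eq_zero_iff_dvd]
  obtain ⟨x, y, hxy⟩ := FiniteField.exists_root_sum_quadratic (f := Polynomial.C (a : ZMod p) * Polynomial.X ^ 2)
    (g := Polynomial.C (b : ZMod p) * Polynomial.X ^ 2 + Polynomial.C (c : ZMod p)) (Polynomial.degree_C_mul_X_pow 2 ha')
    (by compute_degree!) (by rw [ZMod.card]; exact (Nat.Prime.eq_two_or_odd Fact.out).resolve_left h2)
  simp at hxy
  have key : ∀ (a b : ℤ) (x y : ZMod p), (a : ZMod p) ≠ 0 → x ≠ 0 → a * x ^ 2 + (b * y ^ 2 + c) = 0 → Iso ℚ_[p] a b c := by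
    intro a b x y ha' hx hxy
    obtain ⟨y', rfl⟩ := ZMod.ringHom_surjective (PadicInt.toZMod (p := p)) y
    have ha'' : ‖(a : ℤ_[p])‖ = 1 := norm_int_eq_one (by rwa [← ZMod.intCast_zmod_eq_zero_iff_dvd])
    obtain ⟨w, hw⟩ := isSquare_of_res h2 (u := -(a * (b * y' ^ 2 + c))) (by
      rw [norm_eq_one_iff]; simp only [map_neg, map_mul, map_add, map_pow, map_intCast]
      grind) ⟨a * x, by
        simp only [map_neg, map_mul, map_add, map_pow, map_intCast]
        grind⟩
    have hw' := congrArg (fun x : ℤ_[p] => (x : ℚ_[p])) hw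
    push_cast at hw'
    have ha0 : (a : ℚ_[p]) ≠ 0 := by
      intro h
      have : a = 0 := by exact_mod_cast h
      simp [this] at ha'
    refine ⟨w / a, y', 1, by simp, ?_⟩
    grind
  by_cases hx : x = 0
  · have hy : y ≠ 0 := by grind
    exact (key b a y x hb' hy (by linear_combination hxy)).swap
  grind
end Ono

namespace Ono
open scoped NumberTheorySymbols
def ks (x y z : ℤ) : ℤ := (1 - x * y - y * z - z * x) / 2
theorem pm_cases {a : ℤ} (h : a ≠ 0) : ∃ ε : ℤ, (ε = 1 ∨ ε = -1) ∧ a = ε * a.natAbs ∧ a.sign = ε := by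
  rcases lt_or_gt_of_ne h with h | h
  · grind
  · exact ⟨1, by simp, by omega, Int.sign_eq_one_of_pos h⟩
theorem chi4_pm {n : ℕ} (h : Odd n) : ∃ u : ℤ, (u = 1 ∨ u = -1) ∧ J(-1 | n) = u ∧ (4:ℤ) ∣ n - u ∧ ∀ m : ℕ, Odd m → J(m | n) = J(u | m) * J(n | m) := by
  rcases Nat.odd_mod_four_iff.1 (Nat.odd_iff.1 h) with h1 | h1
  · refine ⟨1, by simp, ?_, by omega, fun m hm => ?_⟩
    · rw [jacobiSym.at_neg_one h, ZMod.χ₄_nat_one_mod_four h1]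
    · rw [jacobiSym.quadratic_reciprocity_one_mod_four' hm h1]; simp
  · refine ⟨-1, by simp, ?_, by omega, fun m hm => ?_⟩
    · rw [jacobiSym.at_neg_one h, ZMod.χ₄_nat_three_mod_four h1]
    · rw [jacobiSym.at_neg_one hm]
      rcases Nat.odd_mod_four_iff.1 (Nat.odd_iff.1 hm) with h2 | h2
      · rw [ZMod.χ₄_nat_one_mod_four h2, jacobiSym.quadratic_reciprocity_one_mod_four h2 h]; simp
      · rw [ZMod.χ₄_nat_three_mod_four h2, jacobiSym.quadratic_reciprocity_three_mod_four h2 h1]; simp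
theorem J_sq {m n : ℕ} (h : m.Coprime n) : J(m | n) = 1 ∨ J(m | n) = -1 := jacobiSym.eq_one_or_neg_one (by simpa [Int.gcd_natCast_natCast] using h)
theorem main_formula {a b c : ℤ} (ha : Odd a) (hb : Odd b) (hc : Odd c) (hab : IsCoprime a b) (hbc : IsCoprime b c) (hca : IsCoprime c a) :
    ∃ u v w : ℤ, (u = 1 ∨ u = -1) ∧ (v = 1 ∨ v = -1) ∧ (w = 1 ∨ w = -1) ∧ 4 ∣ a - u ∧ 4 ∣ b - v ∧ 4 ∣ c - w ∧
    J(-(b * c) | a.natAbs) * J(-(c * a) | b.natAbs) * J(-(a * b) | c.natAbs) = ks u v w * ks a.sign b.sign c.sign := by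
  have ne : ∀ {x : ℤ}, Odd x → x ≠ 0 := fun h h0 => by subst h0; simp at h
  obtain ⟨e1, he1, ea, sa⟩ := pm_cases (ne ha)
  obtain ⟨e2, he2, eb, sb⟩ := pm_cases (ne hb)
  obtain ⟨e3, he3, ec, sc⟩ := pm_cases (ne hc)
  have oa : Odd a.natAbs := Int.natAbs_odd.2 ha
  have ob : Odd b.natAbs := Int.natAbs_odd.2 hb
  have oc : Odd c.natAbs := Int.natAbs_odd.2 hc
  obtain ⟨u1, hu1, ju1, du1, ru1⟩ := chi4_pm oa
  obtain ⟨u2, hu2, ju2, du2, ru2⟩ := chi4_pm ob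
  obtain ⟨u3, hu3, ju3, du3, ru3⟩ := chi4_pm oc
  have q1 := J_sq (Int.isCoprime_iff_nat_coprime.1 hab)
  have q2 := J_sq (Int.isCoprime_iff_nat_coprime.1 hbc)
  have q3 := J_sq (Int.isCoprime_iff_nat_coprime.1 hca)
  have r1 := ru1 _ ob
  have r2 := ru2 _ oc
  have r3 := ru3 _ oa
  rw [sa, sb, sc]
  refine ⟨e1 * u1, e2 * u2, e3 * u3, ?_, ?_, ?_, ?_, ?_, ?_, ?_⟩
  · grind
  · grind
  · grind
  · have h := Dvd.dvd.mul_left du1 e1; grind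
  · have h := Dvd.dvd.mul_left du2 e2; grind
  · have h := Dvd.dvd.mul_left du3 e3; grind
  generalize a.natAbs = α at *
  generalize b.natAbs = β at *
  generalize c.natAbs = γ at *
  subst ea eb ec
  rw [show -(e2 * (β:ℤ) * (e3 * γ)) = (-(e2 * e3)) * (β * γ) by ring, show -(e3 * (γ:ℤ) * (e1 * α)) = (-(e3 * e1)) * (γ * α) by ring,
    show -(e1 * (α:ℤ) * (e2 * β)) = (-(e1 * e2)) * (α * β) by ring]
  simp only [jacobiSym.mul_left]
  rw [r1, r2, r3]
  generalize J((α:ℤ) | β) = j1 at *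
  generalize J((β:ℤ) | γ) = j2 at *
  generalize J((γ:ℤ) | α) = j3 at *
  have o1 : ∀ n : ℕ, J(1 | n) = 1 := jacobiSym.one_left
  clear r1 r2 r3 ru1 ru2 ru3 ha hb hc hab hbc hca du1 du2 du3 ne
  rcases hu1 with rfl | rfl <;> rcases hu2 with rfl | rfl <;> rcases hu3 with rfl | rfl <;> 
  rcases he1 with rfl | rfl <;> rcases he2 with rfl | rfl <;> rcases he3 with rfl | rfl <;>
  norm_num only [o1, ju1, ju2, ju3, ks] <;>
  rcases q1 with rfl | rfl <;> rcases q2 with rfl | rfl <;> rcases q3 with rfl | rfl <;> norm_num only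
end Ono

namespace Ono
open scoped NumberTheorySymbols
theorem jac_except {m : ℤ} {n p : ℕ} (hn : Squarefree n) (h : ∀ q, q.Prime → q ∣ n → q ≠ p → J(m | q) = 1) (hp : p = 0 ∨ p.Prime) :
    J(m | n) = if p ∣ n then J(m | p) else 1 := by
  have base : ∀ k : ℕ, k ≠ 0 → (∀ q, q.Prime → q ∣ k → J(m | q) = 1) → J(m | k) = 1 := by
    intro k
    induction k using Nat.recOnMul with
    | zero => simp
    | one => simp
    | prime q hq => intro _ h; exact h q hq dvd_rfl
    | mul a b iha ihb =>
      intro h0 h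
      rw [jacobiSym.mul_right' _ (by rintro rfl; simp at h0) (by rintro rfl; simp at h0), iha (by rintro rfl; simp at h0) fun q hq hd => h q hq (hd.mul_right _),
        ihb (by rintro rfl; simp at h0) fun q hq hd => h q hq (hd.mul_left _), one_mul]
  rcases hp with rfl | hp
  · grind
  split_ifs with hd
  · obtain ⟨k, rfl⟩ := hd
    have hk : k ≠ 0 := by rintro rfl; simp at hn
    rw [jacobiSym.mul_right' _ hp.ne_zero hk, base k hk, mul_one]
    intro q hq hd
    refine h q hq (hd.mul_left _) ?_
    rintro rfl
    exact hq.not_isUnit (hn q (mul_dvd_mul_left q hd))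
  · exact base n hn.ne_zero fun q hq hd' => h q hq hd' (by grind)
def Ex (p : ℕ) (m n : ℤ) : ℤ := if (p : ℤ) ∣ n then J(m | p) else 1
theorem jac_ex {m n : ℤ} {p : ℕ} (hn : Squarefree n) (h : ∀ q : ℕ, q.Prime → (q:ℤ) ∣ n → q ≠ p → J(m | q) = 1) (hp : p = 0 ∨ p.Prime) :
    J(m | n.natAbs) = Ex p m n := by
  rw [jac_except (Int.squarefree_natAbs.2 hn) (fun q hq hd => h q hq (Int.natCast_dvd.2 hd)) hp, Ex]
  simp only [Int.natCast_dvd]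
theorem J_two {b : ℤ} (hb : Odd b) : J(2 | b.natAbs) = if b % 8 = 1 ∨ b % 8 = 7 then 1 else -1 := by
  have := Int.odd_iff.1 hb
  rw [jacobiSym.at_two (Int.natAbs_odd.2 hb), ZMod.χ₈_nat_eq_if_mod_eight, if_neg (by omega)]
  split_ifs <;> omega
def AllBut (p : ℕ) (a b c : ℤ) : Prop := ∀ (q : ℕ) [Fact q.Prime], q ≠ p → Iso ℚ_[q] a b c
theorem AllBut.rot {p : ℕ} {a b c : ℤ} (h : AllBut p a b c) : AllBut p b c a := fun q _ hq => (h q hq).rot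
theorem sqf_J {p : ℕ} {a b c : ℤ} (hs : Squarefree (a * b * c)) (h : AllBut p a b c) {q : ℕ} (hq : q.Prime) (hd : (q:ℤ) ∣ a) (hqp : q ≠ p) : J(-(b * c) | q) = 1 := by
  haveI := Fact.mk hq
  have hu : ¬ IsUnit (q : ℤ) := (Nat.prime_iff_prime_int.1 hq).not_unit
  refine iso_odd (h q hqp) hd (fun hb => hu (hs _ ((mul_dvd_mul hd hb).mul_right _))) (fun hc => hu (hs _ ?_)) (fun h2 => hu (hs _ ?_))
  · rw [show a * b * c = a * c * b by ring]; exact (mul_dvd_mul hd hc).mul_right _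
  · rw [mul_assoc]; exact h2.mul_right _
theorem core_odd {p : ℕ} {a b c : ℤ} (hp : p = 0 ∨ p.Prime) (hp2 : p ≠ 2) (hs : Squarefree (a * b * c)) (h : AllBut p a b c)
    (ha : Odd a) (hb : Odd b) (hc : Odd c) :
    Ex p (-(b * c)) a * Ex p (-(c * a)) b * Ex p (-(a * b)) c = ks a.sign b.sign c.sign := by
  have hs2 : Squarefree (b * c * a) := by grind
  have hs3 : Squarefree (c * a * b) := by grind
  obtain ⟨u, v, w, hu, hv, hw, du, dv, dw, e⟩ := main_formula ha hb hc
    (squarefree_mul_iff.1 (hs.of_mul_left)).1.isCoprime (squarefree_mul_iff.1 (hs2.of_mul_left)).1.isCoprime (squarefree_mul_iff.1 (hs3.of_mul_left)).1.isCoprime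
  rw [jac_ex hs.of_mul_left.of_mul_left (fun q hq hd hqp => sqf_J hs h hq hd hqp) hp,
    jac_ex hs2.of_mul_left.of_mul_left (fun q hq hd hqp => sqf_J hs2 h.rot hq hd hqp) hp,
    jac_ex hs3.of_mul_left.of_mul_left (fun q hq hd hqp => sqf_J hs3 h.rot.rot hq hd hqp) hp] at e
  rw [e]
  have k1 : ks u v w = 1 := by
    obtain ⟨X, Y, Z, hX, hY, hZ, h1, h8⟩ := iso_two (h 2 hp2.symm)
    have := Int.odd_iff.1 ha
    have := Int.odd_iff.1 hb
    have := Int.odd_iff.1 hc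
    have : u = -v ∨ v = -w ∨ w = -u := by
      grind
    rcases hu with rfl | rfl <;> rcases hv with rfl | rfl <;> rcases hw with rfl | rfl <;> simp at this <;> rfl
  rw [k1, one_mul]
theorem core_even {p : ℕ} {a b c : ℤ} (hp : p = 0 ∨ p.Prime) (hp2 : p ≠ 2) (hs : Squarefree (2 * a * b * c)) (h : AllBut p (2 * a) b c)
    (ha : Odd a) (hb : Odd b) (hc : Odd c) :
    Ex p (-(b * c)) (2 * a) * Ex p (-(c * (2 * a))) b * Ex p (-(2 * a * b)) c = ks (2 * a).sign b.sign c.sign := by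
  have hs1 : Squarefree (a * b * c) := hs.squarefree_of_dvd ⟨2, by ring⟩
  have hs2 : Squarefree (b * c * (2 * a)) := by grind
  have hs3 : Squarefree (c * (2 * a) * b) := by grind
  have hs2' : Squarefree (b * c * a) := by grind
  have hs3' : Squarefree (c * a * b) := by grind
  obtain ⟨u, v, w, hu, hv, hw, du, dv, dw, e⟩ := main_formula ha hb hc
    (squarefree_mul_iff.1 (hs1.of_mul_left)).1.isCoprime (squarefree_mul_iff.1 (hs2'.of_mul_left)).1.isCoprime (squarefree_mul_iff.1 (hs3'.of_mul_left)).1.isCoprime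
  have e2 := jac_ex hs2.of_mul_left.of_mul_left (fun q hq hd hqp => sqf_J hs2 h.rot hq hd hqp) hp
  have e3 := jac_ex hs3.of_mul_left.of_mul_left (fun q hq hd hqp => sqf_J hs3 h.rot.rot hq hd hqp) hp
  have e1 : J(-(b * c) | a.natAbs) = Ex p (-(b * c)) (2 * a) := by
    rw [jac_ex hs1.of_mul_left.of_mul_left (fun q hq hd hqp => sqf_J hs h hq (hd.mul_left _) hqp) hp, Ex, Ex]
    refine if_congr ⟨fun h => h.mul_left _, fun h => ?_⟩ rfl rfl
    rcases hp with rfl | hp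
    · simpa using h
    · refine ((Nat.prime_iff_prime_int.1 hp).dvd_or_dvd h).resolve_left fun h => hp2 ?_
      exact (Nat.prime_dvd_prime_iff_eq hp Nat.prime_two).1 (by exact_mod_cast h)
  rw [← e1, ← e2, ← e3, show -(c * (2 * a)) = 2 * -(c * a) by ring, show -(2 * a * b) = 2 * -(a * b) by ring, jacobiSym.mul_left 2, jacobiSym.mul_left 2,
    show ∀ x y z w t : ℤ, x * (y * z) * (w * t) = (y * w) * (x * z * t) by intros; ring, e, J_two hb, J_two hc]
  have k1 : (if b % 8 = 1 ∨ b % 8 = 7 then (1:ℤ) else -1) * (if c % 8 = 1 ∨ c % 8 = 7 then 1 else -1) = ks u v w := by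
    obtain ⟨X, Y, Z, hX, hY, hZ, h1, h8⟩ := iso_two (h 2 hp2.symm)
    have := Int.odd_iff.1 ha
    have := Int.odd_iff.1 hb
    have := Int.odd_iff.1 hc
    have : 8 ∣ b + c ∨ 8 ∣ 2 * a + b + c := by
      rcases hX with rfl | rfl | rfl <;> rcases hY with rfl | rfl | rfl <;> rcases hZ with rfl | rfl | rfl <;> omega
    clear hX hY hZ h1 h8 e e1 e2 e3
    rcases hu with rfl | rfl <;> rcases hv with rfl | rfl <;> rcases hw with rfl | rfl <;> norm_num only [ks] <;> split_ifs <;> omega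
  grind
theorem core {p : ℕ} {a b c : ℤ} (hp : p = 0 ∨ p.Prime) (hp2 : p ≠ 2) (hs : Squarefree (a * b * c)) (h : AllBut p a b c) :
    Ex p (-(b * c)) a * Ex p (-(c * a)) b * Ex p (-(a * b)) c = ks a.sign b.sign c.sign := by
  have ev : ∀ {a b c : ℤ}, Squarefree (a * b * c) → AllBut p a b c → Even a → Ex p (-(b * c)) a * Ex p (-(c * a)) b * Ex p (-(a * b)) c = ks a.sign b.sign c.sign := by
    intro a b c hs h ha
    obtain ⟨a, rfl⟩ := ha.two_dvd
    have od : ∀ x : ℤ, 2 * x ∣ 2 * a * b * c → Odd x := by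
      intro x hx
      rw [← Int.not_even_iff_odd, even_iff_two_dvd]
      intro h2
      have := hs 2 ((mul_dvd_mul_left 2 h2).trans hx)
      norm_num [Int.isUnit_iff] at this
    exact core_even hp hp2 hs h (od a ⟨b * c, by ring⟩) (od b ⟨a * c, by ring⟩) (od c ⟨a * b, by ring⟩)
  have ksr : ∀ x y z, ks x y z = ks y z x := by intros; unfold ks; congr 1; ring
  rcases Int.even_or_odd a with ha | ha
  · exact ev hs h ha
  rcases Int.even_or_odd b with hb | hb
  · rw [ksr, ← ev (by grind) h.rot hb]; ring
  rcases Int.even_or_odd c with hc | hc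
  · rw [ksr, ksr, ← ev (by grind) h.rot.rot hc]; ring
  exact core_odd hp hp2 hs h ha hb hc
end Ono

namespace Ono
open scoped NumberTheorySymbols
def Rec (a b c : ℤ) : Prop := (AllBut 0 a b c → Iso ℝ a b c) ∧ ∀ (p : ℕ) [Fact p.Prime], p ≠ 2 → Iso ℝ a b c → AllBut p a b c → Iso ℚ_[p] a b c
theorem Rec.of {a b c a' b' c' : ℤ} (h : ∀ (F : Type) [Field F] [CharZero F], Iso F a b c ↔ Iso F a' b' c') (hr : Rec a' b' c') : Rec a b c := by
  refine ⟨fun h1 => (h ℝ).2 (hr.1 fun q _ hq => (h _).1 (h1 q hq)), fun p _ h2 hR h1 => (h _).2 (hr.2 p h2 ((h ℝ).1 hR) fun q _ hq => (h _).1 (h1 q hq))⟩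
theorem Rec.rot {a b c : ℤ} (hr : Rec a b c) : Rec b c a := hr.of fun F _ _ => ⟨fun h => h.rot.rot, fun h => h.rot⟩
theorem iso_real_iff {a b c : ℤ} (ha : a ≠ 0) (hb : b ≠ 0) (hc : c ≠ 0) : Iso ℝ a b c ↔ ks a.sign b.sign c.sign = 1 := by
  have key : ∀ {a b c : ℤ}, 0 < a → b < 0 → Iso ℝ a b c := by
    intro a b c ha hb
    have ha' : (0:ℝ) < a := by exact_mod_cast ha
    have hb' : (b:ℝ) < 0 := by exact_mod_cast hb
    refine ⟨√(-b), √a, 0, fun h => ?_, ?_⟩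
    · grind
    grind
  have pos : ∀ {a b c : ℤ}, 0 < a → 0 < b → 0 < c → ¬ Iso ℝ a b c := by
    rintro a b c ha hb hc ⟨x, y, z, h0, h⟩
    have ha' : (0:ℝ) < a := by exact_mod_cast ha
    have hb' : (0:ℝ) < b := by exact_mod_cast hb
    have hc' : (0:ℝ) < c := by exact_mod_cast hc
    have h1 := mul_nonneg ha'.le (sq_nonneg x)
    have h2 := mul_nonneg hb'.le (sq_nonneg y)
    have h3 := mul_nonneg hc'.le (sq_nonneg z)
    apply h0
    have e1 : a * x ^ 2 = 0 := by linarith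
    have e2 : b * y ^ 2 = 0 := by linarith
    grind
  have neg : ∀ {a b c : ℤ}, a < 0 → b < 0 → c < 0 → ¬ Iso ℝ a b c := by
    rintro a b c ha hb hc ⟨x, y, z, h0, h⟩
    refine pos (neg_pos.2 ha) (neg_pos.2 hb) (neg_pos.2 hc) ⟨x, y, z, h0, ?_⟩
    grind
  rcases lt_or_gt_of_ne ha with ha | ha <;> rcases lt_or_gt_of_ne hb with hb | hb <;> rcases lt_or_gt_of_ne hc with hc | hc <;>
    simp only [Int.sign_eq_neg_one_of_neg, Int.sign_eq_one_of_pos, ha, hb, hc] <;> norm_num [ks]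
  · exact neg ha hb hc
  · exact (key hc ha).rot
  · exact (key hb hc).rot.rot
  · exact (key hb ha).swap
  · exact key ha hb
  · exact key ha hb
  · exact (key hb hc).rot.rot
  · exact pos ha hb hc
theorem rec_sqf {a b c : ℤ} (hs : Squarefree (a * b * c)) : Rec a b c := by
  have h0 := hs.ne_zero
  have ha : a ≠ 0 := by rintro rfl; simp at h0
  have hb : b ≠ 0 := by rintro rfl; simp at h0
  have hc : c ≠ 0 := by rintro rfl; simp at h0
  rw [Rec, iso_real_iff ha hb hc]
  refine ⟨fun h => ?_, fun p _ h2 hR h => ?_⟩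
  · rw [← core (Or.inl rfl) (by norm_num) hs h]
    simp [Ex, ha, hb, hc]
  · have hp : p.Prime := Fact.out
    have hu : ¬ IsUnit (p : ℤ) := (Nat.prime_iff_prime_int.1 hp).not_unit
    have e := core (Or.inr hp) h2 hs h
    rw [hR] at e
    have k : ∀ {a b c : ℤ}, Squarefree (a * b * c) → Ex p (-(b * c)) a * Ex p (-(c * a)) b * Ex p (-(a * b)) c = 1 → (p:ℤ) ∣ a → Iso ℚ_[p] a b c := by
      intro a b c hs e ha
      have hb : ¬ (p:ℤ) ∣ b := fun hb => hu (hs _ ((mul_dvd_mul ha hb).mul_right _))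
      have hc : ¬ (p:ℤ) ∣ c := fun hc => hu (hs _ (by rw [show a * b * c = a * c * b by ring]; exact (mul_dvd_mul ha hc).mul_right _))
      refine iso_of_J h2 hb hc ?_
      simpa [Ex, ha, hb, hc] using e
    by_cases da : (p:ℤ) ∣ a
    · exact k hs e da
    by_cases db : (p:ℤ) ∣ b
    · exact (k (by grind) (by rw [← e]; ring) db).rot.rot
    by_cases dc : (p:ℤ) ∣ c
    · exact (k (by grind) (by rw [← e]; ring) dc).rot
    exact iso_of_units h2 da db dc
theorem rec_all {a b c : ℤ} (h : a * b * c ≠ 0) : Rec a b c := by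
  obtain ⟨n, hn⟩ : ∃ n, (a * b * c).natAbs = n := ⟨_, rfl⟩
  induction n using Nat.strong_induction_on generalizing a b c with
  | _ n ih =>
  by_cases hs : Squarefree (a * b * c)
  · exact rec_sqf hs
  rw [← Int.squarefree_natAbs, Nat.squarefree_iff_prime_squarefree] at hs
  push Not at hs
  obtain ⟨q, hq, hd⟩ := hs
  have hd : (q:ℤ) ^ 2 ∣ a * b * c := by rw [sq]; exact Int.natCast_dvd.2 (by simpa using hd)
  have hq' := Nat.prime_iff_prime_int.1 hq
  have q0 : (q:ℤ) ≠ 0 := hq'.ne_zero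
  have lt : ∀ m k : ℤ, k * m = a * b * c → k.natAbs > 1 → m.natAbs < n := by
    intro m k e hk
    rw [← hn, ← e, Int.natAbs_mul]
    have : m.natAbs ≠ 0 := by grind
    nlinarith [Nat.pos_of_ne_zero this]
  have two : ∀ {x y z : ℤ}, x * y * z = a * b * c → (q:ℤ) ∣ x → (q:ℤ) ∣ y → Rec x y z := by
    rintro x y z e ⟨x, rfl⟩ ⟨y, rfl⟩
    refine Rec.of (fun F _ _ => iso_mul q0) (ih _ (lt (x * y * (q * z)) q (by rw [← e]; ring) (by simpa using hq.one_lt)) ?_ rfl)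
    grind
  have one : ∀ {x y z : ℤ}, x * y * z = a * b * c → (q:ℤ) ^ 2 ∣ x → Rec x y z := by
    rintro x y z e ⟨x, rfl⟩
    refine Rec.of (fun F _ _ => iso_sq q0) (ih _ (lt (x * y * z) (q ^ 2) (by rw [← e]; ring) (by
      rw [Int.natAbs_pow]; exact Nat.one_lt_pow (by norm_num) (by simpa using hq.one_lt))) ?_ rfl)
    grind
  by_cases da : (q:ℤ) ∣ a
  · by_cases db : (q:ℤ) ∣ b
    · exact two rfl da db
    by_cases dc : (q:ℤ) ∣ c
    · exact (two (by ring) dc da (z := b)).rot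
    · exact one rfl (hq'.pow_dvd_of_dvd_mul_right _ db (hq'.pow_dvd_of_dvd_mul_right _ dc hd))
  by_cases db : (q:ℤ) ∣ b
  · by_cases dc : (q:ℤ) ∣ c
    · exact (two (by ring) db dc (z := a)).rot.rot
    · refine (one (x := b) (y := c) (z := a) (by ring) ?_).rot.rot
      exact hq'.pow_dvd_of_dvd_mul_left _ da (hq'.pow_dvd_of_dvd_mul_right _ dc hd)
  · refine (one (x := c) (y := a) (z := b) (by ring) ?_).rot
    have : ¬ (q:ℤ) ∣ a * b := fun h => (hq'.dvd_or_dvd h).elim da db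
    exact hq'.pow_dvd_of_dvd_mul_left _ this hd
end Ono

namespace Ono
open Matrix
theorem diag3 (M : Matrix (Fin 3) (Fin 3) ℚ) (hM : M.IsSymm) (hd : M.det ≠ 0) :
    ∃ (V : Matrix (Fin 3) (Fin 3) ℚ) (w : Fin 3 → ℤ), V.det ≠ 0 ∧ (∀ i, w i ≠ 0) ∧ Vᵀ * M * V = Matrix.diagonal (fun i => (w i : ℚ)) := by
  have hs : (Matrix.toBilin' M).IsSymm := by
    rw [LinearMap.BilinForm.isSymm_iff_basis (Pi.basisFun ℚ (Fin 3))]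
    intro i j
    simp only [Pi.basisFun_apply, Matrix.toBilin'_single]
    exact hM.apply j i
  haveI : Invertible (2:ℚ) := invertibleOfNonzero two_ne_zero
  obtain ⟨v, hv⟩ := LinearMap.BilinForm.exists_orthogonal_basis (LinearMap.BilinForm.isSymm_iff.1 hs)
  let e : Fin (Module.finrank ℚ (Fin 3 → ℚ)) ≃ Fin 3 := finCongr (by simp)
  let v' := v.reindex e
  let V := (Pi.basisFun ℚ (Fin 3)).toMatrix v'
  have h1 : Vᵀ * M * V = LinearMap.BilinForm.toMatrix v' (Matrix.toBilin' M) := by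
    rw [← LinearMap.BilinForm.toMatrix_mul_basis_toMatrix (Pi.basisFun ℚ (Fin 3)) v' (Matrix.toBilin' M), LinearMap.BilinForm.toMatrix_basisFun, LinearMap.BilinForm.toMatrix'_toBilin']
  have hV : V.det ≠ 0 := by
    haveI : Invertible V := (Pi.basisFun ℚ (Fin 3)).invertibleToMatrix v'
    exact (Matrix.isUnit_det_of_invertible V).ne_zero
  set t : Fin 3 → ℚ := fun i => (Vᵀ * M * V) i i with ht
  have h2 : Vᵀ * M * V = Matrix.diagonal t := by
    ext i j
    by_cases hij : i = j
    · subst hij; simp [ht]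
    · rw [Matrix.diagonal_apply_ne _ hij, h1, LinearMap.BilinForm.toMatrix_apply]
      simp only [v', Module.Basis.reindex_apply]
      exact hv (fun h => hij (e.symm.injective h))
  have ht0 : ∀ i, t i ≠ 0 := by
    intro i h0
    have := congrArg Matrix.det h2
    rw [Matrix.det_mul, Matrix.det_mul, Matrix.det_transpose, Matrix.det_diagonal, Finset.prod_eq_zero (Finset.mem_univ i) h0] at this
    simp [hV, hd] at this
  refine ⟨V * Matrix.diagonal (fun i => ((t i).den : ℚ)), fun i => (t i).num * (t i).den, ?_, ?_, ?_⟩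
  · rw [Matrix.det_mul, Matrix.det_diagonal]
    exact mul_ne_zero hV (Finset.prod_ne_zero_iff.2 fun i _ => by exact_mod_cast (t i).den_nz)
  · intro i; exact mul_ne_zero (Rat.num_ne_zero.2 (ht0 i)) (by exact_mod_cast (t i).den_nz)
  · rw [Matrix.transpose_mul, Matrix.diagonal_transpose, show ∀ D V M : Matrix (Fin 3) (Fin 3) ℚ, D * Vᵀ * M * (V * D) = D * (Vᵀ * M * V) * D by
      grind, h2, Matrix.diagonal_mul_diagonal, Matrix.diagonal_mul_diagonal]
    congr 1; ext i; push_cast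
    have := Rat.den_mul_eq_num (t i)
    grind
variable {A B : ℤ}
def Ob (F : Type*) [Field F] [Algebra ℚ F] (α : Cub ℚ A B) : Prop :=
  ∃ z : Cub F A B, z ≠ 0 ∧ (Cub.map (algebraMap ℚ F) α * z ^ 2).c = 0
def gram {R : Type*} [CommRing R] (α : Cub R A B) : Matrix (Fin 3) (Fin 3) R :=
  !![α.c, α.b, α.a - A * α.c; α.b, α.a - A * α.c, -A * α.b - B * α.c; α.a - A * α.c, -A * α.b - B * α.c, -A * (α.a - A * α.c) - B * α.b]
theorem gram_det {R : Type*} [CommRing R] (α : Cub R A B) : (gram α).det = - α.N := by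
  rw [gram, Matrix.det_fin_three]; simp [Cub.N]; ring
theorem gram_symm {R : Type*} [CommRing R] (α : Cub R A B) : (gram α).IsSymm := by
  ext i j; fin_cases i <;> fin_cases j <;> simp [gram]
theorem gram_q {R : Type*} [CommRing R] (α z : Cub R A B) : ![z.a, z.b, z.c] ⬝ᵥ gram α *ᵥ ![z.a, z.b, z.c] = (α * z ^ 2).c := by
  simp [gram, Matrix.mulVec, dotProduct, Fin.sum_univ_three, pow_two]; ring
theorem gram_map {R S : Type*} [CommRing R] [CommRing S] (g : R →+* S) (α : Cub R A B) : (gram α).map g = gram (Cub.map g α) := by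
  ext i j; fin_cases i <;> fin_cases j <;> simp [gram]
theorem ob_iff_vec {F : Type*} [Field F] [Algebra ℚ F] (α : Cub ℚ A B) : Ob F α ↔ ∃ x : Fin 3 → F, x ≠ 0 ∧ x ⬝ᵥ (gram α).map (algebraMap ℚ F) *ᵥ x = 0 := by
  rw [gram_map]
  constructor
  · rintro ⟨z, hz, h⟩
    refine ⟨![z.a, z.b, z.c], fun h0 => hz ?_, by rw [gram_q, h]⟩
    have h1 := congrFun h0 0; have h2 := congrFun h0 1; have h3 := congrFun h0 2
    ext <;> simpa using ‹_›
  · rintro ⟨x, hx, h⟩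
    refine ⟨⟨x 0, x 1, x 2⟩, fun h0 => hx ?_, ?_⟩
    · ext i; fin_cases i
      · exact congrArg Cub.a h0
      · exact congrArg Cub.b h0
      · exact congrArg Cub.c h0
    · rw [← gram_q, ← h]
      have : x = ![x 0, x 1, x 2] := by ext i; fin_cases i <;> rfl
      rw [← this]
theorem ob_iso {α : Cub ℚ A B} (hα : α.N ≠ 0) : ∃ a b c : ℤ, a * b * c ≠ 0 ∧ ∀ (F : Type) [Field F] [Algebra ℚ F], Ob F α ↔ Iso F a b c := by
  obtain ⟨V, w, hV, hw, e⟩ := diag3 (gram α) (gram_symm α) (by rw [gram_det]; exact neg_ne_zero.2 hα)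
  refine ⟨w 0, w 1, w 2, mul_ne_zero (mul_ne_zero (hw 0) (hw 1)) (hw 2), fun F _ _ => ?_⟩
  rw [ob_iff_vec]
  set g := algebraMap ℚ F with hg
  have hVF : (V.map g).det ≠ 0 := by
    rw [← RingHom.mapMatrix_apply, ← RingHom.map_det]; exact (map_ne_zero g).2 hV
  have eF : (V.map g)ᵀ * (gram α).map g * V.map g = Matrix.diagonal (fun i => (w i : F)) := by
    have := congrArg (fun M => M.map g) e
    simp only [Matrix.map_mul, Matrix.diagonal_map (map_zero g)] at this
    rw [← Matrix.transpose_map, this]; simp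
  have key : ∀ y : Fin 3 → F, (V.map g *ᵥ y) ⬝ᵥ (gram α).map g *ᵥ (V.map g *ᵥ y) = w 0 * y 0 ^ 2 + w 1 * y 1 ^ 2 + w 2 * y 2 ^ 2 := by
    intro y
    have : (V.map g *ᵥ y) ⬝ᵥ (gram α).map g *ᵥ (V.map g *ᵥ y) = y ⬝ᵥ ((V.map g)ᵀ * (gram α).map g * V.map g) *ᵥ y := by
      rw [← Matrix.mulVec_mulVec, ← Matrix.mulVec_mulVec, Matrix.dotProduct_mulVec y, Matrix.vecMul_transpose]
    rw [this, eF]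
    simp [Matrix.mulVec_diagonal, dotProduct, Fin.sum_univ_three]; ring
  constructor
  · rintro ⟨x, hx, h⟩
    have hx' : V.map g *ᵥ ((V.map g)⁻¹ *ᵥ x) = x := by
      rw [Matrix.mulVec_mulVec, Matrix.mul_nonsing_inv _ (isUnit_iff_ne_zero.2 hVF), Matrix.one_mulVec]
    set y := (V.map g)⁻¹ *ᵥ x
    rw [← hx', key] at h
    refine ⟨y 0, y 1, y 2, fun h0 => hx ?_, h⟩
    have : y = 0 := by ext i; fin_cases i; exacts [h0.1, h0.2.1, h0.2.2]
    rw [← hx', this, Matrix.mulVec_zero]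
  · rintro ⟨y0, y1, y2, h0, h⟩
    refine ⟨V.map g *ᵥ ![y0, y1, y2], fun h1 => h0 ?_, by rw [key]; simpa using h⟩
    have := Matrix.eq_zero_of_mulVec_eq_zero hVF h1
    exact ⟨congrFun this 0, congrFun this 1, congrFun this 2⟩
theorem ob_real {α : Cub ℚ A B} (hα : α.N ≠ 0) (h : ∀ (q : ℕ) [Fact q.Prime], Ob ℚ_[q] α) : Ob ℝ α := by
  obtain ⟨a, b, c, h0, e⟩ := ob_iso hα
  exact (e ℝ).2 ((rec_all h0).1 fun q _ _ => (e _).1 (h q))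
theorem ob_p {α : Cub ℚ A B} (hα : α.N ≠ 0) (p : ℕ) [Fact p.Prime] (hp : p ≠ 2) (hR : Ob ℝ α) (h : ∀ (q : ℕ) [Fact q.Prime], q ≠ p → Ob ℚ_[q] α) : Ob ℚ_[p] α := by
  obtain ⟨a, b, c, h0, e⟩ := ob_iso hα
  exact (e _).2 ((rec_all h0).2 p hp ((e ℝ).1 hR) fun q _ hq => (e _).1 (h q hq))
end Ono

namespace Ono
open Matrix
variable {A B : ℤ}
def vl {S : Type*} [CommRing S] (r : S) (x : Cub S A B) : S := x.a + x.b * r + x.c * r ^ 2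
section
variable {S T : Type*} [CommRing S] [CommRing T] {r : S}
theorem vl_mul (h : r ^ 3 + A * r + B = 0) (x y : Cub S A B) : vl r (x * y) = vl r x * vl r y := (Cub.ev (RingHom.id S) r h).map_mul x y
@[simp] theorem vl_add (x y : Cub S A B) : vl r (x + y) = vl r x + vl r y := by simp [vl]; ring
@[simp] theorem vl_sub (x y : Cub S A B) : vl r (x - y) = vl r x - vl r y := by simp [vl]; ring
@[simp] theorem vl_of (s : S) : vl r (Cub.of A B s) = s := by simp [vl]
@[simp] theorem vl_one : vl r (1 : Cub S A B) = 1 := by simp [vl]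
@[simp] theorem vl_zero : vl r (0 : Cub S A B) = 0 := by simp [vl]
@[simp] theorem vl_θ : vl r (Cub.θ : Cub S A B) = r := by simp [vl]
theorem vl_sq (h : r ^ 3 + A * r + B = 0) (x : Cub S A B) : vl r (x ^ 2) = vl r x ^ 2 := by rw [pow_two, vl_mul h, pow_two]
theorem vl_map (g : S →+* T) (x : Cub S A B) : vl (g r) (Cub.map g x) = g (vl r x) := by simp [vl]
end
section
variable {F : Type*} [CommRing F] [IsDomain F] {r s t : F}
theorem vieta (hr : r ^ 3 + A * r + B = 0) (hs : s ^ 3 + A * s + B = 0) (h : s ≠ r) (hst : r + s + t = 0) :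
    (A : F) = -(s ^ 2 + s * r + r ^ 2) ∧ (B : F) = r * s * (r + s) ∧ t = -r - s := by
  have e1 : (s - r) * (s ^ 2 + s * r + r ^ 2 + A) = 0 := by grind
  have e2 := (mul_eq_zero.1 e1).resolve_left (sub_ne_zero.2 h)
  grind
theorem prod_vl (hr : r ^ 3 + A * r + B = 0) (hs : s ^ 3 + A * s + B = 0) (h : s ≠ r) (hst : r + s + t = 0) (x : Cub F A B) :
    x.N = vl r x * vl s x * vl t x := by
  obtain ⟨eA, eB, et⟩ := vieta hr hs h hst
  simp only [vl, Cub.N]; rw [eA, eB, et]; ring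
end
theorem lam_ze {F : Type*} [CommRing F] {e : F} (he : e ^ 3 + A * e + B = 0) (α : Cub F A B) :
    (α * (⟨e ^ 2 + A, e, 1⟩ : Cub F A B) ^ 2).c = vl e α * (3 * e ^ 2 + A) := by
  simp [vl, pow_two]; grind
theorem real_ob {α : Cub ℚ A B} (hN : 0 < α.N) {e : ℝ} (he : e ^ 3 + A * e + B = 0) (hf : 0 < 3 * e ^ 2 + A)
    (h : 0 < vl e (Cub.map (algebraMap ℚ ℝ) α)) : Ob ℝ α := by
  set β := Cub.map (algebraMap ℚ ℝ) α with hβ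
  have hN' : 0 < β.N := by rw [hβ, Cub.N_map, eq_ratCast]; exact_mod_cast hN
  set w : Cub ℝ A B := ⟨e ^ 2 + A, e, 1⟩
  have hw : 0 < (β * w ^ 2).c := by rw [lam_ze he]; positivity
  obtain ⟨v, hv0, hv⟩ : ∃ v : Cub ℝ A B, v ≠ 0 ∧ (β * v ^ 2).c ≤ 0 := by
    by_contra hcon
    push Not at hcon
    have hpd : (gram β).PosDef := by
      refine Matrix.PosDef.of_dotProduct_mulVec_pos ?_ fun x hx => ?_
      · rw [Matrix.IsHermitian, Matrix.conjTranspose_eq_transpose_of_trivial]; exact gram_symm β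
      · have hx' : x = ![x 0, x 1, x 2] := by ext i; fin_cases i <;> rfl
        have := hcon ⟨x 0, x 1, x 2⟩ (fun h0 => hx (by
          ext i; fin_cases i
          · exact congrArg Cub.a h0
          · exact congrArg Cub.b h0
          · exact congrArg Cub.c h0))
        rw [← gram_q] at this
        simp only [← hx'] at this
        simpa using this
    have := hpd.det_pos
    rw [gram_det] at this
    linarith
  have hcont : Continuous fun t : ℝ => (β * (Cub.of A B (1 - t) * v + Cub.of A B t * w) ^ 2).c := by
    simp [pow_two]; fun_prop
  obtain ⟨t, ht, h0⟩ := intermediate_value_Icc zero_le_one hcont.continuousOn (show (0:ℝ) ∈ _ by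
    grind)
  refine ⟨_, fun hz => ?_, h0⟩
  have key : Cub.of A B ((1 - t) ^ 2) * (β * v ^ 2) = Cub.of A B (t ^ 2) * (β * w ^ 2) := by
    grind
  have k2 := congrArg Cub.c key
  simp only [Cub.mul_c _ (_ * _), Cub.of_a, Cub.of_b, Cub.of_c] at k2
  have k3 : t = 0 := by
    by_contra h3
    have := mul_pos (pow_pos (lt_of_le_of_ne ht.1 (Ne.symm h3)) 2) hw
    nlinarith [mul_nonneg (sq_nonneg (1 - t)) (neg_nonneg.2 hv)]
  grind
theorem flip_contra {α : Cub ℚ A B} {r s t : ℝ} (hr : r ^ 3 + A * r + B = 0) (hs : s ^ 3 + A * s + B = 0) (hsum : r + s + t = 0)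
    (hrs : r < s) (hst : s < t) (h1 : vl r (Cub.map (algebraMap ℚ ℝ) α) < 0) (h2 : 0 < vl s (Cub.map (algebraMap ℚ ℝ) α))
    (h3 : vl t (Cub.map (algebraMap ℚ ℝ) α) < 0) : ¬ Ob ℝ α := by
  rintro ⟨z, hz, h⟩
  obtain ⟨eA, eB, et⟩ := vieta hr hs hrs.ne' hsum
  have ht : t ^ 3 + A * t + B = 0 := by rw [eA, eB, et]; ring
  set β := Cub.map (algebraMap ℚ ℝ) α with hβ
  have lag : ∀ y : Cub ℝ A B, (t - s) * vl r y - (t - r) * vl s y + (s - r) * vl t y = (t - s) * (t - r) * (s - r) * y.c := by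
    intro y; simp only [vl]; ring
  have := lag (β * z ^ 2)
  rw [h, vl_mul hr, vl_mul hs, vl_mul ht, vl_sq hr, vl_sq hs, vl_sq ht] at this
  have p1 : 0 < (t - s) * -vl r β := mul_pos (by linarith) (by linarith)
  have p2 : 0 < (t - r) * vl s β := mul_pos (by linarith) (by linarith)
  have p3 : 0 < (s - r) * -vl t β := mul_pos (by linarith) (by linarith)
  have n1 := mul_nonneg p1.le (sq_nonneg (vl r z))
  have n2 := mul_nonneg p2.le (sq_nonneg (vl s z))
  have n3 := mul_nonneg p3.le (sq_nonneg (vl t z))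
  have z1 : vl r z = 0 := by
    have : (t - s) * -vl r β * vl r z ^ 2 = 0 := by linarith
    simpa [p1.ne'] using (mul_eq_zero.1 this).resolve_left p1.ne'
  have z2 : vl s z = 0 := by
    have : (t - r) * vl s β * vl s z ^ 2 = 0 := by linarith
    simpa using (mul_eq_zero.1 this).resolve_left p2.ne'
  have z3 : vl t z = 0 := by
    have : (s - r) * -vl t β * vl t z ^ 2 = 0 := by linarith
    simpa using (mul_eq_zero.1 this).resolve_left p3.ne'
  have zc : z.c = 0 := by
    grind
  have zb : z.b = 0 := by
    have : z.b * (s - r) = 0 := by simp only [vl, zc] at z1 z2; grind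
    grind
  have za : z.a = 0 := by simpa [vl, zb, zc] using z1
  exact hz (by ext <;> assumption)
end Ono

namespace Ono
open Filter Topology
variable {A B : ℤ}
section
variable {F : Type*} [NontriviallyNormedField F] [CompleteSpace F] [CharZero F]
theorem sq_nhds : ∀ᶠ x : F × F × F in 𝓝 (1, 0, 0), ∃ w : Cub F A B, IsUnit w ∧ w ^ 2 = ⟨x.1, x.2.1, x.2.2⟩ := by
  let p : F × F × F := (1, 0, 0)
  have h1 : HasStrictFDerivAt (fun x : F × F × F => x.1) (ContinuousLinearMap.fst F F (F × F)) p := hasStrictFDerivAt_fst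
  have h2 : HasStrictFDerivAt (fun x : F × F × F => x.2.1) ((ContinuousLinearMap.fst F F F).comp (ContinuousLinearMap.snd F F (F × F))) p :=
    hasStrictFDerivAt_fst.comp p hasStrictFDerivAt_snd
  have h3 : HasStrictFDerivAt (fun x : F × F × F => x.2.2) ((ContinuousLinearMap.snd F F F).comp (ContinuousLinearMap.snd F F (F × F))) p :=
    hasStrictFDerivAt_snd.comp p hasStrictFDerivAt_snd
  have hA := ((h1.mul h1).sub ((h2.mul h3).const_mul (2 * (B:F)))).prodMk
    ((((h1.mul h2).const_mul (2:F)).sub ((h2.mul h3).const_mul (2 * (A:F)))).sub ((h3.mul h3).const_mul (B:F)) |>.prodMk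
    ((((h1.mul h3).const_mul (2:F)).add (h2.mul h2)).sub ((h3.mul h3).const_mul (A:F))))
  have hm := hA.map_nhds_eq_of_surj (by
    rw [LinearMap.range_eq_top]
    rintro ⟨u, v, w⟩
    refine ⟨(u / 2, v / 2, w / 2), ?_⟩
    ext <;> simp [p] <;> ring)
  let φ : F × F × F → F × F × F := fun x => (x.1 * x.1 - 2 * (B:F) * (x.2.1 * x.2.2), 2 * (x.1 * x.2.1) - 2 * (A:F) * (x.2.1 * x.2.2) - (B:F) * (x.2.2 * x.2.2),
    2 * (x.1 * x.2.2) + x.2.1 * x.2.1 - (A:F) * (x.2.2 * x.2.2))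
  have hv : φ p = (1, 0, 0) := by simp [p, φ]
  replace hm : Filter.map φ (𝓝 p) = 𝓝 (φ p) := hm
  have hev : ∀ᶠ x : F × F × F in 𝓝 p, (⟨x.1, x.2.1, x.2.2⟩ : Cub F A B).N ≠ 0 := by
    have hc : Continuous fun x : F × F × F => (⟨x.1, x.2.1, x.2.2⟩ : Cub F A B).N := by simp only [Cub.N]; fun_prop
    exact hc.continuousAt.eventually_ne (by simp [Cub.N, p])
  have := Filter.image_mem_map (m := φ) hev
  rw [hm, hv] at this
  filter_upwards [this]
  rintro y ⟨x, hx, rfl⟩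
  refine ⟨⟨x.1, x.2.1, x.2.2⟩, Cub.isUnit_iff.2 (isUnit_iff_ne_zero.2 hx), ?_⟩
  rw [pow_two]; ext <;> simp [φ] <;> ring
def LX (d : F) (β : Cub F A B) (X : F) : Prop := ∃ z : Cub F A B, IsUnit z ∧ β * z ^ 2 = Cub.of A B X - Cub.of A B d * Cub.θ
theorem LX.nhds {d X : F} {β : Cub F A B} (hβ : IsUnit β) (h : LX d β X) : ∀ᶠ X' in 𝓝 X, LX d β X' := by
  obtain ⟨z, hz, e⟩ := h
  have hu : IsUnit (Cub.of A B X - Cub.of A B d * Cub.θ) := by rw [← e]; exact hβ.mul (hz.pow 2)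
  obtain ⟨v, hv⟩ := hu.exists_right_inv
  have hc : Continuous fun X' : F => ((1 + (X' - X) * v.a, (X' - X) * v.b, (X' - X) * v.c) : F × F × F) := by fun_prop
  have ht := hc.tendsto X
  simp only [sub_self, zero_mul, add_zero] at ht
  filter_upwards [ht.eventually (sq_nhds (A := A) (B := B))]
  rintro X' ⟨w, hw, h2⟩
  refine ⟨z * w, hz.mul hw, ?_⟩
  have h3 : w ^ 2 = 1 + Cub.of A B (X' - X) * v := by rw [h2]; ext <;> simp
  grind
def LocF (d : F) (β : Cub F A B) : Prop := ∃ X, LX d β X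
theorem LocF.one {d : F} : LocF d (1 : Cub F A B) := by
  have hc : Continuous fun t : F => ((1, -(t ^ 2 * d), 0) : F × F × F) := by fun_prop
  have ht := hc.tendsto 0
  simp only [ne_eq, OfNat.ofNat_ne_zero, not_false_eq_true, zero_pow, zero_mul, neg_zero] at ht
  have hev := (ht.eventually (sq_nhds (A := A) (B := B))).filter_mono (nhdsWithin_le_nhds (s := {(0:F)}ᶜ))
  obtain ⟨t, ⟨w, hw, h2⟩, ht0⟩ := (hev.and self_mem_nhdsWithin).exists
  have ht0 : t ≠ 0 := ht0
  have ho : (Cub.of A B t⁻¹) * Cub.of A B t = 1 := by rw [← map_mul, inv_mul_cancel₀ ht0, map_one]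
  refine ⟨t⁻¹ ^ 2, Cub.of A B t⁻¹ * w, ((isUnit_iff_ne_zero.2 (inv_ne_zero ht0)).map _).mul hw, ?_⟩
  have h3 : w ^ 2 = 1 - Cub.of A B t ^ 2 * Cub.of A B d * Cub.θ := by rw [h2, ← map_pow, ← map_mul]; ext <;> simp [-map_pow, -map_mul]
  grind
theorem LX.mul_sq {d X : F} {β w : Cub F A B} (hw : IsUnit w) (h : LX d (β * w ^ 2) X) : LX d β X := by
  obtain ⟨z, hz, e⟩ := h
  exact ⟨w * z, hw.mul hz, by rw [← e]; ring⟩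
theorem LocF.of_sq {d : F} {β w : Cub F A B} (hw : IsUnit w) (h : LocF d (β * w ^ 2)) : LocF d β := by
  obtain ⟨X, h⟩ := h; exact ⟨X, h.mul_sq hw⟩
theorem LocF.mul_sq {d : F} {β w : Cub F A B} (hw : IsUnit w) (h : LocF d β) : LocF d (β * w ^ 2) := by
  obtain ⟨v, hv⟩ := hw.exists_right_inv
  refine LocF.of_sq (w := v) (IsUnit.of_mul_eq_one w (by rw [mul_comm, hv])) ?_
  grind
theorem LocF.twist {d t : F} (ht : t ≠ 0) {β : Cub F A B} (h : LocF d β) : LocF (d * t ^ 2) β := by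
  obtain ⟨X, z, hz, e⟩ := h
  refine ⟨X * t ^ 2, Cub.of A B t * z, ((isUnit_iff_ne_zero.2 ht).map _).mul hz, ?_⟩
  grind
theorem N_lin (d X : F) : (Cub.of A B X - Cub.of A B d * Cub.θ).N = X ^ 3 + d ^ 2 * A * X + d ^ 3 * B := by
  simp [Cub.N]; ring
theorem LocF.mul {d : F} {β₁ β₂ : Cub F A B} (hu₁ : IsUnit β₁) (hu₂ : IsUnit β₂) (hn₁ : IsSquare β₁.N) (hn₂ : IsSquare β₂.N)
    (h₁ : LocF d β₁) (h₂ : LocF d β₂) : LocF d (β₁ * β₂) := by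
  obtain ⟨X₁, z₁, hz₁, e₁⟩ := h₁
  obtain ⟨X₂', h₂⟩ := h₂
  have sq : ∀ {β z : Cub F A B} {X : F}, IsSquare β.N → β * z ^ 2 = Cub.of A B X - Cub.of A B d * Cub.θ → ∃ Y, Y ^ 2 = X ^ 3 + d ^ 2 * A * X + d ^ 3 * B := by
    rintro β z X ⟨s, hs⟩ e
    refine ⟨s * z.N, ?_⟩
    rw [← N_lin, ← e, Cub.N_mul, Cub.N_pow, hs]; ring
  obtain ⟨Y₁, hY₁⟩ := sq hn₁ e₁
  have hfin : ({E : F | E ^ 3 + d ^ 2 * A * E + d ^ 3 * B = 0}).Finite := by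
    generalize d ^ 2 * (A:F) = u; generalize d ^ 3 * (B:F) = u'
    let P : Polynomial F := Polynomial.X ^ 3 + (Polynomial.C u * Polynomial.X + Polynomial.C u')
    have hP : P ≠ 0 := by
      intro h0
      have := congrArg (fun P => Polynomial.coeff P 3) h0
      simp [P, Polynomial.coeff_X, Polynomial.coeff_C] at this
    refine (Polynomial.finite_setOf_isRoot hP).subset fun E hE => ?_
    simp only [Set.mem_ofPred_eq] at hE
    simp [P, Polynomial.IsRoot.def]; rw [← hE]; ring
  have hinf : {X | LX d β₂ X}.Infinite := infinite_of_mem_nhds X₂' (h₂.nhds hu₂)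
  obtain ⟨X₂, ⟨z₂, hz₂, e₂⟩, hX₂⟩ := hinf.exists_notMem_finite ((hfin.image fun E => (Y₁ / (X₁ - E)) ^ 2 - X₁ - E).union (Set.finite_singleton X₁))
  simp only [Set.mem_union, Set.mem_singleton_iff, not_or] at hX₂
  obtain ⟨hb, hne⟩ := hX₂
  obtain ⟨Y₂, hY₂⟩ := sq hn₂ e₂
  have hne' : X₁ - X₂ ≠ 0 := sub_ne_zero.2 (Ne.symm hne)
  obtain ⟨m, hm⟩ : ∃ m, m * (X₁ - X₂) = Y₁ - Y₂ := ⟨(Y₁ - Y₂) / (X₁ - X₂), div_mul_cancel₀ _ hne'⟩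
  set n := Y₁ - m * X₁ with hn
  set X₃ := m ^ 2 - X₁ - X₂ with hX₃
  have s1 : d ^ 2 * A = m ^ 2 * (X₁ + X₂) - 2 * m * -n - X₁ ^ 2 - X₁ * X₂ - X₂ ^ 2 := by
    grind
  have s0 : d ^ 3 * B = Y₁ ^ 2 - X₁ ^ 3 - (m ^ 2 * (X₁ + X₂) - 2 * m * -n - X₁ ^ 2 - X₁ * X₂ - X₂ ^ 2) * X₁ := by grind
  have id : ∀ x : F, (x - X₁) * (x - X₂) * (x - X₃) = x ^ 3 + d ^ 2 * A * x + d ^ 3 * B - (m * x + n) ^ 2 := by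
    grind
  have hu3 : IsUnit (Cub.of A B X₃ - Cub.of A B d * Cub.θ) := by
    rw [Cub.isUnit_iff, N_lin, isUnit_iff_ne_zero]
    intro h0
    have i := id X₃
    rw [h0, sub_self, mul_zero] at i
    apply hb
    refine ⟨X₃, h0, ?_⟩
    have hE : X₁ - X₃ ≠ 0 := by
      intro h1
      have hu := (hu₁.mul (hz₁.pow 2))
      rw [e₁, Cub.isUnit_iff, N_lin, sub_eq_zero.1 h1, h0] at hu
      simp at hu
    grind
  have prod : (Cub.of A B X₁ - Cub.of A B d * Cub.θ) * (Cub.of A B X₂ - Cub.of A B d * Cub.θ) * (Cub.of A B X₃ - Cub.of A B d * Cub.θ) = (Cub.of A B (m * d) * Cub.θ + Cub.of A B n) ^ 2 := by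
    have T3 : (Cub.of A B d * Cub.θ) ^ 3 + Cub.of A B (d ^ 2 * A) * (Cub.of A B d * Cub.θ) + Cub.of A B (d ^ 3 * B) = 0 := by
      have := Cub.θ_eq (R := F) (A := A) (B := B)
      simp only [map_mul, map_pow]; grind
    rw [s0, s1, hn] at T3
    rw [hX₃, hn]
    simp only [map_mul, map_sub, map_pow, map_add, map_neg, map_ofNat] at T3 ⊢
    linear_combination -T3
  have hum : IsUnit (Cub.of A B (m * d) * Cub.θ + Cub.of A B n) := by
    have : IsUnit ((Cub.of A B (m * d) * Cub.θ + Cub.of A B n) ^ 2) := by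
      rw [← prod, ← e₁, ← e₂]; exact ((hu₁.mul (hz₁.pow 2)).mul (hu₂.mul (hz₂.pow 2))).mul hu3
    exact (isUnit_pow_iff two_ne_zero).1 this
  obtain ⟨v, hv⟩ := hum.exists_right_inv
  refine ⟨X₃, z₁ * z₂ * (Cub.of A B X₃ - Cub.of A B d * Cub.θ) * v, ((hz₁.mul hz₂).mul hu3).mul (IsUnit.of_mul_eq_one _ (by rw [mul_comm, hv])), ?_⟩
  grind
end
def Loc (F : Type*) [NontriviallyNormedField F] [CompleteSpace F] [CharZero F] [Algebra ℚ F] (d : ℤ) (α : Cub ℚ A B) : Prop :=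
  LocF (d : F) (Cub.map (algebraMap ℚ F) α)
theorem LocF.ob {F : Type*} [NontriviallyNormedField F] [CompleteSpace F] [CharZero F] [Algebra ℚ F] {d : F} {α : Cub ℚ A B}
    (h : LocF d (Cub.map (algebraMap ℚ F) α)) : Ob F α := by
  obtain ⟨X, z, hz, e⟩ := h
  exact ⟨z, fun h0 => by rw [h0, Cub.isUnit_iff] at hz; simp [Cub.N] at hz, by rw [e]; simp⟩
end Ono

namespace Ono
open MvPolynomial in
theorem chev {p : ℕ} [Fact p.Prime] (M : Matrix (Fin 3) (Fin 3) (ZMod p)) : ∃ x : Fin 3 → ZMod p, x ≠ 0 ∧ x ⬝ᵥ M.mulVec x = 0 := by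
  let P : MvPolynomial (Fin 3) (ZMod p) := ∑ i, ∑ j, C (M i j) * (X i * X j)
  have hev : ∀ x, eval x P = x ⬝ᵥ M.mulVec x := by
    intro x
    simp only [P, map_sum, map_mul, eval_C, eval_X, dotProduct, Matrix.mulVec, Finset.mul_sum]
    grind
  have hdeg : P.totalDegree < Fintype.card (Fin 3) := by
    refine lt_of_le_of_lt (b := 2) ?_ (by simp)
    refine (totalDegree_finset_sum _ _).trans (Finset.sup_le fun i _ => (totalDegree_finset_sum _ _).trans (Finset.sup_le fun j _ => ?_))
    refine (totalDegree_mul _ _).trans ?_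
    rw [totalDegree_C, zero_add]
    exact (totalDegree_mul _ _).trans (by simp [totalDegree_X])
  have hd := char_dvd_card_solutions p hdeg
  have h0 : eval 0 P = 0 := by rw [hev]; simp
  have hp := (Fact.out : p.Prime).one_lt
  haveI : Nontrivial {x : Fin 3 → ZMod p // eval x P = 0} := by
    rw [← Fintype.one_lt_card_iff_nontrivial]
    have : 0 < Fintype.card {x : Fin 3 → ZMod p // eval x P = 0} := Fintype.card_pos_iff.2 ⟨⟨0, h0⟩⟩
    exact hp.trans_le (Nat.le_of_dvd this hd)
  obtain ⟨⟨x, hx⟩, hne⟩ := exists_ne (⟨0, h0⟩ : {x : Fin 3 → ZMod p // eval x P = 0})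
  grind
variable {A B : ℤ} {p : ℕ} [Fact p.Prime]
noncomputable abbrev inc : Cub ℤ_[p] A B →+* Cub ℚ_[p] A B := Cub.map PadicInt.Coe.ringHom
def UF (β : Cub ℚ_[p] A B) : Prop := ∃ z, IsUnit z ∧ ∃ u : Cub ℤ_[p] A B, IsUnit u ∧ β * z ^ 2 = inc u
theorem UF.one : UF (1 : Cub ℚ_[p] A B) := ⟨1, isUnit_one, 1, isUnit_one, by simp⟩
theorem UF.mul {β γ : Cub ℚ_[p] A B} (h : UF β) (h' : UF γ) : UF (β * γ) := by
  obtain ⟨z, hz, u, hu, e⟩ := h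
  obtain ⟨z', hz', u', hu', e'⟩ := h'
  exact ⟨z * z', hz.mul hz', u * u', hu.mul hu', by grind⟩
theorem UF.of_sq {β w : Cub ℚ_[p] A B} (hw : IsUnit w) (h : UF (β * w ^ 2)) : UF β := by
  obtain ⟨z, hz, u, hu, e⟩ := h
  exact ⟨w * z, hw.mul hz, u, hu, by rw [← e]; ring⟩
theorem UF.mul_sq {β w : Cub ℚ_[p] A B} (hw : IsUnit w) (h : UF β) : UF (β * w ^ 2) := by
  obtain ⟨v, hv⟩ := hw.exists_right_inv
  refine UF.of_sq (w := v) (IsUnit.of_mul_eq_one w (by rw [mul_comm, hv])) ?_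
  grind
theorem unit_form (h2 : p ≠ 2) {u : Cub ℤ_[p] A B} (hu : IsUnit u) : ∃ z : Cub ℤ_[p] A B, z ≠ 0 ∧ (u * z ^ 2).c = 0 := by
  set g := PadicInt.toZMod (p := p)
  set ub := Cub.map g u with hub
  have hub' : IsUnit ub := hu.map _
  obtain ⟨x, hx, h0⟩ := chev (gram ub)
  obtain ⟨z, hz⟩ : ∃ z : Cub ℤ_[p] A B, Cub.map g z = ⟨x 0, x 1, x 2⟩ := by
    obtain ⟨a, ha⟩ := ZMod.ringHom_surjective g (x 0)
    obtain ⟨b, hb⟩ := ZMod.ringHom_surjective g (x 1)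
    obtain ⟨c, hc⟩ := ZMod.ringHom_surjective g (x 2)
    exact ⟨⟨a, b, c⟩, by ext <;> simpa⟩
  set zb := Cub.map g z with hzb
  have hzb0 : zb ≠ 0 := by
    rw [hz]; intro h; apply hx; ext i; fin_cases i
    · exact congrArg Cub.a h
    · exact congrArg Cub.b h
    · exact congrArg Cub.c h
  have hq : (ub * zb ^ 2).c = 0 := by
    rw [← gram_q, hz]
    have : x = ![x 0, x 1, x 2] := by ext i; fin_cases i <;> rfl
    simp only [← this]; exact h0
  obtain ⟨w, hw⟩ : ∃ w : Cub ℤ_[p] A B, (ub * zb * Cub.map g w).c ≠ 0 := by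
    by_contra hcon
    push Not at hcon
    apply hzb0
    have h1 := hcon 1
    have h2 := hcon Cub.θ
    have h3 := hcon (Cub.θ ^ 2)
    have : ub * zb = 0 := by
      simp only [map_one, mul_one, map_pow, Cub.map_θ] at h1 h2 h3
      generalize ub * zb = y at *
      simp [pow_two, h1] at h2
      simp [pow_two, h1, h2] at h3
      ext <;> assumption
    exact (hub'.mul_right_eq_zero).1 this
  have hg : ∀ y : Cub ℤ_[p] A B, g y.c = (Cub.map g y).c := fun y => rfl
  have n1 : ‖(u * z ^ 2).c‖ < 1 := by
    rw [PadicInt.norm_lt_one_iff_dvd, dvd_iff_toZMod]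
    change g _ = 0
    rw [hg, map_mul, map_pow, ← hub, ← hzb, hq]
  have n2 : ‖(2 * (u * z * w).c : ℤ_[p])‖ = 1 := by
    rw [norm_eq_one_iff]
    change g _ ≠ 0
    rw [map_mul, hg, map_mul, map_mul, ← hub, ← hzb, map_ofNat]
    refine mul_ne_zero ?_ hw
    intro h
    have : ((2 : ℕ) : ZMod p) = 0 := by exact_mod_cast h
    rw [ZMod.natCast_eq_zero_iff] at this
    exact h2 ((Nat.prime_dvd_prime_iff_eq Fact.out Nat.prime_two).1 this)
  obtain ⟨t, ht, htn⟩ : ∃ t : ℤ_[p], (u * z ^ 2).c + 2 * (u * z * w).c * t + (u * w ^ 2).c * t ^ 2 = 0 ∧ ‖t‖ < 1 := by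
    revert n1 n2
    generalize (u * z ^ 2).c = c0
    generalize (2 * (u * z * w).c : ℤ_[p]) = c1
    generalize (u * w ^ 2).c = c2
    intro n1 n2
    let P : Polynomial ℤ_[p] := Polynomial.C c0 + Polynomial.C c1 * Polynomial.X + Polynomial.C c2 * Polynomial.X ^ 2
    obtain ⟨t, ht, htn, -⟩ := hensels_lemma (F := P) (a := (0 : ℤ_[p])) (by simpa [P, n2, Polynomial.derivative_mul] using n1)
    refine ⟨t, by simpa [P] using ht, ?_⟩
    simpa [P, n2, Polynomial.derivative_mul] using htn
  refine ⟨z + Cub.of A B t * w, fun h => hzb0 ?_, ?_⟩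
  · have htd : g t = 0 := by
      rw [← dvd_iff_toZMod, ← PadicInt.norm_lt_one_iff_dvd]
      exact htn
    have := congrArg (Cub.map g) h
    rwa [map_add, map_mul, Cub.map_of, htd, map_zero, zero_mul, add_zero, map_zero] at this
  · rw [← ht, show u * (z + Cub.of A B t * w) ^ 2 = u * z ^ 2 + Cub.of A B t * (2 * (u * z * w)) + Cub.of A B t ^ 2 * (u * w ^ 2) by ring, ← map_pow]
    have e2 : ∀ y : Cub ℤ_[p] A B, (2 * y).c = 2 * y.c := fun y => by rw [two_mul, two_mul]; rfl
    have e3 : ∀ (s : ℤ_[p]) (y : Cub ℤ_[p] A B), (Cub.of A B s * y).c = s * y.c := fun s y => by simp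
    rw [Cub.add_c, Cub.add_c, e3, e3, e2]; ring
theorem UF.ob (h2 : p ≠ 2) {α : Cub ℚ A B} (h : UF (Cub.map (algebraMap ℚ ℚ_[p]) α)) : Ob ℚ_[p] α := by
  obtain ⟨z, hz, u, hu, e⟩ := h
  obtain ⟨y, hy, h0⟩ := unit_form h2 hu
  refine ⟨z * inc y, fun h => hy ?_, ?_⟩
  · have := (hz.mul_right_eq_zero).1 h
    exact Cub.map_injective (g := PadicInt.Coe.ringHom) (fun a b h => PadicInt.ext h) (by rw [this, map_zero])
  · rw [mul_pow, ← mul_assoc, e, ← map_pow, ← map_mul, Cub.map_c, h0, map_zero]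
end Ono

namespace Ono
variable {A B : ℤ} {p : ℕ} [Fact p.Prime]
theorem UF.of_int {u : Cub ℤ_[p] A B} (h : ‖u.N‖ = 1) : UF (inc u) :=
  ⟨1, isUnit_one, u, Cub.isUnit_iff.2 (PadicInt.isUnit_iff.2 h), by simp⟩
theorem UF.big {X Y : ℚ_[p]} {D : ℤ} (h : Y ^ 2 = X ^ 3 + D ^ 2 * A * X + D ^ 3 * B) (hX : 1 < ‖X‖) :
    UF (Cub.of A B X - Cub.of A B (D : ℚ_[p]) * Cub.θ) := by
  have hX0 : X ≠ 0 := fun h => by rw [h, norm_zero] at hX; linarith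
  have hn : ‖Y‖ ^ 2 = ‖X‖ ^ 3 := by
    rw [← norm_pow, h, show X ^ 3 + D ^ 2 * A * X + D ^ 3 * B = X ^ 3 + ((D ^ 2 * A : ℤ) * X + (D ^ 3 * B : ℤ)) by push_cast; ring,
      Padic.add_eq_max_of_ne, norm_pow, max_eq_left]
    all_goals
      have h1 : ‖((D ^ 2 * A : ℤ) : ℚ_[p]) * X + (D ^ 3 * B : ℤ)‖ ≤ ‖X‖ := by
        refine (Padic.nonarchimedean _ _).trans (max_le ?_ ((Padic.norm_int_le_one _).trans hX.le))
        rw [norm_mul]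
        exact mul_le_of_le_one_left (norm_nonneg _) (Padic.norm_int_le_one _)
      have h2 : ‖X‖ < ‖X‖ ^ 3 := by
        have : 0 < ‖X‖ := by linarith
        nlinarith [mul_pos this (by linarith : 0 < ‖X‖ - 1)]
    · exact h1.trans h2.le
    · rw [norm_pow]; grind
  have hY0 : Y ≠ 0 := by
    rintro rfl
    have : 0 < ‖X‖ ^ 3 := by positivity
    rw [← hn, norm_zero] at this; norm_num at this
  have hYp : 0 < ‖Y‖ := norm_pos_iff.2 hY0
  obtain ⟨x, hx⟩ := lift_int (x := X * (X / Y) ^ 2) (by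
    rw [norm_mul, norm_pow, norm_div, div_pow, hn]; field_simp; rfl)
  obtain ⟨y, hy⟩ := lift_int (x := -(D : ℚ_[p]) * (X / Y) ^ 2) (by
    rw [norm_mul, norm_neg, norm_pow, norm_div, div_pow, hn]
    refine mul_le_one₀ (Padic.norm_int_le_one _) (by positivity) ?_
    rw [div_le_one (by positivity)]
    exact pow_le_pow_right₀ hX.le (by norm_num))
  have e : (Cub.of A B X - Cub.of A B (D : ℚ_[p]) * Cub.θ) * (Cub.of A B (X / Y)) ^ 2 = inc (⟨x, y, 0⟩ : Cub ℤ_[p] A B) := by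
    rw [← map_pow]
    ext
    · simp [-map_pow]; exact hx.symm
    · simp [-map_pow]; rw [← neg_mul]; exact hy.symm
    · simp [-map_pow]
  refine ⟨Cub.of A B (X / Y), (isUnit_iff_ne_zero.2 (div_ne_zero hX0 hY0)).map _, _, ?_, e⟩
  rw [Cub.isUnit_iff, PadicInt.isUnit_iff]
  have e2 := congrArg (fun t => ‖t.N‖) e
  simp only [Cub.N_mul, N_lin, ← h, Cub.N_pow, Cub.N_of, Cub.N_map] at e2
  change _ = ‖((_ : ℤ_[p]) : ℚ_[p])‖ at e2
  rw [← PadicInt.norm_def] at e2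
  rw [← e2]
  simp only [norm_mul, norm_pow, norm_div]
  grind
theorem UF.small {X Y : ℤ_[p]} {D : ℤ} (h : Y ^ 2 = X ^ 3 + D ^ 2 * A * X + D ^ 3 * B) (hY : Y ≠ 0)
    (hD : ‖Y‖ = 1 ∨ ¬ (p : ℤ) ∣ Dis A B ∧ ¬ (p : ℤ) ∣ D) : UF (Cub.of A B (X : ℚ_[p]) - Cub.of A B (D : ℚ_[p]) * Cub.θ) := by
  set α : Cub ℤ_[p] A B := Cub.of A B X - Cub.of A B (D : ℤ_[p]) * Cub.θ with hα
  have hi : Cub.of A B (X : ℚ_[p]) - Cub.of A B (D : ℚ_[p]) * Cub.θ = inc α := by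
    ext <;> simp [hα] <;> rfl
  have hN : α.N = Y ^ 2 := by rw [h, hα]; simp [Cub.N]; ring
  rw [hi]
  by_cases h1 : ‖Y‖ = 1
  · exact UF.of_int (by rw [hN, norm_pow, h1, one_pow])
  obtain ⟨hd1, hd2⟩ := hD.resolve_left h1
  rw [norm_eq_one_iff, not_not] at h1
  set u := α.adj + 2 * Cub.of A B Y + α
  have e : (Cub.of A B Y + α) ^ 2 = α * u := by
    have := α.mul_adj
    rw [hN, map_pow] at this
    simp only [u]; linear_combination -this
  set w := 3 * X ^ 2 + D ^ 2 * A + Y * (1 + 3 * X + Y)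
  have hw : (Cub.of A B Y + α).N = Y * w := by
    have : (Cub.of A B Y + α).N = (Y + X) ^ 3 + D ^ 2 * A * (Y + X) + D ^ 3 * B := by rw [hα]; simp [Cub.N]; ring
    rw [this]; simp only [w]; linear_combination -h
  have hu : u.N = w ^ 2 := by
    have := congrArg Cub.N e
    rw [Cub.N_pow, Cub.N_mul, hN, hw, mul_pow] at this
    exact (mul_left_cancel₀ (pow_ne_zero 2 hY) this).symm
  have hwn : ‖w‖ = 1 := by
    rw [norm_eq_one_iff]
    intro h0
    have h0' : 3 * (PadicInt.toZMod X) ^ 2 + (D : ZMod p) ^ 2 * A = 0 := by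
      have h3 : PadicInt.toZMod (3 : ℤ_[p]) = 3 := map_ofNat _ 3
      simpa [w, h1, h3] using h0
    have h' := congrArg PadicInt.toZMod h
    simp only [map_pow, h1, map_add, map_mul, map_intCast] at h'
    have : ((D ^ 6 * Dis A B : ℤ) : ZMod p) = 0 := by
      simp only [Dis]; push_cast
      generalize PadicInt.toZMod X = x at *
      linear_combination -(3 * x ^ 2 + 4 * (D : ZMod p) ^ 2 * A) * (3 * x ^ 2 + (D : ZMod p) ^ 2 * A) * h0' - 27 * (x ^ 3 + D ^ 2 * A * x - D ^ 3 * B) * h'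
    rw [ZMod.intCast_zmod_eq_zero_iff_dvd] at this
    have hp : Prime (p : ℤ) := Nat.prime_iff_prime_int.1 Fact.out
    exact (hp.dvd_or_dvd this).elim (fun h => hd2 (hp.dvd_of_dvd_pow h)) hd1
  have hαu : IsUnit (inc α) := by
    rw [Cub.isUnit_iff, Cub.N_map, hN, isUnit_iff_ne_zero, map_pow]
    exact pow_ne_zero 2 (fun h => hY (PadicInt.ext h))
  have hYu : IsUnit (inc (Cub.of A B Y + α)) := by
    rw [Cub.isUnit_iff, Cub.N_map, hw, isUnit_iff_ne_zero]
    refine fun h => ?_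
    have : Y * w = 0 := PadicInt.ext h
    rcases mul_eq_zero.1 this with h | h
    · exact hY h
    · rw [h, norm_zero] at hwn; norm_num at hwn
  obtain ⟨v, hv⟩ := hαu.exists_right_inv
  refine ⟨inc (Cub.of A B Y + α) * v, hYu.mul (IsUnit.of_mul_eq_one _ (by rw [mul_comm, hv])), u, ?_, ?_⟩
  · rw [Cub.isUnit_iff, hu, PadicInt.isUnit_iff, norm_pow, hwn, one_pow]
  · have e' : (inc (Cub.of A B Y + α)) ^ 2 = inc α * inc u := by rw [← map_pow, e, map_mul]
    linear_combination inc α * v ^ 2 * e' + (inc u * inc α * v + inc u) * hv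
theorem UF.inert_int {X Y : ℤ_[p]} {D : ℤ} (h : Y ^ 2 = X ^ 3 + D ^ 2 * A * X + D ^ 3 * B)
    (hD : (p : ℤ) ∣ D) (hD2 : ¬ (p : ℤ) * p ∣ D) (hr : ∀ r : ZMod p, r ^ 3 + A * r + B ≠ 0) : ‖Y‖ = 1 := by
  obtain ⟨δ, rfl⟩ := hD
  have hδ : (δ : ZMod p) ≠ 0 := by
    rw [Ne, ZMod.intCast_zmod_eq_zero_iff_dvd]; exact fun h => hD2 (mul_dvd_mul_left _ h)
  have hpp : Prime (p : ℤ_[p]) := PadicInt.prime_p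
  by_contra hY
  rw [norm_eq_one_iff, not_not] at hY
  have h' := congrArg PadicInt.toZMod h
  have hX : PadicInt.toZMod X = 0 := by simpa [hY] using h'.symm
  rw [← dvd_iff_toZMod] at hX hY
  obtain ⟨x, rfl⟩ := hX
  obtain ⟨y, rfl⟩ := hY
  have e : y ^ 2 = p * (x ^ 3 + δ ^ 2 * A * x + δ ^ 3 * B) := by
    refine mul_left_cancel₀ (pow_ne_zero 2 hpp.ne_zero) ?_
    push_cast at h
    linear_combination h
  obtain ⟨y, rfl⟩ : (p : ℤ_[p]) ∣ y := hpp.dvd_of_dvd_pow (n := 2) ⟨_, e⟩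
  have e2 : p * y ^ 2 = x ^ 3 + δ ^ 2 * A * x + δ ^ 3 * B := mul_left_cancel₀ hpp.ne_zero (by linear_combination e)
  have e3 := congrArg PadicInt.toZMod e2
  simp only [map_mul, map_add, map_pow, map_natCast, CharP.cast_eq_zero, zero_mul, map_intCast] at e3
  apply hr (PadicInt.toZMod x / δ)
  grind
theorem UF.point {X Y : ℚ_[p]} {D : ℤ} (h : Y ^ 2 = X ^ 3 + D ^ 2 * A * X + D ^ 3 * B) (hY : Y ≠ 0)
    (hD : (¬ (p : ℤ) ∣ Dis A B ∧ ¬ (p : ℤ) ∣ D) ∨ ((p : ℤ) ∣ D ∧ ¬ (p : ℤ) * p ∣ D ∧ ∀ r : ZMod p, r ^ 3 + A * r + B ≠ 0)) :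
    UF (Cub.of A B X - Cub.of A B (D : ℚ_[p]) * Cub.θ) := by
  by_cases hX : 1 < ‖X‖
  · exact UF.big h hX
  obtain ⟨x, rfl⟩ := lift_int (not_lt.1 hX)
  have e : Y ^ 2 = ((x ^ 3 + D ^ 2 * A * x + D ^ 3 * B : ℤ_[p]) : ℚ_[p]) := by rw [h]; push_cast; rfl
  obtain ⟨y, rfl⟩ : ∃ y : ℤ_[p], (y : ℚ_[p]) = Y := by
    refine lift_int ?_
    have : ‖Y‖ ^ 2 ≤ 1 := by rw [← norm_pow, e]; grind
    exact (sq_le_one_iff₀ (norm_nonneg _)).1 this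
  have e' : y ^ 2 = x ^ 3 + D ^ 2 * A * x + D ^ 3 * B := PadicInt.ext (by rw [← e]; push_cast; rfl)
  refine UF.small e' (fun h => hY (by rw [h]; rfl)) ?_
  rcases hD with hD | ⟨h1, h2, h3⟩
  · exact Or.inr hD
  · exact Or.inl (UF.inert_int e' h1 h2 h3)
end Ono

namespace Ono
open scoped NumberTheorySymbols
theorem Cd.J_eq {η : ℤ} {p l : ℕ} (hp : Odd p) (hl : Odd l) (h1 : J(-1 | p) = η)
    (h2 : J(l | p) = 1) : J(η * p | l) = 1 := by
  rw [jacobiSym.at_neg_one hp] at h1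
  rcases Nat.odd_mod_four_iff.1 (Nat.odd_iff.1 hp) with h | h
  · rw [ZMod.χ₄_nat_one_mod_four h] at h1
    rw [← h1, one_mul, jacobiSym.quadratic_reciprocity_one_mod_four h hl, h2]
  · rw [ZMod.χ₄_nat_three_mod_four h] at h1
    rw [← h1, jacobiSym.mul_left, jacobiSym.at_neg_one hl]
    rcases Nat.odd_mod_four_iff.1 (Nat.odd_iff.1 hl) with h' | h'
    · rw [ZMod.χ₄_nat_one_mod_four h', one_mul, ← jacobiSym.quadratic_reciprocity_one_mod_four h' hp, h2]
    · rw [ZMod.χ₄_nat_three_mod_four h', jacobiSym.quadratic_reciprocity_three_mod_four h h', h2]; norm_num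
theorem Cd.sq {η : ℤ} {N p l : ℕ} [Fact l.Prime] (hp : p.Prime) (hpN : ¬ p ∣ N) (hN : N ≠ 0) (h2 : 2 ∣ N) (hl : l ∣ N) (h : Cd η N p) :
    ∃ t : ℚ_[l], t ≠ 0 ∧ ((η * p : ℤ) : ℚ_[l]) = t ^ 2 := by
  have hlp : l.Prime := Fact.out
  have hp2 : p ≠ 2 := fun e => hpN (e ▸ h2)
  have hpo : Odd p := hp.odd_of_ne_two hp2
  have hpl : p ≠ l := fun e => hpN (e ▸ hl)
  obtain ⟨h1, hq⟩ := h
  have hη : η = 1 ∨ η = -1 := by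
    rw [← h1]
    exact J_ne_zero hp (fun hd => by
      have : (p : ℤ) ∣ 1 := by simpa using hd
      exact hp.one_lt.ne' (by exact_mod_cast Int.eq_one_of_dvd_one (by positivity) this))
  have hne : (η * p : ℤ) ≠ 0 := mul_ne_zero (by grind) (by grind)
  have hlη : ¬ (l : ℤ) ∣ η * p := fun hd => by
    have : (l : ℤ) ∣ p := by rcases hη with h | h <;> simpa [h] using hd
    exact hpl ((Nat.prime_dvd_prime_iff_eq hlp hp).1 (by exact_mod_cast this)).symm
  suffices hs : IsSquare ((η * p : ℤ) : ℤ_[l]) by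
    obtain ⟨t, ht⟩ := hs
    have ht' : ((η * p : ℤ) : ℚ_[l]) = (t : ℚ_[l]) ^ 2 := by
      have := congrArg (fun x : ℤ_[l] => (x : ℚ_[l])) ht
      rw [pow_two]; simpa using this
    exact ⟨t, fun h0 => by rw [h0] at ht'; exact hne (by exact_mod_cast (by simpa using ht' : ((η * p : ℤ) : ℚ_[l]) = 0)), ht'⟩
  by_cases hl2 : l = 2
  · subst hl2
    have hJ := hq 2 (Nat.mem_primeFactors.2 ⟨Nat.prime_two, h2, hN⟩)
    rw [Nat.cast_ofNat, jacobiSym.at_two hpo] at hJ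
    rw [jacobiSym.at_neg_one hpo] at h1
    have h8 : (8 : ℤ) ∣ 1 - η * p := by
      rw [ZMod.χ₈_nat_eq_if_mod_eight] at hJ
      rw [ZMod.χ₄_nat_eq_if_mod_four] at h1
      have : p % 2 = 1 := Nat.odd_iff.1 hpo
      rcases hη with rfl | rfl <;> split_ifs at hJ h1 <;> omega
    refine sq_of_near (a := 1) ?_
    have e : ‖(1 : ℤ_[2]) ^ 2 - ((η * p : ℤ) : ℤ_[2])‖ ≤ (2 : ℝ) ^ (-(3 : ℕ) : ℤ) := by
      have := (PadicInt.norm_int_le_pow_iff_dvd (p := 2) (k := 1 - η * p) (n := 3)).2 (by norm_num; exact h8)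
      simpa using this
    refine e.trans_lt ?_
    have : ‖(2 : ℤ_[2])‖ = 2⁻¹ := by simpa using PadicInt.norm_p (p := 2)
    rw [mul_one, this]; norm_num
  · have hlo : Odd l := hlp.odd_of_ne_two hl2
    have hJ := Cd.J_eq hpo hlo h1 (hq l (Nat.mem_primeFactors.2 ⟨hlp, hl, hN⟩))
    refine isSquare_of_res hl2 (norm_int_eq_one hlη) ?_
    rw [map_intCast]
    rw [← jacobiSym.legendreSym.to_jacobiSym, legendreSym.eq_one_iff _ (by rwa [Ne, ZMod.intCast_zmod_eq_zero_iff_dvd])] at hJ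
    exact hJ
end Ono

namespace Ono
variable {A B : ℤ}
abbrev Qr {R : Type*} [CommRing R] (A : ℤ) (r : R) := QuadraticAlgebra R (-(r ^ 2 + A)) (-r)
def prj {R : Type*} [CommRing R] (r : R) (x : Cub R A B) : Qr A r := ⟨x.a - x.c * (r ^ 2 + A), x.b - x.c * r⟩
theorem prj_mul {R : Type*} [CommRing R] {r : R} (h : r ^ 3 + A * r + B = 0) (x y : Cub R A B) : prj r (x * y) = prj r x * prj r y := by
  have hB : (B : R) = - r ^ 3 - A * r := by linear_combination h
  ext
  · simp [prj, hB]; ring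
  · simp [prj, hB]; ring
theorem prj_norm {R : Type*} [CommRing R] {r : R} (h : r ^ 3 + A * r + B = 0) (x : Cub R A B) : x.N = vl r x * (prj r x).norm := by
  have hB : (B : R) = - r ^ 3 - A * r := by linear_combination h
  simp [prj, QuadraticAlgebra.norm_def, Cub.N, vl, hB]; ring
theorem ram_modp {F : Type*} [Field F] (h2 : (2 : F) ≠ 0) {r δ v n x y : F} (hr : r ^ 3 + A * r + B = 0) (hD : (Dis A B : F) ≠ 0)
    (hδ : δ ≠ 0) {σ : Cub F A B} (hn : n ≠ 0) (hN : σ.N = n ^ 2) (hxy : ¬ (x = 0 ∧ y = 0))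
    (e : prj r σ * ⟨δ * r, -δ⟩ * (⟨x, y⟩ : Qr A r) ^ 2 = ⟨-(v * r), v⟩) : IsSquare (vl r σ) := by
  rw [Dis_root hr] at hD
  have hd2 : 3 * r ^ 2 + A ≠ 0 := fun h => right_ne_zero_of_mul hD (by rw [h]; simp)
  have hNs := prj_norm hr σ
  have e1 := congrArg QuadraticAlgebra.norm e
  simp only [map_mul, map_pow] at e1
  have e2 : (⟨δ * r, -δ⟩ : Qr A r).norm = δ ^ 2 * (3 * r ^ 2 + A) := by simp [QuadraticAlgebra.norm_def]; ring
  have e3 : (⟨-(v * r), v⟩ : Qr A r).norm = v ^ 2 * (3 * r ^ 2 + A) := by simp [QuadraticAlgebra.norm_def]; ring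
  rw [e2, e3] at e1
  have hs0 : (prj r σ).norm ≠ 0 := fun h => by grind
  set m := (⟨x, y⟩ : Qr A r).norm
  have e4 : (prj r σ).norm * (δ * m) ^ 2 = v ^ 2 := mul_right_cancel₀ hd2 (by linear_combination e1)
  by_cases hm : m = 0
  · exfalso
    have hv : v = 0 := by grind
    have hu : IsUnit (prj r σ * ⟨δ * r, -δ⟩) := by
      rw [QuadraticAlgebra.isUnit_iff_norm_isUnit, map_mul, e2, isUnit_iff_ne_zero]
      grind
    have hz : (⟨x, y⟩ : Qr A r) ^ 2 = 0 := by
      rw [← hu.mul_right_eq_zero, e, hv]; ext <;> simp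
    have z1 := congrArg QuadraticAlgebra.re hz
    have z2 := congrArg QuadraticAlgebra.im hz
    simp [pow_two] at z1 z2
    apply hxy
    by_cases hy : y = 0
    · grind
    grind
  · have hv : v ≠ 0 := by
      grind
    refine ⟨n * (δ * m) / v, ?_⟩
    grind
variable {p : ℕ} [Fact p.Prime]
theorem root_lift {r : ZMod p} (hr : r ^ 3 + A * r + B = 0) (hD : ¬ (p : ℤ) ∣ Dis A B) :
    ∃ ρ : ℤ_[p], ρ ^ 3 + A * ρ + B = 0 ∧ PadicInt.toZMod ρ = r := by
  obtain ⟨a, rfl⟩ := ZMod.ringHom_surjective (PadicInt.toZMod (p := p)) r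
  rw [← ZMod.intCast_zmod_eq_zero_iff_dvd, Dis_root hr] at hD
  have hd : ‖3 * a ^ 2 + A‖ = 1 := by
    rw [norm_eq_one_iff]; intro h
    apply hD
    have h3 : PadicInt.toZMod (3 : ℤ_[p]) = 3 := map_ofNat _ 3
    simp only [map_add, map_mul, map_pow, map_intCast, h3] at h
    rw [h]; simp
  have h1 : ‖a ^ 3 + A * a + B‖ < 1 := by
    rw [PadicInt.norm_lt_one_iff_dvd, dvd_iff_toZMod]; simpa using hr
  let P : Polynomial ℤ_[p] := Polynomial.X ^ 3 + Polynomial.C (A : ℤ_[p]) * Polynomial.X + Polynomial.C (B : ℤ_[p])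
  have hP : ∀ t : ℤ_[p], Polynomial.aeval t P = t ^ 3 + A * t + B := fun t => by simp [P]
  have hP' : Polynomial.aeval a P.derivative = 3 * a ^ 2 + A := by simp [P]; norm_num
  obtain ⟨t, ht, htn, -⟩ := hensels_lemma (F := P) (a := a) (by rw [hP, hP', hd]; simpa using h1)
  rw [hP] at ht
  rw [hP', hd] at htn
  refine ⟨t, ht, ?_⟩
  rw [PadicInt.norm_lt_one_iff_dvd, dvd_iff_toZMod, map_sub, sub_eq_zero] at htn
  exact htn
theorem norm_odd {t s : ℚ_[p]} (hs : s ≠ 0) (h : ‖t‖ ^ 2 * (p : ℝ) ^ 3 = ‖s‖ ^ 2) : False := by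
  have hp : 1 < (p : ℝ) := by exact_mod_cast (Fact.out : p.Prime).one_lt
  have hs' : 0 < ‖s‖ := norm_pos_iff.2 hs
  have ht : t ≠ 0 := by rintro rfl; rw [norm_zero] at h; have := pow_pos hs' 2; grind
  rw [Padic.norm_eq_zpow_neg_valuation ht, Padic.norm_eq_zpow_neg_valuation hs, ← zpow_natCast, ← zpow_natCast, ← zpow_natCast,
    ← zpow_mul, ← zpow_mul, ← zpow_add₀ (by linarith)] at h
  have := zpow_right_injective₀ (by linarith) hp.ne' h
  grind
def qmap {R S : Type*} [CommRing R] [CommRing S] (g : R →+* S) {r : R} (x : Qr A r) : Qr A (g r) := ⟨g x.re, g x.im⟩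
theorem qmap_mul {R S : Type*} [CommRing R] [CommRing S] (g : R →+* S) {r : R} (x y : Qr A r) : qmap g (x * y) = qmap g x * qmap g y := by
  ext <;> simp [qmap]
theorem qmap_prj {R S : Type*} [CommRing R] [CommRing S] (g : R →+* S) {r : R} (x : Cub R A B) : qmap g (prj r x) = prj (g r) (Cub.map g x) := by
  ext <;> simp [qmap, prj]
theorem norm_p3 : ‖(p : ℚ_[p])‖ ^ 3 * (p : ℝ) ^ 3 = 1 := by
  rw [Padic.norm_p, ← mul_pow, inv_mul_cancel₀ (by exact_mod_cast (Fact.out : p.Prime).ne_zero), one_pow]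
theorem ram (h2 : p ≠ 2) (hD : ¬ (p : ℤ) ∣ Dis A B) {δ : ℤ} (hδ : ¬ (p : ℤ) ∣ δ) {c : Cub ℚ A B} {n : ℚ} (hn : n ≠ 0) (hcN : c.N = n ^ 2)
    (hloc : Loc ℚ_[p] (p * δ) c) (hs : ∀ r : ZMod p, r ^ 3 + A * r + B = 0 → ∃ (s : Cub ℤ A B) (m : ℤ), s.N = m ^ 2 ∧ ¬ (p : ℤ) ∣ m ∧
      ¬ IsSquare (evr r s) ∧ Ob ℚ_[p] (c * Cub.map (Int.castRingHom ℚ) s)) :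
    ∃ (z : Cub ℚ_[p] A B) (ε : ℤ_[p]), IsUnit z ∧ Cub.map (algebraMap ℚ ℚ_[p]) c * z ^ 2 = inc (1 - Cub.of A B (p * ε) * Cub.θ) := by
  obtain ⟨X, z, hz, e⟩ := hloc
  have hp0 : (p : ℚ_[p]) ≠ 0 := by exact_mod_cast (Fact.out : p.Prime).ne_zero
  push_cast at e
  obtain ⟨Y, hY0, hY⟩ : ∃ Y : ℚ_[p], Y ≠ 0 ∧ Y ^ 2 = X ^ 3 + (p * δ) ^ 2 * A * X + (p * δ) ^ 3 * B := by
    refine ⟨algebraMap ℚ ℚ_[p] n * z.N, mul_ne_zero (by simpa using hn) (Cub.isUnit_iff.1 hz).ne_zero, ?_⟩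
    rw [← N_lin, ← e, Cub.N_mul, Cub.N_map, hcN, Cub.N_pow, mul_pow, map_pow]
  by_cases hX : 1 ≤ ‖X‖
  · have hX0 : X ≠ 0 := fun h => by rw [h, norm_zero] at hX; linarith
    obtain ⟨i, hi⟩ := lift_int (x := X⁻¹) (by rw [norm_inv]; exact inv_le_one_of_one_le₀ hX)
    obtain ⟨w, hw⟩ : IsSquare (1 + p * (p * δ ^ 2 * A * i ^ 2 + p ^ 2 * δ ^ 3 * B * i ^ 3) : ℤ_[p]) := by
      refine isSquare_of_res h2 (norm_eq_one_iff.2 ?_) ?_ <;> simp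
    have hw' : (1 + (p * δ) ^ 2 * A * X⁻¹ ^ 2 + (p * δ) ^ 3 * B * X⁻¹ ^ 3 : ℚ_[p]) = (w : ℚ_[p]) ^ 2 := by
      have := congrArg (fun x : ℤ_[p] => (x : ℚ_[p])) hw
      push_cast at this
      grind
    have e1 : X ^ 3 * (w : ℚ_[p]) ^ 2 = Y ^ 2 := by grind
    have hw0 : (w : ℚ_[p]) ≠ 0 := fun h => by grind
    refine ⟨z * Cub.of A B (X * w / Y), δ * i, hz.mul ((isUnit_iff_ne_zero.2 (div_ne_zero (mul_ne_zero hX0 hw0) hY0)).map _), ?_⟩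
    rw [mul_pow, ← mul_assoc, e, ← map_pow]
    have e2 : (X * w / Y) ^ 2 = X⁻¹ := by grind
    rw [e2]
    have hi' : PadicInt.Coe.ringHom i = X⁻¹ := hi
    ext
    · simp [hX0]
    · simp [hi']; ring
    · simp
  exfalso
  push Not at hX
  obtain ⟨x, rfl⟩ := lift_int hX.le
  have hX' : ‖x‖ < 1 := hX
  rw [PadicInt.norm_lt_one_iff_dvd] at hX'
  obtain ⟨x, rfl⟩ := hX'
  push_cast at hY e
  have hYF : Y ^ 2 = p ^ 3 * ((x ^ 3 + δ ^ 2 * A * x + δ ^ 3 * B : ℤ_[p]) : ℚ_[p]) := by rw [hY]; push_cast; ring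
  have hδ' : (δ : ZMod p) ≠ 0 := by rwa [Ne, ZMod.intCast_zmod_eq_zero_iff_dvd]
  have hYn : ‖Y‖ ^ 2 * (p : ℝ) ^ 3 = ‖x ^ 3 + δ ^ 2 * A * x + δ ^ 3 * B‖ := by
    rw [← norm_pow, hYF, norm_mul, norm_pow, mul_right_comm, norm_p3, one_mul, ← PadicInt.norm_def]
  have hF : PadicInt.toZMod (x ^ 3 + δ ^ 2 * A * x + δ ^ 3 * B : ℤ_[p]) = 0 := by
    by_contra h
    rw [← Ne, ← norm_eq_one_iff] at h
    exact norm_odd (p := p) (t := Y) (s := 1) one_ne_zero (by rw [hYn, h]; simp)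
  simp only [map_add, map_mul, map_pow, map_intCast] at hF
  obtain ⟨ρ, hρ, hρr⟩ := root_lift (A := A) (B := B) (r := PadicInt.toZMod x / (δ : ZMod p)) (by
    grind) hD
  have hxρ : PadicInt.toZMod x = δ * PadicInt.toZMod ρ := by rw [hρr]; field_simp
  set g := PadicInt.toZMod (p := p)
  have hρg : (g ρ) ^ 3 + A * g ρ + B = 0 := by grind
  have hDg : (Dis A B : ZMod p) ≠ 0 := by rwa [Ne, ZMod.intCast_zmod_eq_zero_iff_dvd]
  have hd2 : 3 * (g ρ) ^ 2 + A ≠ 0 := by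
    rw [Dis_root hρg] at hDg
    grind
  have h3g : g 3 = 3 := map_ofNat _ 3
  obtain ⟨s, m, hsN, hm, hsq, y', hy', hob⟩ := hs _ hρg
  set σ : Cub ℤ_[p] A B := Cub.map (Int.castRingHom ℤ_[p]) s with hσ
  have hσN : σ.N = (m : ℤ_[p]) ^ 2 := by rw [hσ, Cub.N_map, hsN]; simp
  have hσρ : ‖vl ρ σ‖ = 1 := by
    have := congrArg norm (prj_norm hρ σ)
    rw [hσN, norm_pow, norm_int_eq_one hm, norm_mul, one_pow] at this
    have h1 := PadicInt.norm_le_one (vl ρ σ)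
    have h2 := PadicInt.norm_le_one (prj ρ σ).norm
    nlinarith [norm_nonneg (vl ρ σ)]
  set lin : Cub ℤ_[p] A B := Cub.of A B x - Cub.of A B (δ : ℤ_[p]) * Cub.θ with hlin
  have hlinρ : vl ρ lin = x - δ * ρ := by simp [hlin, vl]; ring
  have hYl : ‖Y‖ ^ 2 * (p : ℝ) ^ 3 = ‖x - δ * ρ‖ := by
    rw [hYn, show x ^ 3 + δ ^ 2 * A * x + δ ^ 3 * B = (x - δ * ρ) * (x ^ 2 + δ * ρ * x + δ ^ 2 * (ρ ^ 2 + A)) by linear_combination (δ : ℤ_[p]) ^ 3 * hρ, norm_mul]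
    suffices hh : ‖x ^ 2 + δ * ρ * x + δ ^ 2 * (ρ ^ 2 + A)‖ = 1 by rw [hh, mul_one]
    rw [norm_eq_one_iff]
    simp only [map_add, map_mul, map_pow, map_intCast]
    change g x ^ 2 + _ * _ * g x + _ ≠ 0
    rw [hxρ]
    convert mul_ne_zero (pow_ne_zero 2 hδ') hd2 using 1; ring
  have hxρ0 : x - δ * ρ ≠ 0 := fun h => by
    rw [h, norm_zero] at hYl
    have h1 : 0 < ‖Y‖ := norm_pos_iff.2 hY0
    have h2 : (0 : ℝ) < p := by exact_mod_cast (Fact.out : p.Prime).pos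
    have : 0 < ‖Y‖ ^ 2 * (p : ℝ) ^ 3 := by positivity
    linarith
  set ι := PadicInt.Coe.ringHom (p := p)
  have hι : Function.Injective ι := fun a b h => PadicInt.ext h
  have hρι : (ι ρ) ^ 3 + A * ι ρ + B = 0 := by simpa using congrArg ι hρ
  obtain ⟨zi, hzi⟩ := hz.exists_right_inv
  set y := zi * y' with hy
  have hy0 : y ≠ 0 := fun h => hy' (by rw [← one_mul y', ← hzi, mul_assoc, ← hy, h, mul_zero])
  have hsi : Cub.map (algebraMap ℚ ℚ_[p]) (Cub.map (Int.castRingHom ℚ) s) = Cub.map ι σ := by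
    ext <;> simp [hσ]
  have hT : (Cub.map ι lin * Cub.map ι σ * y ^ 2).c = 0 := by
    have e1 : Cub.map (algebraMap ℚ ℚ_[p]) (c * Cub.map (Int.castRingHom ℚ) s) * y' ^ 2 = Cub.of A B (p : ℚ_[p]) * (Cub.map ι lin * Cub.map ι σ * y ^ 2) := by
      have e3 : Cub.of A B (p : ℚ_[p]) * Cub.map ι lin = Cub.map (algebraMap ℚ ℚ_[p]) c * z ^ 2 := by
        rw [e, hlin]
        have hιc : ∀ t : ℤ_[p], ι t = (t : ℚ_[p]) := fun t => rfl
        ext <;> simp [hιc]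
      rw [map_mul, hsi, ← mul_assoc, ← mul_assoc, e3, hy]
      linear_combination -(Cub.map (algebraMap ℚ ℚ_[p]) c * Cub.map ι σ * y' ^ 2 * (z * zi + 1)) * hzi
    rw [e1] at hob
    have e4 : ∀ (t : ℚ_[p]) (w : Cub ℚ_[p] A B), (Cub.of A B t * w).c = t * w.c := fun t w => by simp
    rw [e4] at hob
    exact (mul_eq_zero.1 hob).resolve_left hp0
  set T := Cub.map ι lin * Cub.map ι σ * y ^ 2 with hTd
  have hv : T.a + T.b * ι ρ = ι (x - δ * ρ) * ι (vl ρ σ) * (vl (ι ρ) y) ^ 2 := by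
    have : vl (ι ρ) T = T.a + T.b * ι ρ := by simp [vl, hT]
    rw [← this, hTd, vl_mul hρι, vl_mul hρι, vl_sq hρι, vl_map, vl_map, hlinρ]
  have hq : prj (ι ρ) T = prj (ι ρ) (Cub.map ι lin) * prj (ι ρ) (Cub.map ι σ) * (prj (ι ρ) y) ^ 2 := by
    rw [hTd, prj_mul hρι, prj_mul hρι, pow_two y, prj_mul hρι, ← pow_two]
  have hprim : ¬ ((prj (ι ρ) y).re = 0 ∧ (prj (ι ρ) y).im = 0 ∧ (0 : ℚ_[p]) = 0) := by
    rintro ⟨h1, h2, -⟩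
    have h0 : prj (ι ρ) y = 0 := by ext <;> simp [h1, h2]
    rw [h0] at hq
    have ha := congrArg QuadraticAlgebra.re hq
    have hb := congrArg QuadraticAlgebra.im hq
    simp [prj, hT] at ha hb
    rw [ha, hb, zero_mul, add_zero] at hv
    have h3 : vl (ι ρ) y = 0 := by
      have h4 : ι (x - δ * ρ) ≠ 0 := fun h => hxρ0 (hι (by rw [h, map_zero]))
      have h5 : ι (vl ρ σ) ≠ 0 := fun h => by
        rw [hι (by rw [h, map_zero] : ι (vl ρ σ) = ι 0), norm_zero] at hσρ; norm_num at hσρ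
      exact (pow_eq_zero_iff two_ne_zero).1 ((mul_eq_zero.1 hv.symm).resolve_left (mul_ne_zero h4 h5))
    simp only [prj, vl] at h1 h2 h3
    have h6 : y.c * ι (3 * ρ ^ 2 + A) = 0 := by
      have : ι 3 = 3 := map_ofNat _ 3
      simp only [map_add, map_mul, map_pow, map_intCast, this]
      linear_combination h3 - h1 - ι ρ * h2
    have h7 : y.c = 0 := by
      refine (mul_eq_zero.1 h6).resolve_right fun h => hd2 ?_
      have := congrArg g (hι (by rw [h, map_zero] : ι (3 * ρ ^ 2 + A) = ι 0))
      simpa [h3g] using this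
    rw [h7] at h1 h2
    rw [zero_mul, sub_zero] at h1 h2
    exact hy0 (by ext; exacts [h1, h2, h7])
  obtain ⟨k, x', y'', z', hk, hx', hy'', hz', hpr⟩ := primitive3 hprim
  have hz'0 : z' = 0 := by
    have : (z' : ℚ_[p]) = 0 := (mul_eq_zero.1 hz'.symm).resolve_left hk
    exact PadicInt.ext this
  set w : Qr A ρ := prj ρ lin * prj ρ σ * ⟨x', y''⟩ ^ 2 with hw
  have hqw : prj (ι ρ) T = QuadraticAlgebra.C (k ^ 2) * qmap ι w := by
    have : prj (ι ρ) y = QuadraticAlgebra.C k * qmap ι ⟨x', y''⟩ := by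
      ext
      · rw [hx']; simp [qmap]; exact Or.inl rfl
      · rw [hy'']; simp [qmap]; exact Or.inl rfl
    rw [hq, this, hw, pow_two (⟨x', y''⟩ : Qr A ρ), qmap_mul, qmap_mul, qmap_mul, qmap_prj, qmap_prj, QuadraticAlgebra.C_pow]
    ring
  have hTa : T.a = k ^ 2 * ι w.re := by
    generalize k ^ 2 = κ at hqw ⊢
    have := congrArg QuadraticAlgebra.re hqw
    simpa [prj, hT, qmap] using this
  have hTb : T.b = k ^ 2 * ι w.im := by
    generalize k ^ 2 = κ at hqw ⊢
    have := congrArg QuadraticAlgebra.im hqw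
    simpa [prj, hT, qmap] using this
  have hdv : g (w.re + w.im * ρ) = 0 := by
    by_contra h
    rw [← Ne, ← norm_eq_one_iff] at h
    have e1 : k ^ 2 * ι (w.re + w.im * ρ) = ι (x - δ * ρ) * ι (vl ρ σ) * (vl (ι ρ) y) ^ 2 := by
      rw [← hv, hTa, hTb, map_add, map_mul]; ring
    have e2 := congrArg norm e1
    have hιn : ∀ t : ℤ_[p], ‖ι t‖ = ‖t‖ := fun t => rfl
    rw [norm_mul, norm_mul, norm_mul, hιn, hιn, hιn, h, hσρ, norm_pow, norm_pow, mul_one, mul_one, ← hYl] at e2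
    exact norm_odd (p := p) (t := Y * vl (ι ρ) y) (s := k) hk (by rw [e2, norm_mul]; ring)
  have hqm : qmap g w = prj (g ρ) (Cub.map g lin) * prj (g ρ) (Cub.map g σ) * (qmap g ⟨x', y''⟩) ^ 2 := by
    rw [hw, pow_two (⟨x', y''⟩ : Qr A ρ), qmap_mul, qmap_mul, qmap_mul, qmap_prj, qmap_prj, ← pow_two]
  apply hsq
  have hevr : evr (g ρ) s = vl (g ρ) (Cub.map g σ) := by simp [evr, vl, hσ]
  have h2' : (2 : ZMod p) ≠ 0 := fun h => by
    have : ((2 : ℕ) : ZMod p) = 0 := by exact_mod_cast h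
    rw [ZMod.natCast_eq_zero_iff] at this
    exact h2 ((Nat.prime_dvd_prime_iff_eq Fact.out Nat.prime_two).1 this)
  rw [hevr]
  refine ram_modp h2' hρg hDg hδ' (v := g w.im) (n := (m : ZMod p)) (x := g x') (y := g y'') (by rwa [Ne, ZMod.intCast_zmod_eq_zero_iff_dvd]) (by rw [Cub.N_map, hσN]; simp) ?_ ?_
  · rintro ⟨h1, h2⟩
    rcases hpr with h | h | h
    · exact norm_eq_one_iff.1 h h1
    · exact norm_eq_one_iff.1 h h2
    · rw [hz'0, norm_zero] at h; norm_num at h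
  · have e1 : prj (g ρ) (Cub.map g lin) = ⟨δ * g ρ, -δ⟩ := by
      ext <;> simp [prj, hlin, hxρ]
    rw [e1] at hqm
    have e2 : qmap g w = ⟨-(g w.im * g ρ), g w.im⟩ := by
      ext
      · simp only [qmap]
        rw [map_add, map_mul] at hdv
        linear_combination hdv
      · simp [qmap]
    rw [← e2, hqm, mul_comm (prj _ _)]; rfl
end Ono

namespace Ono
variable {A B : ℤ}
structure HH (d : ℤ) (e : ℝ) (N : ℕ) (α : Cub ℚ A B) : Prop where
  sq : ∃ n : ℚ, n ≠ 0 ∧ α.N = n ^ 2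
  pos : 0 < vl e (Cub.map (algebraMap ℚ ℝ) α)
  loc : ∀ (l : ℕ) [Fact l.Prime], l ∣ N → Loc ℚ_[l] d α
  unr : ∀ (l : ℕ) [Fact l.Prime], ¬ l ∣ N → UF (Cub.map (algebraMap ℚ ℚ_[l]) α)
theorem isUnit_of_N {F : Type*} [Field F] {α : Cub F A B} (h : α.N ≠ 0) : IsUnit α := Cub.isUnit_iff.2 (isUnit_iff_ne_zero.2 h)
theorem vl_ne {F : Type*} [Field F] {r : F} (hr : r ^ 3 + A * r + B = 0) {α : Cub F A B} (h : IsUnit α) : vl r α ≠ 0 := by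
  have := (Cub.isUnit_iff.1 h).ne_zero
  rw [prj_norm hr] at this
  grind
theorem isUnit_of_sq {α : Cub ℚ A B} (h : ∃ n : ℚ, n ≠ 0 ∧ α.N = n ^ 2) : IsUnit α := by
  obtain ⟨n, hn, h⟩ := h; exact isUnit_of_N (by rw [h]; positivity)
theorem isSquare_map_N {F : Type*} [Field F] [Algebra ℚ F] {α : Cub ℚ A B} (h : ∃ n : ℚ, n ≠ 0 ∧ α.N = n ^ 2) :
    IsSquare (Cub.map (algebraMap ℚ F) α).N := by
  obtain ⟨n, hn, h⟩ := h; exact ⟨algebraMap ℚ F n, by rw [Cub.N_map, h, pow_two, map_mul]⟩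
theorem sq_mul {α β : Cub ℚ A B} (h : ∃ n : ℚ, n ≠ 0 ∧ α.N = n ^ 2) (h' : ∃ n : ℚ, n ≠ 0 ∧ β.N = n ^ 2) :
    ∃ n : ℚ, n ≠ 0 ∧ (α * β).N = n ^ 2 := by
  obtain ⟨n, hn, h⟩ := h; obtain ⟨m, hm, h'⟩ := h'
  exact ⟨n * m, mul_ne_zero hn hm, by rw [Cub.N_mul, h, h', mul_pow]⟩
theorem Loc.mul {F : Type*} [NontriviallyNormedField F] [CompleteSpace F] [CharZero F] [Algebra ℚ F] {d : ℤ} {α β : Cub ℚ A B}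
    (h : ∃ n : ℚ, n ≠ 0 ∧ α.N = n ^ 2) (h' : ∃ n : ℚ, n ≠ 0 ∧ β.N = n ^ 2) (hα : Loc F d α) (hβ : Loc F d β) : Loc F d (α * β) := by
  rw [Loc, map_mul]
  exact LocF.mul ((isUnit_of_sq h).map _) ((isUnit_of_sq h').map _) (isSquare_map_N h) (isSquare_map_N h') hα hβ
section
variable {d : ℤ} {e : ℝ} {N : ℕ} {α β w : Cub ℚ A B}
theorem HH.isUnit (h : HH d e N α) : IsUnit α := isUnit_of_sq h.sq
theorem HH.one : HH d e N (1 : Cub ℚ A B) where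
  sq := ⟨1, one_ne_zero, by simp [Cub.N]⟩
  pos := by simp
  loc l _ _ := by rw [Loc, map_one]; exact LocF.one
  unr l _ _ := by rw [map_one]; exact UF.one
theorem HH.mul (he : e ^ 3 + A * e + B = 0) (h : HH d e N α) (h' : HH d e N β) : HH d e N (α * β) where
  sq := sq_mul h.sq h'.sq
  pos := by rw [map_mul, vl_mul he]; exact mul_pos h.pos h'.pos
  loc l _ hl := Loc.mul h.sq h'.sq (h.loc l hl) (h'.loc l hl)
  unr l _ hl := by rw [map_mul]; exact (h.unr l hl).mul (h'.unr l hl)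
theorem HH.mul_sq (he : e ^ 3 + A * e + B = 0) (h : HH d e N α) (hw : IsUnit w) : HH d e N (α * w ^ 2) where
  sq := sq_mul h.sq ⟨w.N, (Cub.isUnit_iff.1 hw).ne_zero, Cub.N_pow _ _⟩
  pos := by
    rw [map_mul, vl_mul he, map_pow, vl_sq he]
    have := vl_ne he (hw.map (Cub.map (algebraMap ℚ ℝ)))
    have := h.pos
    positivity
  loc l _ hl := by rw [Loc, map_mul, map_pow]; exact LocF.mul_sq (hw.map _) (h.loc l hl)
  unr l _ hl := by rw [map_mul, map_pow]; exact (h.unr l hl).mul_sq (hw.map _)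
def Hg (he : e ^ 3 + A * e + B = 0) (d : ℤ) (N : ℕ) : Subgroup (Cub ℚ A B)ˣ where
  carrier := {u | HH d e N (u : Cub ℚ A B)}
  one_mem' := HH.one
  mul_mem' h h' := HH.mul he h h'
  inv_mem' {u} h := by
    have := HH.mul_sq he h (u⁻¹).isUnit
    rwa [pow_two, ← mul_assoc, Units.mul_inv, one_mul] at this
theorem mem_Hg {he : e ^ 3 + A * e + B = 0} {u : (Cub ℚ A B)ˣ} : u ∈ Hg he d N ↔ HH d e N (u : Cub ℚ A B) := Iff.rfl
theorem HH.integral (he : e ^ 3 + A * e + B = 0) (h : HH d e N α) : ∃ (s : Cub ℤ A B) (m : ℤ) (k : Cub ℚ A B), IsUnit k ∧ m ≠ 0 ∧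
    s.N = m ^ 2 ∧ Cub.map (Int.castRingHom ℚ) s = α * k ^ 2 ∧ HH d e N (Cub.map (Int.castRingHom ℚ) s) := by
  have hk : (α.a.den * α.b.den * α.c.den : ℚ) ≠ 0 := by
    exact_mod_cast mul_ne_zero (mul_ne_zero α.a.den_ne_zero α.b.den_ne_zero) α.c.den_ne_zero
  set k : Cub ℚ A B := Cub.of A B (α.a.den * α.b.den * α.c.den : ℚ) with hkd
  have hku : IsUnit k := (isUnit_iff_ne_zero.2 hk).map _
  let s : Cub ℤ A B := ⟨α.a.num * α.a.den * (α.b.den * α.c.den) ^ 2, α.b.num * α.b.den * (α.a.den * α.c.den) ^ 2,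
    α.c.num * α.c.den * (α.a.den * α.b.den) ^ 2⟩
  have hs : Cub.map (Int.castRingHom ℚ) s = α * k ^ 2 := by
    have ha := Rat.mul_den_eq_num α.a
    have hb := Rat.mul_den_eq_num α.b
    have hc := Rat.mul_den_eq_num α.c
    rw [hkd, ← map_pow, mul_comm α]
    ext <;> simp [s, -map_pow, -map_mul]
    · grind
    · grind
    grind
  have hH : HH d e N (Cub.map (Int.castRingHom ℚ) s) := by rw [hs]; exact h.mul_sq he hku
  obtain ⟨n, hn, hN⟩ := hH.sq
  rw [Cub.N_map, eq_intCast] at hN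
  have hsq : IsSquare ((s.N : ℤ) : ℚ) := ⟨n, by rw [hN, pow_two]⟩
  obtain ⟨m, hm⟩ := Rat.isSquare_intCast_iff.1 hsq
  refine ⟨s, m, k, hku, ?_, by rw [hm, pow_two], hs, hH⟩
  rintro rfl
  rw [hm] at hN; grind
theorem rec_pair (he : e ^ 3 + A * e + B = 0) (hf : 0 < 3 * e ^ 2 + A) (h2 : 2 ∣ N) (hsq : ∃ n : ℚ, n ≠ 0 ∧ α.N = n ^ 2)
    (hpos : 0 < vl e (Cub.map (algebraMap ℚ ℝ) α)) (loc : ∀ (l : ℕ) [Fact l.Prime], l ∣ N → Loc ℚ_[l] d α) (p : ℕ) [Fact p.Prime]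
    (hp : ¬ p ∣ N) (unr : ∀ (l : ℕ) [Fact l.Prime], ¬ l ∣ N → l ≠ p → UF (Cub.map (algebraMap ℚ ℚ_[l]) α)) : Ob ℚ_[p] α := by
  obtain ⟨n, hn, hN⟩ := hsq
  refine ob_p (by rw [hN]; positivity) p (fun h => hp (h ▸ h2)) (real_ob (by rw [hN]; positivity) he hf hpos) fun q _ hq => ?_
  by_cases hqN : q ∣ N
  · exact (loc q hqN).ob
  · exact UF.ob (fun h => hqN (by rwa [h])) (unr q hqN hq)
theorem loc_twist {η : ℤ} {p l : ℕ} [Fact l.Prime] (hp : p.Prime) (hpN : ¬ p ∣ N) (hN : N ≠ 0) (h2 : 2 ∣ N) (hl : l ∣ N) (hc : Cd η N p) :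
    Loc ℚ_[l] (p * (η * d)) α ↔ Loc ℚ_[l] d α := by
  obtain ⟨t, ht, e⟩ := Cd.sq hp hpN hN h2 hl hc
  have e1 : ((p * (η * d) : ℤ) : ℚ_[l]) = d * t ^ 2 := by grind
  have e2 : (d : ℚ_[l]) = ((p * (η * d) : ℤ) : ℚ_[l]) * t⁻¹ ^ 2 := by rw [e1]; field_simp
  refine ⟨fun h => ?_, fun h => ?_⟩
  · rw [Loc, e2]; exact LocF.twist (inv_ne_zero ht) h
  · rw [Loc, e1]; exact LocF.twist ht h
theorem kill_ram (he : e ^ 3 + A * e + B = 0) (hf : 0 < 3 * e ^ 2 + A) (hN : N ≠ 0) (h2 : 2 ∣ N) (hDN : Dis A B ∣ N) (hdN : d ∣ N)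
    {η : ℤ} {p : ℕ} [Fact p.Prime] (hη : η = 1 ∨ η = -1) (hpN : ¬ p ∣ N) (hc : Cd η N p)
    (hs : ∀ r : ZMod p, r ^ 3 + A * r + B = 0 → ∃ (s : Cub ℤ A B) (m : ℤ), s.N = m ^ 2 ∧ ¬ (p : ℤ) ∣ m ∧
      ¬ IsSquare (evr r s) ∧ HH d e N (Cub.map (Int.castRingHom ℚ) s)) (h : HH (p * (η * d)) e (N * p) α) :
    HH d e N α ∧ ∀ ρ : ℤ_[p], ρ ^ 3 + A * ρ + B = 0 → IsSquare (vl (ρ : ℚ_[p]) (Cub.map (algebraMap ℚ ℚ_[p]) α)) := by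
  have hpp : p.Prime := Fact.out
  have hp2 : p ≠ 2 := fun h => hpN (h ▸ h2)
  have hpD : ¬ (p : ℤ) ∣ Dis A B := fun h => hpN (Int.natCast_dvd_natCast.1 (h.trans hDN))
  have hpd : ¬ (p : ℤ) ∣ η * d := by
    rcases hη with rfl | rfl
    · rw [one_mul]; exact fun h => hpN (Int.natCast_dvd_natCast.1 (h.trans hdN))
    · rw [neg_one_mul, dvd_neg]; exact fun h => hpN (Int.natCast_dvd_natCast.1 (h.trans hdN))
  have loc : ∀ (l : ℕ) [Fact l.Prime], l ∣ N → Loc ℚ_[l] d α := fun l _ hl =>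
    (loc_twist hpp hpN hN h2 hl hc).1 (h.loc l (hl.mul_right p))
  have unr : ∀ (l : ℕ) [Fact l.Prime], ¬ l ∣ N → l ≠ p → UF (Cub.map (algebraMap ℚ ℚ_[l]) α) := fun l _ hl hlp =>
    h.unr l fun h => ((Fact.out : l.Prime).dvd_mul.1 h).elim hl fun h => hlp ((Nat.prime_dvd_prime_iff_eq Fact.out hpp).1 h)
  obtain ⟨n, hn, hαN⟩ := h.sq
  obtain ⟨z, ε, hz, ez⟩ := ram hp2 hpD hpd hn hαN (h.loc p (dvd_mul_left p N)) fun r hr => by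
    obtain ⟨s, m, h1, h3, h4, h5⟩ := hs r hr
    refine ⟨s, m, h1, h3, h4, rec_pair he hf h2 (sq_mul h.sq h5.sq) ?_ (fun l _ hl => Loc.mul h.sq h5.sq (loc l hl) (h5.loc l hl)) p hpN fun l _ hl hlp => ?_⟩
    · rw [map_mul, vl_mul he]; exact mul_pos h.pos h5.pos
    · rw [map_mul]; exact (unr l hl hlp).mul (h5.unr l hl)
  refine ⟨⟨h.sq, h.pos, loc, fun l _ hl => ?_⟩, fun ρ hρ => ?_⟩
  · by_cases hlp : l = p
    · subst hlp
      refine UF.of_sq hz ?_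
      rw [ez]
      refine UF.of_int (norm_eq_one_iff.2 ?_)
      have : PadicInt.toZMod (1 - Cub.of A B (l * ε) * Cub.θ : Cub ℤ_[l] A B).N = 1 := by
        simp [Cub.N]
      rw [this]; exact one_ne_zero
    · exact unr l hl hlp
  · have hρ' : (ρ : ℚ_[p]) ^ 3 + A * (ρ : ℚ_[p]) + B = 0 := by exact_mod_cast congrArg (PadicInt.Coe.ringHom (p := p)) hρ
    have e1 := congrArg (vl (ρ : ℚ_[p])) ez
    rw [vl_mul hρ', vl_sq hρ'] at e1
    have e2 : vl (ρ : ℚ_[p]) (inc (1 - Cub.of A B (p * ε) * Cub.θ)) = ((1 - p * ε * ρ : ℤ_[p]) : ℚ_[p]) := by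
      have := vl_map (PadicInt.Coe.ringHom (p := p)) (r := ρ) (1 - Cub.of A B (p * ε) * Cub.θ)
      refine this.trans ?_
      rw [vl_sub, vl_mul hρ, vl_of, vl_one, vl_θ]; rfl
    rw [e2] at e1
    have e3 : PadicInt.toZMod (1 - p * ε * ρ : ℤ_[p]) = 1 := by simp
    obtain ⟨y, hy⟩ := isSquare_of_res hp2 (u := 1 - p * ε * ρ) (norm_eq_one_iff.2 (by rw [e3]; exact one_ne_zero)) (by rw [e3]; exact IsSquare.one)
    have hv := vl_ne hρ' hz
    refine ⟨y / vl (ρ : ℚ_[p]) z, ?_⟩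
    rw [hy, PadicInt.coe_mul] at e1
    field_simp
    rw [e1]; ring
end
end Ono

namespace Ono
variable {A B : ℤ}
theorem index2 {G : Type*} [Group G] {L K : Subgroup G} {χ : G → Prop} (h : ∀ u ∈ K, u ∈ L ↔ χ u) {a : G} (ha : a ∈ K)
    (hx : ∀ b ∈ K, χ (b * a) ↔ ¬ χ b) : L.relIndex K = 2 := by
  rw [Subgroup.relIndex_eq_two_iff]
  refine ⟨a, ha, fun b hb => ?_⟩
  rw [h _ (K.mul_mem hb ha), h _ hb, hx b hb]
  grind
def Sq (A B : ℤ) : Subgroup (Cub ℚ A B)ˣ := (powMonoidHom 2).range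
theorem mem_Sq {u : (Cub ℚ A B)ˣ} : u ∈ Sq A B ↔ ∃ v : (Cub ℚ A B)ˣ, v ^ 2 = u := Iff.rfl
theorem Sq_le {e : ℝ} (he : e ^ 3 + A * e + B = 0) {d : ℤ} {N : ℕ} : Sq A B ≤ Hg he d N := by
  rintro _ ⟨v, rfl⟩
  have := HH.one.mul_sq (d := d) (N := N) he v.isUnit
  rw [one_mul] at this
  rw [mem_Hg]; simpa using this
structure Adm (A B : ℤ) (d : ℤ) (N : ℕ) : Prop where
  N0 : N ≠ 0
  two : 2 ∣ N
  dis : Dis A B ∣ N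
  dvd : d ∣ N
  sqf : Squarefree d
theorem Adm.next {d : ℤ} {N p : ℕ} (h : Adm A B d N) (hp : p.Prime) (hpN : ¬ p ∣ N) {η : ℤ} (hη : η = 1 ∨ η = -1) :
    Adm A B (p * (η * d)) (N * p) where
  N0 := mul_ne_zero h.N0 hp.ne_zero
  two := h.two.mul_right _
  dis := by push_cast; exact h.dis.mul_right _
  dvd := by
    push_cast; rw [mul_comm]; refine mul_dvd_mul_right ?_ _
    rcases hη with rfl | rfl
    · rw [one_mul]; exact h.dvd
    · rw [neg_one_mul, neg_dvd]; exact h.dvd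
  sqf := by
    have h1 : (p * (η * d)).natAbs = p * d.natAbs := by
      rcases hη with rfl | rfl <;> simp [Int.natAbs_mul]
    rw [← Int.squarefree_natAbs, h1, Nat.squarefree_mul_iff]
    exact ⟨(Nat.Prime.coprime_iff_not_dvd hp).2 fun hd => hpN (hd.trans (Int.natAbs_dvd_natAbs.2 h.dvd)), hp.prime.squarefree,
      Int.squarefree_natAbs.2 h.sqf⟩
section
variable {p : ℕ} [Fact p.Prime]
theorem res_sq {ρ : ℤ_[p]} {s : Cub ℤ A B} (h : IsSquare (vl (ρ : ℚ_[p]) (Cub.map (algebraMap ℚ ℚ_[p]) (Cub.map (Int.castRingHom ℚ) s)))) :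
    IsSquare (evr (PadicInt.toZMod ρ) s) := by
  obtain ⟨y, hy⟩ := h
  have e1 : vl (ρ : ℚ_[p]) (Cub.map (algebraMap ℚ ℚ_[p]) (Cub.map (Int.castRingHom ℚ) s)) = ((evr ρ s : ℤ_[p]) : ℚ_[p]) := by
    simp [vl, evr]
  rw [e1] at hy
  have hy1 : ‖y‖ ≤ 1 := by
    have := PadicInt.norm_le_one (evr ρ s)
    rw [PadicInt.norm_def, hy, norm_mul] at this
    by_contra hc; nlinarith
  obtain ⟨y, rfl⟩ := lift_int hy1
  refine ⟨PadicInt.toZMod y, ?_⟩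
  have : evr ρ s = y * y := PadicInt.ext (by rw [hy, PadicInt.coe_mul])
  rw [← map_mul, ← this]; simp [evr]
def QU (x : ℚ_[p]) : Prop := ∃ (a : ℤ_[p]) (t : ℚ_[p]), ‖a‖ = 1 ∧ t ≠ 0 ∧ x = a * t ^ 2
theorem QU.sq_iff (h2 : p ≠ 2) {a : ℤ_[p]} {t : ℚ_[p]} (ha : ‖a‖ = 1) (ht : t ≠ 0) : IsSquare (a * t ^ 2 : ℚ_[p]) ↔ IsSquare (PadicInt.toZMod a) := by
  constructor
  · rintro ⟨y, hy⟩
    have hz : (a : ℚ_[p]) = (y / t) * (y / t) := by grind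
    have : ‖y / t‖ ≤ 1 := by
      have h := ha; rw [PadicInt.norm_def, hz, norm_mul] at h
      by_contra hc; nlinarith
    obtain ⟨w, hw⟩ := lift_int this
    rw [← hw] at hz
    refine ⟨PadicInt.toZMod w, ?_⟩
    rw [← map_mul]; congr 1; exact PadicInt.ext (by rw [hz, PadicInt.coe_mul])
  · intro h
    obtain ⟨y, rfl⟩ := isSquare_of_res h2 ha h
    exact ⟨y * t, by push_cast; ring⟩
theorem QU.xor (h2 : p ≠ 2) {x y : ℚ_[p]} (hx : QU x) (hy : QU y) (h : ¬ IsSquare y) : IsSquare (x * y) ↔ ¬ IsSquare x := by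
  obtain ⟨a, t, ha, ht, rfl⟩ := hx
  obtain ⟨b, s, hb, hs, rfl⟩ := hy
  have e : (a * t ^ 2 * (b * s ^ 2) : ℚ_[p]) = (a * b : ℤ_[p]) * (t * s) ^ 2 := by push_cast; ring
  have hab : ‖a * b‖ = 1 := by rw [norm_mul, ha, hb, one_mul]
  rw [QU.sq_iff h2 hb hs] at h
  rw [e, QU.sq_iff h2 hab (mul_ne_zero ht hs), QU.sq_iff h2 ha ht]
  have ha0 := norm_eq_one_iff.1 ha
  have hb0 := norm_eq_one_iff.1 hb
  have hab0 := norm_eq_one_iff.1 hab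
  rw [← quadraticChar_one_iff_isSquare hb0] at h
  rw [← quadraticChar_one_iff_isSquare hab0, ← quadraticChar_one_iff_isSquare ha0, map_mul, map_mul]
  have h1 := (quadraticChar_dichotomy hb0).resolve_left h
  rw [h1]
  rcases quadraticChar_dichotomy ha0 with h | h <;> rw [h] <;> norm_num
theorem coe_root {ρ : ℤ_[p]} (hρ : ρ ^ 3 + A * ρ + B = 0) : (ρ : ℚ_[p]) ^ 3 + A * (ρ : ℚ_[p]) + B = 0 := by
  exact_mod_cast congrArg (PadicInt.Coe.ringHom (p := p)) hρ
theorem UF.vl {ρ : ℤ_[p]} (hρ : ρ ^ 3 + A * ρ + B = 0) {β : Cub ℚ_[p] A B} (h : UF β) : QU (vl (ρ : ℚ_[p]) β) := by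
  obtain ⟨z, hz, u, hu, e⟩ := h
  have hz' := vl_ne (coe_root hρ) hz
  have e1 := congrArg (Ono.vl (ρ : ℚ_[p])) e
  rw [vl_mul (coe_root hρ), vl_sq (coe_root hρ), show Ono.vl (ρ : ℚ_[p]) (inc u) = (Ono.vl ρ u : ℤ_[p]) from vl_map PadicInt.Coe.ringHom u] at e1
  refine ⟨Ono.vl ρ u, (Ono.vl (ρ : ℚ_[p]) z)⁻¹, ?_, inv_ne_zero hz', ?_⟩
  · rw [← PadicInt.isUnit_iff]
    have := Cub.isUnit_iff.1 hu
    rw [prj_norm hρ] at this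
    grind
  grind
end
theorem interp {F : Type*} [Field F] {r s t : F} (hr : r ^ 3 + A * r + B = 0) (hs : s ^ 3 + A * s + B = 0) (ht : t ^ 3 + A * t + B = 0)
    (hrs : s ≠ r) (hrt : t ≠ r) (hst : s ≠ t) {β : Cub F A B} (h1 : IsSquare (vl r β)) (h2 : IsSquare (vl s β)) (h3 : IsSquare (vl t β)) :
    ∃ w, β = w ^ 2 := by
  obtain ⟨x, hx⟩ := h1; obtain ⟨y, hy⟩ := h2; obtain ⟨z, hz⟩ := h3
  have h1 := sub_ne_zero.2 hrs; have h2 := sub_ne_zero.2 hrt; have h3 := sub_ne_zero.2 hst.symm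
  set b := (y - x) / (s - r) with hb
  set c := (z - x - b * (t - r)) / ((t - r) * (t - s)) with hc
  have hb' : b * (s - r) = y - x := by rw [hb]; field_simp
  have hc' : c * ((t - r) * (t - s)) = z - x - b * (t - r) := by rw [hc]; field_simp
  let w : Cub F A B := ⟨x - b * r + c * r * s, b - c * (r + s), c⟩
  have wr : vl r w = x := by simp only [vl, w]; ring
  have ws : vl s w = y := by simp only [vl, w]; linear_combination hb'
  have wt : vl t w = z := by simp only [vl, w]; linear_combination hc'
  refine ⟨w, ?_⟩
  set δ := β - w ^ 2 with hδ
  have d1 : vl r δ = 0 := by rw [hδ, vl_sub, vl_sq hr, wr, hx]; ring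
  have d2 : vl s δ = 0 := by rw [hδ, vl_sub, vl_sq hs, ws, hy]; ring
  have d3 : vl t δ = 0 := by rw [hδ, vl_sub, vl_sq ht, wt, hz]; ring
  simp only [vl] at d1 d2 d3
  have c1 : δ.b + δ.c * (r + s) = 0 := (mul_eq_zero.1 (show (s - r) * (δ.b + δ.c * (r + s)) = 0 by grind)).resolve_left h1
  have c3 : δ.c = 0 := (mul_eq_zero.1 (show (t - s) * δ.c = 0 by grind)).resolve_left h3
  rw [c3] at c1 d1
  have c4 : δ.b = 0 := by linear_combination c1
  rw [c4] at d1
  have c5 : δ.a = 0 := by linear_combination d1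
  exact sub_eq_zero.1 (Cub.ext c5 c4 c3)
section
variable {e : ℝ} {d : ℤ} {N : ℕ}
theorem not_sq {u : (Cub ℚ A B)ˣ} (hus : u ∉ Sq A B) {k x : Cub ℚ A B} (hk : IsUnit k) (hsk : x = u * k ^ 2) (z : Cub ℚ A B) : z ^ 2 ≠ x := by
  intro hz
  rw [hsk] at hz
  obtain ⟨k, rfl⟩ := hk
  have h1 : (z * (k⁻¹ : (Cub ℚ A B)ˣ)) ^ 2 = u := by
    rw [mul_pow, hz, mul_assoc, ← mul_pow, Units.mul_inv, one_pow, mul_one]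
  obtain ⟨v, hv⟩ := (isUnit_pow_iff two_ne_zero).1 (h1 ▸ u.isUnit)
  exact hus (mem_Sq.2 ⟨v, Units.ext (by rw [Units.val_pow_eq_pow_val, hv, h1])⟩)
theorem kill_transp (hfr : ∀ x : ℚ, x ^ 3 + A * x + B ≠ 0) (he : e ^ 3 + A * e + B = 0) (hf : 0 < 3 * e ^ 2 + A) (hD : Dis A B < 0)
    (hA : Adm A B d N) (h : ¬ Hg he d N ≤ Sq A B) :
    ∃ d' N', Adm A B d' N' ∧ Hg he d' N' < Hg he d N := by
  obtain ⟨u, hu, hus⟩ := SetLike.not_le_iff_exists.1 h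
  obtain ⟨s, m, k, hk, hm, hsm, hsk, hsH⟩ := HH.integral he hu
  obtain ⟨p, _, hpN, hpm, hc, r, hr, hrs, hr3⟩ := transp_exists hfr hA.N0 hD hA.dis hm hsm (not_sq hus hk hsk)
  have key := fun {α} => kill_ram (α := α) he hf hA.N0 hA.two hA.dis hA.dvd (Or.inr rfl) hpN hc fun x hx => by
    rw [← mem_rts, hr, Finset.mem_singleton] at hx
    grind
  have hrr : r ∈ rts A B p := by rw [hr]; simp
  refine ⟨_, _, hA.next Fact.out hpN (Or.inr rfl), ⟨fun v hv => (key hv).1, fun hle => hrs ?_⟩⟩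
  obtain ⟨ρ, hρ, rfl⟩ := root_lift (mem_rts.1 hrr) fun h => hpN (Int.natCast_dvd_natCast.1 (h.trans hA.dis))
  have := (key (HH.mul_sq he (hle hu) hk)).2 ρ hρ
  rw [← hsk] at this
  exact res_sq this
end
end Ono

namespace Ono
variable {A B : ℤ} {e : ℝ} {d : ℤ} {N : ℕ}
def Ks (H : Subgroup (Cub ℚ A B)ˣ) {F : Type*} [Field F] [Algebra ℚ F] {r : F} (hr : r ^ 3 + A * r + B = 0) : Subgroup (Cub ℚ A B)ˣ where
  carrier := {u | u ∈ H ∧ IsSquare (vl r (Cub.map (algebraMap ℚ F) (u : Cub ℚ A B)))}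
  one_mem' := ⟨H.one_mem, by simp⟩
  mul_mem' h h' := ⟨H.mul_mem h.1 h'.1, by rw [Units.val_mul, map_mul, vl_mul hr]; exact h.2.mul h'.2⟩
  inv_mem' {u} h := ⟨H.inv_mem h.1, by
    have e : vl r (Cub.map (algebraMap ℚ F) (u : Cub ℚ A B)) * vl r (Cub.map (algebraMap ℚ F) ((u⁻¹ : (Cub ℚ A B)ˣ) : Cub ℚ A B)) = 1 := by
      rw [← vl_mul hr, ← map_mul, Units.mul_inv, map_one, vl_one]
    rw [← inv_eq_of_mul_eq_one_right e]; exact h.2.inv⟩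
theorem kill_split (hfr : ∀ x : ℚ, x ^ 3 + A * x + B ≠ 0) (he : e ^ 3 + A * e + B = 0) (hf : 0 < 3 * e ^ 2 + A) (hD : Dis A B ≠ 0)
    (hA : Adm A B d N) (hd : 0 < d) {u₁ u₂ : (Cub ℚ A B)ˣ} (hu₁ : u₁ ∈ Hg he d N) (hu₂ : u₂ ∈ Hg he d N) (h₁ : u₁ ∉ Sq A B) (h₂ : u₂ ∉ Sq A B)
    (h₃ : u₁ * u₂ ∉ Sq A B) :
    ∃ d' N', Adm A B d' N' ∧ 0 < d' ∧ Hg he d' N' ≤ Hg he d N ∧ (Hg he d' N').relIndex (Hg he d N) = 4 := by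
  obtain ⟨s₁, m₁, k₁, hk₁, hm₁, hsm₁, hsk₁, hsH₁⟩ := HH.integral he hu₁
  obtain ⟨s₂, m₂, k₂, hk₂, hm₂, hsm₂, hsk₂, hsH₂⟩ := HH.integral he hu₂
  have hsk₃ : Cub.map (Int.castRingHom ℚ) (s₁ * s₂) = ((u₁ * u₂ : (Cub ℚ A B)ˣ) : Cub ℚ A B) * (k₁ * k₂) ^ 2 := by
    rw [map_mul, hsk₁, hsk₂, Units.val_mul]; ring
  obtain ⟨p, _, hpN, hpm₁, hpm₂, hc, r, s, t, hsr, htr, hst, hsum, hrts, hall, hx₁, hx₂, hx₃⟩ :=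
    split_exists hfr hA.N0 hD hA.dis hA.two hm₁ hm₂ hsm₁ hsm₂ (not_sq h₁ hk₁ hsk₁) (not_sq h₂ hk₂ hsk₂) (not_sq h₃ (hk₁.mul hk₂) hsk₃)
  have key := fun {α} => kill_ram (α := α) he hf hA.N0 hA.two hA.dis hA.dvd (Or.inl rfl) hpN hc fun x hx => by
    rcases hall x (mem_rts.2 hx) with h | h
    exacts [⟨s₁, m₁, hsm₁, hpm₁, h, hsH₁⟩, ⟨s₂, m₂, hsm₂, hpm₂, h, hsH₂⟩]
  have hpD : ¬ (p : ℤ) ∣ Dis A B := fun h => hpN (Int.natCast_dvd_natCast.1 (h.trans hA.dis))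
  have hp2 : p ≠ 2 := fun h => hpN (h ▸ hA.two)
  have hpp : p.Prime := Fact.out
  obtain ⟨ρ, hρ, er⟩ := root_lift (mem_rts.1 (show r ∈ rts A B p by simp [hrts])) hpD
  obtain ⟨σ, hσ, es⟩ := root_lift (mem_rts.1 (show s ∈ rts A B p by simp [hrts])) hpD
  obtain ⟨τ, hτ, et⟩ := root_lift (mem_rts.1 (show t ∈ rts A B p by simp [hrts])) hpD
  have hσρ : σ ≠ ρ := fun h => hsr (by rw [← es, ← er, h])
  have hτρ : τ ≠ ρ := fun h => htr (by rw [← et, ← er, h])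
  have hστ : σ ≠ τ := fun h => hst (by rw [← es, ← et, h])
  have hsum' : (ρ : ℚ_[p]) + σ + τ = 0 := by
    have e1 : (σ - ρ) * (σ ^ 2 + σ * ρ + ρ ^ 2 + A) = 0 := by linear_combination hσ - hρ
    have e2 : (τ - ρ) * (τ ^ 2 + τ * ρ + ρ ^ 2 + A) = 0 := by linear_combination hτ - hρ
    have e3 := (mul_eq_zero.1 e1).resolve_left (sub_ne_zero.2 hσρ)
    have e4 := (mul_eq_zero.1 e2).resolve_left (sub_ne_zero.2 hτρ)
    have e5 : (σ - τ) * (ρ + σ + τ) = 0 := by linear_combination e3 - e4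
    exact_mod_cast congrArg (PadicInt.Coe.ringHom (p := p)) ((mul_eq_zero.1 e5).resolve_left (sub_ne_zero.2 hστ))
  have inj : ∀ {x y : ℤ_[p]}, x ≠ y → (x : ℚ_[p]) ≠ y := fun h h' => h (PadicInt.ext h')
  let χ : ℤ_[p] → (Cub ℚ A B)ˣ → Prop := fun ρ u => IsSquare (vl (ρ : ℚ_[p]) (Cub.map (algebraMap ℚ ℚ_[p]) (u : Cub ℚ A B)))
  have third : ∀ u ∈ Hg he d N, χ ρ u → χ σ u → χ τ u := by
    intro u hu h1 h2
    have hN := isSquare_map_N (F := ℚ_[p]) (HH.sq hu)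
    have hU : IsUnit (Cub.map (algebraMap ℚ ℚ_[p]) (u : Cub ℚ A B)) := u.isUnit.map _
    have n1 := vl_ne (coe_root hρ) hU
    have n2 := vl_ne (coe_root hσ) hU
    rw [prod_vl (coe_root hρ) (coe_root hσ) (inj hσρ) hsum'] at hN
    have := hN.div (h1.mul h2)
    rwa [mul_div_cancel_left₀ _ (mul_ne_zero n1 n2)] at this
  have xor : ∀ {ρ : ℤ_[p]}, ρ ^ 3 + A * ρ + B = 0 → ∀ {a}, a ∈ Hg he d N → ¬ χ ρ a → ∀ b ∈ Hg he d N, χ ρ (b * a) ↔ ¬ χ ρ b := by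
    intro ρ hρ a ha hna b hb
    have := QU.xor hp2 (UF.vl hρ (HH.unr hb p hpN)) (UF.vl hρ (HH.unr ha p hpN)) hna
    simp only [χ]
    rwa [Units.val_mul, map_mul, vl_mul (coe_root hρ)]
  have hle : Hg he (p * (1 * d)) (N * p) ≤ Hg he d N := fun v hv => (key hv).1
  have mem' : ∀ u ∈ Hg he d N, (u ∈ Hg he (p * (1 * d)) (N * p) ↔ χ ρ u ∧ χ σ u) := by
    intro u hu
    refine ⟨fun h => ⟨(key h).2 ρ hρ, (key h).2 σ hσ⟩, fun ⟨h1, h2⟩ => ?_⟩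
    have h3 := third u hu h1 h2
    refine ⟨HH.sq hu, HH.pos hu, fun l _ hl => ?_, fun l _ hl => HH.unr hu l fun h => hl (h.mul_right _)⟩
    rcases (Nat.Prime.dvd_mul Fact.out).1 hl with hl | hl
    · exact (loc_twist hpp hpN hA.N0 hA.two hl hc).2 (HH.loc hu l hl)
    · obtain rfl := (Nat.prime_dvd_prime_iff_eq Fact.out hpp).1 hl
      obtain ⟨w, hw⟩ := interp (coe_root hρ) (coe_root hσ) (coe_root hτ) (inj hσρ) (inj hτρ) (inj hστ) h1 h2 h3
      rw [Loc, hw, ← one_mul (w ^ 2)]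
      refine LocF.one.mul_sq ((isUnit_pow_iff two_ne_zero).1 ?_)
      rw [← hw]; exact u.isUnit.map _
  have lift : ∀ {u : (Cub ℚ A B)ˣ} {s : Cub ℤ A B} {k : Cub ℚ A B}, Cub.map (Int.castRingHom ℚ) s = u * k ^ 2 → ∀ {ρ : ℤ_[p]}, ρ ^ 3 + A * ρ + B = 0 →
      χ ρ u → IsSquare (evr (PadicInt.toZMod ρ) s) := by
    intro u s k hk ρ hρ h
    refine res_sq ?_
    rw [hk, map_mul, vl_mul (coe_root hρ), map_pow, vl_sq (coe_root hρ)]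
    exact h.mul (IsSquare.sq _)
  have two : ∀ {u : (Cub ℚ A B)ˣ} {s : Cub ℤ A B} {k : Cub ℚ A B}, Cub.map (Int.castRingHom ℚ) s = u * k ^ 2 → u ∈ Hg he d N →
      (∃ x ∈ rts A B p, ¬ IsSquare (evr x s)) → χ ρ u → ¬ χ σ u := by
    rintro u s k hk hu ⟨x, hx, hns⟩ h1 h2
    rw [hrts, Finset.mem_insert, Finset.mem_insert, Finset.mem_singleton] at hx
    rcases hx with rfl | rfl | rfl
    · exact hns (er ▸ lift hk hρ h1)
    · exact hns (es ▸ lift hk hσ h2)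
    · exact hns (et ▸ lift hk hτ (third u hu h1 h2))
  obtain ⟨a, ha, ha1, ha2⟩ : ∃ a ∈ Hg he d N, χ ρ a ∧ ¬ χ σ a := by
    by_cases c1 : χ ρ u₁
    · exact ⟨u₁, hu₁, c1, two hsk₁ hu₁ hx₁ c1⟩
    by_cases c2 : χ ρ u₂
    · exact ⟨u₂, hu₂, c2, two hsk₂ hu₂ hx₂ c2⟩
    have h3 := Subgroup.mul_mem _ hu₁ hu₂
    have c3 := (xor hρ hu₂ c2 u₁ hu₁).2 c1
    exact ⟨u₁ * u₂, h3, c3, two hsk₃ h3 hx₃ c3⟩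
  obtain ⟨b, hb, hb1⟩ : ∃ b ∈ Hg he d N, ¬ χ ρ b := by
    rcases hall r (by simp [hrts]) with h | h
    · exact ⟨u₁, hu₁, fun h' => h (er ▸ lift hsk₁ hρ h')⟩
    · exact ⟨u₂, hu₂, fun h' => h (er ▸ lift hsk₂ hρ h')⟩
  have i1 : (Hg he (p * (1 * d)) (N * p)).relIndex (Ks (Hg he d N) (coe_root hρ)) = 2 :=
    index2 (χ := χ σ) (fun u hu => (mem' u hu.1).trans (and_iff_right hu.2)) ⟨ha, ha1⟩ fun b hb => xor hσ ha ha2 b hb.1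
  have i2 : (Ks (Hg he d N) (coe_root hρ)).relIndex (Hg he d N) = 2 :=
    index2 (χ := χ ρ) (fun u hu => and_iff_right hu) hb (xor hρ hb hb1)
  refine ⟨_, _, hA.next hpp hpN (Or.inl rfl), by have := hpp.pos; positivity, hle, ?_⟩
  rw [← Subgroup.relIndex_mul_relIndex _ (Ks (Hg he d N) (coe_root hρ)) _ (fun u hu => ⟨hle hu, ((mem' u (hle hu)).1 hu).1⟩) fun u hu => hu.1, i1, i2]
theorem flip {e' f : ℝ} (he : e ^ 3 + A * e + B = 0) (he' : e' ^ 3 + A * e' + B = 0) (hf : f ^ 3 + A * f + B = 0) (h1 : e < e') (h2 : e' < f)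
    (hsum : e + e' + f = 0) (h2N : 2 ∣ N) {s : (Cub ℚ A B)ˣ} (hs : s ∈ Hg he d N) (hs' : vl e' (Cub.map (algebraMap ℚ ℝ) (s : Cub ℚ A B)) < 0) :
    Hg hf d N ≤ Hg he d N ∧ (Hg hf d N).relIndex (Hg he d N) = 2 := by
  have hprod : ∀ u : (Cub ℚ A B)ˣ, (∃ n : ℚ, n ≠ 0 ∧ (u : Cub ℚ A B).N = n ^ 2) → 0 < vl e (Cub.map (algebraMap ℚ ℝ) (u : Cub ℚ A B)) *
      vl e' (Cub.map (algebraMap ℚ ℝ) (u : Cub ℚ A B)) * vl f (Cub.map (algebraMap ℚ ℝ) (u : Cub ℚ A B)) := by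
    rintro u ⟨n, hn, h⟩
    rw [← prod_vl he he' h1.ne' hsum, Cub.N_map, h, map_pow]
    have : algebraMap ℚ ℝ n ≠ 0 := (map_ne_zero _).2 hn
    positivity
  have hne : ∀ u : (Cub ℚ A B)ˣ, vl f (Cub.map (algebraMap ℚ ℝ) (u : Cub ℚ A B)) ≠ 0 := fun u => vl_ne hf (u.isUnit.map _)
  have hsp := hprod s hs.sq
  have hsf : vl f (Cub.map (algebraMap ℚ ℝ) (s : Cub ℚ A B)) < 0 := by
    by_contra hc
    have := mul_nonneg hs.pos.le (not_lt.1 hc)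
    nlinarith
  have hle : Hg hf d N ≤ Hg he d N := by
    intro c hc
    refine ⟨hc.sq, ?_, hc.loc, hc.unr⟩
    by_contra hn
    have hn' : vl e (Cub.map (algebraMap ℚ ℝ) (c : Cub ℚ A B)) < 0 := lt_of_le_of_ne (not_lt.1 hn) (vl_ne he (c.isUnit.map _))
    have hcp := hprod c hc.sq
    have hce : vl e' (Cub.map (algebraMap ℚ ℝ) (c : Cub ℚ A B)) < 0 := by
      by_contra hc'
      have := mul_nonneg (not_lt.1 hc') hc.pos.le
      nlinarith
    refine flip_contra he he' hsum h1 h2 (α := (c : Cub ℚ A B) * (s : Cub ℚ A B)) ?_ ?_ ?_ (ob_real (isUnit_iff_ne_zero.1 (Cub.isUnit_iff.1 (c.isUnit.mul s.isUnit))) fun q _ => ?_)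
    · rw [map_mul, vl_mul he]; exact mul_neg_of_neg_of_pos hn' hs.pos
    · rw [map_mul, vl_mul he']; exact mul_pos_of_neg_of_neg hce hs'
    · rw [map_mul, vl_mul hf]; exact mul_neg_of_pos_of_neg hc.pos hsf
    · by_cases hq : q ∣ N
      · exact (Loc.mul hc.sq hs.sq (hc.loc q hq) (hs.loc q hq)).ob
      · exact UF.ob (fun h => hq (by rwa [h])) (by rw [map_mul]; exact (hc.unr q hq).mul (hs.unr q hq))
  refine ⟨hle, index2 (χ := fun u => 0 < vl f (Cub.map (algebraMap ℚ ℝ) (u : Cub ℚ A B)))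
    (fun u hu => ⟨fun h => HH.pos h, fun h => ⟨HH.sq hu, h, HH.loc hu, HH.unr hu⟩⟩) hs fun b hb => ?_⟩
  rw [Units.val_mul, map_mul, vl_mul hf, mul_pos_iff, not_lt]
  grind
end Ono

namespace Ono
open NumberField IsDedekindDomain nonZeroDivisors
theorem fin_index {G T : Type*} [CommGroup G] [Finite T] {H K : Subgroup G} (f : G → T)
    (hf : ∀ u ∈ K, ∀ v ∈ K, f u = f v → u * v⁻¹ ∈ H) : H.relIndex K ≠ 0 := by
  have : Finite (K ⧸ H.subgroupOf K) := by
    refine Finite.of_injective (fun q : K ⧸ H.subgroupOf K => f (q.out : K)) fun q r h => ?_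
    have := hf _ (SetLike.coe_mem _) _ (SetLike.coe_mem _) h.symm
    rw [← q.out_eq, ← r.out_eq]
    refine QuotientGroup.eq.2 ?_
    rw [Subgroup.mem_subgroupOf]
    push_cast
    rwa [mul_comm]
  exact Subgroup.index_ne_zero_of_finite
section
variable {K : Type*} [Field K] [NumberField K]
noncomputable def ct (v : HeightOneSpectrum (𝓞 K)) (u : Kˣ) : ℤ := FractionalIdeal.count K v (toPrincipalIdeal (𝓞 K) K u : FractionalIdeal (𝓞 K)⁰ K)
theorem ct_mul (v : HeightOneSpectrum (𝓞 K)) (u w : Kˣ) : ct v (u * w) = ct v u + ct v w := by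
  rw [ct, map_mul, Units.val_mul, FractionalIdeal.count_mul _ _ (Units.ne_zero _) (Units.ne_zero _)]; rfl
theorem ct_one (v : HeightOneSpectrum (𝓞 K)) : ct v (1 : Kˣ) = 0 := by
  rw [ct, map_one, Units.val_one, FractionalIdeal.count_one]
theorem ct_inv (v : HeightOneSpectrum (𝓞 K)) (u : Kˣ) : ct v u⁻¹ = - ct v u := by
  have := ct_mul v u u⁻¹
  rw [mul_inv_cancel, ct_one] at this
  linarith
theorem ideal_sqrt (u : Kˣ) (h : ∀ v : HeightOneSpectrum (𝓞 K), Even (ct v u)) :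
    ∃ J : (FractionalIdeal (𝓞 K)⁰ K)ˣ, J ^ 2 = toPrincipalIdeal (𝓞 K) K u := by
  choose c hc using h
  have key := FractionalIdeal.finprod_heightOneSpectrum_factorization' K (toPrincipalIdeal (𝓞 K) K u).ne_zero
  have fin := FractionalIdeal.finite_factors (toPrincipalIdeal (𝓞 K) K u : FractionalIdeal (𝓞 K)⁰ K)
  have hs : (Function.mulSupport fun v : HeightOneSpectrum (𝓞 K) => (v.asIdeal : FractionalIdeal (𝓞 K)⁰ K) ^ c v).Finite := by
    refine (Filter.eventually_cofinite.1 fin).subset fun v hv h0 => hv ?_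
    have : c v = 0 := by have := hc v; rw [ct, h0] at this; lia
    simp [this]
  have e : (∏ᶠ v : HeightOneSpectrum (𝓞 K), (v.asIdeal : FractionalIdeal (𝓞 K)⁰ K) ^ c v) ^ 2 = toPrincipalIdeal (𝓞 K) K u := by
    rw [finprod_pow hs, ← key]
    refine finprod_congr fun v => ?_
    rw [← zpow_natCast, ← zpow_mul]
    congr 1
    have := hc v; rw [ct] at this; grind
  have h0 : (∏ᶠ v : HeightOneSpectrum (𝓞 K), (v.asIdeal : FractionalIdeal (𝓞 K)⁰ K) ^ c v) ≠ 0 := fun h0 => by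
    rw [h0] at e
    exact (toPrincipalIdeal (𝓞 K) K u).ne_zero (by rw [← e]; simp)
  exact ⟨Units.mk0 _ h0, Units.ext (by simpa using e)⟩
theorem unit_of_ideal {u : Kˣ} (h : toPrincipalIdeal (𝓞 K) K u = 1) :
    ∃ t : (𝓞 K)ˣ, Units.map (algebraMap (𝓞 K) K).toMonoidHom t = u := by
  have key : ∀ u : Kˣ, toPrincipalIdeal (𝓞 K) K u = 1 → ∃ t : 𝓞 K, algebraMap (𝓞 K) K t = u := fun u h => by
    rw [toPrincipalIdeal_eq_iff, Units.val_one] at h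
    have := FractionalIdeal.mem_spanSingleton_self (𝓞 K)⁰ (u : K)
    rw [h, FractionalIdeal.mem_one_iff] at this
    exact this
  obtain ⟨t, ht⟩ := key u h
  obtain ⟨s, hs⟩ := key u⁻¹ (by rw [map_inv, h, inv_one])
  have : t * s = 1 := RingOfIntegers.ext (by
    change algebraMap (𝓞 K) K (t * s) = algebraMap (𝓞 K) K 1
    rw [map_mul, map_one, ht, hs, Units.mul_inv])
  exact ⟨⟨t, s, this, by rw [mul_comm, this]⟩, Units.ext ht⟩
theorem fin_gen {N : ℕ} (hN : N ≠ 0) (G : Subgroup Kˣ)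
    (hG : ∀ u ∈ G, ∀ v : HeightOneSpectrum (𝓞 K), (N : 𝓞 K) ∉ v.asIdeal → Even (ct v u)) :
    (powMonoidHom 2 : Kˣ →* Kˣ).range.relIndex G ≠ 0 := by
  classical
  let H1 : Subgroup Kˣ :=
    { carrier := {u | ∀ v : HeightOneSpectrum (𝓞 K), Even (ct v u)}
      one_mem' := fun v => by rw [ct_one]; exact Even.zero
      mul_mem' := fun h h' v => by rw [ct_mul]; exact (h v).add (h' v)
      inv_mem' := fun h v => by rw [ct_inv]; exact (h v).neg }
  let H2 : Subgroup Kˣ :=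
    { carrier := {u | ∃ w : Kˣ, toPrincipalIdeal (𝓞 K) K u = toPrincipalIdeal (𝓞 K) K w ^ 2}
      one_mem' := ⟨1, by simp⟩
      mul_mem' := fun ⟨a, h⟩ ⟨b, h'⟩ => ⟨a * b, by rw [map_mul, h, h', map_mul, mul_pow]⟩
      inv_mem' := fun ⟨a, h⟩ => ⟨a⁻¹, by rw [map_inv, h, map_inv, inv_pow]⟩ }
  have hN' : Ideal.span {(N : 𝓞 K)} ≠ 0 := by simpa using hN
  have hfin : Finite {v : HeightOneSpectrum (𝓞 K) // (N : 𝓞 K) ∈ v.asIdeal} := by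
    have := Ideal.finite_factors hN'
    simp only [Ideal.dvd_span_singleton] at this
    exact this
  have h1 : H1.relIndex G ≠ 0 := by
    refine fin_index (fun u => fun v : {v : HeightOneSpectrum (𝓞 K) // (N : 𝓞 K) ∈ v.asIdeal} => decide (Even (ct v.1 u))) ?_
    intro u hu w hw h v
    by_cases hv : (N : 𝓞 K) ∈ v.asIdeal
    · have := congrFun h ⟨v, hv⟩
      simp only [decide_eq_decide] at this
      rw [ct_mul, ct_inv, Int.even_add, even_neg]
      exact this
    · exact hG _ (G.mul_mem hu (G.inv_mem hw)) v hv
  have h2 : H2.relIndex H1 ≠ 0 := by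
    have hJ : ∀ u : Kˣ, ∃ J : (FractionalIdeal (𝓞 K)⁰ K)ˣ, u ∈ H1 → J ^ 2 = toPrincipalIdeal (𝓞 K) K u := fun u => by
      by_cases hu : u ∈ H1
      · obtain ⟨J, hJ⟩ := ideal_sqrt u hu; grind
      · exact ⟨1, fun h => absurd h hu⟩
    choose J hJ using hJ
    refine fin_index (fun u => ClassGroup.mk K (J u)) ?_
    intro u hu w hw h
    have h' : ClassGroup.mk K (J u * (J w)⁻¹) = 1 := by rw [map_mul, map_inv]; exact mul_inv_eq_one.2 h
    rw [ClassGroup.mk_eq_one_iff, FractionalIdeal.isPrincipal_iff] at h'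
    obtain ⟨x, hx⟩ := mem_principal_ideals_iff.2 (h'.imp fun _ h => h.symm)
    exact ⟨x, by rw [hx, mul_pow, inv_pow, hJ u hu, hJ w hw, map_mul, map_inv]⟩
  have h3 : (powMonoidHom 2 : Kˣ →* Kˣ).range.relIndex H2 ≠ 0 := by
    have hJ : ∀ u : Kˣ, ∃ (w : Kˣ) (t : (𝓞 K)ˣ), u ∈ H2 → u = w ^ 2 * Units.map (algebraMap (𝓞 K) K).toMonoidHom t := fun u => by
      by_cases hu : u ∈ H2
      · obtain ⟨w, hw⟩ := hu
        obtain ⟨t, ht⟩ := unit_of_ideal (u := u * (w ^ 2)⁻¹) (by rw [map_mul, map_inv, map_pow, hw, mul_inv_cancel])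
        exact ⟨w, t, fun _ => by rw [ht, mul_comm, inv_mul_cancel_right]⟩
      · exact ⟨1, 1, fun h => absurd h hu⟩
    choose w t hJ using hJ
    have : Group.FG (𝓞 K)ˣ := Group.fg_iff_monoid_fg.2 inferInstance
    have := Subgroup.finiteIndex_range_powMonoidHom_of_fg (𝓞 K)ˣ two_ne_zero
    have := Subgroup.finiteIndex_iff_finite_quotient.1 this
    refine fin_index (fun u => (t u : (𝓞 K)ˣ ⧸ (powMonoidHom 2 : (𝓞 K)ˣ →* (𝓞 K)ˣ).range)) ?_
    intro u hu v hv h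
    obtain ⟨s, hs⟩ := QuotientGroup.eq.1 h
    refine ⟨w u * (w v)⁻¹ * (Units.map (algebraMap (𝓞 K) K).toMonoidHom s)⁻¹, ?_⟩
    conv_rhs => rw [hJ u hu, hJ v hv]
    have : t v = t u * s ^ 2 := by rw [eq_comm, ← eq_inv_mul_iff_mul_eq]; exact hs
    rw [powMonoidHom_apply, this, map_mul, map_pow, mul_pow, mul_pow, inv_pow, inv_pow, mul_inv, mul_inv]
    generalize Units.map (algebraMap (𝓞 K) K).toMonoidHom (t u) = a
    rw [mul_mul_mul_comm, mul_inv_cancel_left, mul_assoc]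
  exact Subgroup.relIndex_ne_zero_trans (Subgroup.relIndex_ne_zero_trans h3 h2) h1
end
end Ono

namespace Ono
open NumberField IsDedekindDomain nonZeroDivisors
variable {A B : ℤ}
theorem norm_le_of_lt {p : ℕ} [Fact p.Prime] {x y : ℚ_[p]} (h : ‖x - y‖ < 1) (hy : ‖y‖ ≤ 1) : ‖x‖ ≤ 1 := by
  have := Padic.nonarchimedean (x - y) y
  rw [sub_add_cancel] at this
  grind
theorem UF.rat {l : ℕ} [Fact l.Prime] {α : Cub ℚ A B} (h : UF (Cub.map (algebraMap ℚ ℚ_[l]) α)) :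
    ∃ (z : Cub ℚ A B) (m : ℕ) (s : Cub ℤ A B), ¬ l ∣ m ∧ ¬ (l : ℤ) ∣ s.N ∧ Cub.map (Int.castRingHom ℚ) s = m * (α * z ^ 2) := by
  obtain ⟨z, hz, u, hu, e⟩ := h
  set β := Cub.map (algebraMap ℚ ℚ_[l]) α with hβ
  let Φ : ℚ_[l] × ℚ_[l] × ℚ_[l] → Cub ℚ_[l] A B := fun t => β * (⟨t.1, t.2.1, t.2.2⟩ : Cub ℚ_[l] A B) ^ 2
  have ca : Continuous fun t => (Φ t).a := by simp only [Φ, pow_two, Cub.mul_a, Cub.mul_b, Cub.mul_c]; fun_prop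
  have cb : Continuous fun t => (Φ t).b := by simp only [Φ, pow_two, Cub.mul_a, Cub.mul_b, Cub.mul_c]; fun_prop
  have cc : Continuous fun t => (Φ t).c := by simp only [Φ, pow_two, Cub.mul_a, Cub.mul_b, Cub.mul_c]; fun_prop
  have cN : Continuous fun t => (Φ t).N := by simp only [Cub.N]; fun_prop
  have hd : DenseRange (Prod.map (Rat.cast : ℚ → ℚ_[l]) (Prod.map (Rat.cast : ℚ → ℚ_[l]) (Rat.cast : ℚ → ℚ_[l]))) :=
    (Padic.denseRange_ratCast l).prodMap ((Padic.denseRange_ratCast l).prodMap (Padic.denseRange_ratCast l))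
  have ez : Φ (z.a, z.b, z.c) = inc u := e
  have hO : ∀ g : ℚ_[l] × ℚ_[l] × ℚ_[l] → ℚ_[l], Continuous g → IsOpen {t | ‖g t - g (z.a, z.b, z.c)‖ < 1} := fun g hg =>
    isOpen_lt (by fun_prop) continuous_const
  obtain ⟨⟨x, y, w⟩, ⟨⟨h1, h2⟩, h3⟩, h4⟩ := hd.exists_mem_open ((((hO _ ca).inter (hO _ cb)).inter (hO _ cc)).inter (hO _ cN))
    ⟨(z.a, z.b, z.c), by simp⟩
  simp only [Set.mem_ofPred_eq, ez] at h1 h2 h3 h4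
  set z0 : Cub ℚ A B := ⟨x, y, w⟩
  have e0 : Φ (Prod.map (Rat.cast : ℚ → ℚ_[l]) (Prod.map (Rat.cast : ℚ → ℚ_[l]) (Rat.cast : ℚ → ℚ_[l])) (x, y, w)) = Cub.map (algebraMap ℚ ℚ_[l]) (α * z0 ^ 2) := by
    rw [map_mul, map_pow]; rfl
  rw [e0] at h1 h2 h3 h4
  set γ := α * z0 ^ 2
  have i1 := PadicInt.isUnit_den _ (norm_le_of_lt h1 (u.a).2)
  have i2 := PadicInt.isUnit_den _ (norm_le_of_lt h2 (u.b).2)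
  have i3 := PadicInt.isUnit_den _ (norm_le_of_lt h3 (u.c).2)
  have hm : IsUnit ((γ.a.den * γ.b.den * γ.c.den : ℕ) : ℤ_[l]) := by push_cast; exact (i1.mul i2).mul i3
  let s : Cub ℤ A B := ⟨γ.a.num * γ.b.den * γ.c.den, γ.a.den * γ.b.num * γ.c.den, γ.a.den * γ.b.den * γ.c.num⟩
  have hs : Cub.map (Int.castRingHom ℚ) s = (γ.a.den * γ.b.den * γ.c.den : ℕ) * γ := by
    have e1 := Rat.mul_den_eq_num γ.a
    have e2 := Rat.mul_den_eq_num γ.b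
    have e3 := Rat.mul_den_eq_num γ.c
    ext <;> simp only [s, Cub.map_a, Cub.map_b, Cub.map_c, Cub.mul_a, Cub.mul_b, Cub.mul_c, Cub.natCast_a, Cub.natCast_b, Cub.natCast_c, eq_intCast] <;> push_cast
    · linear_combination -(γ.b.den * γ.c.den : ℚ) * e1
    · linear_combination -(γ.a.den * γ.c.den : ℚ) * e2
    · linear_combination -(γ.a.den * γ.b.den : ℚ) * e3
  refine ⟨z0, γ.a.den * γ.b.den * γ.c.den, s, ?_, ?_, hs⟩
  · intro hl
    rw [PadicInt.isUnit_iff] at hm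
    have := PadicInt.norm_int_lt_one_iff_dvd (p := l) ((γ.a.den * γ.b.den * γ.c.den : ℕ) : ℤ)
    rw [Int.cast_natCast, hm] at this
    simpa using this.2 (by exact_mod_cast hl)
  · intro hl
    have hu1 : ‖u.N‖ = 1 := PadicInt.isUnit_iff.1 (Cub.isUnit_iff.1 hu)
    have hN := congrArg Cub.N hs
    rw [Cub.N_map, Cub.N_mul, ← map_natCast (Cub.of A B), Cub.N_of] at hN
    have hN' := congrArg (fun t : ℚ => ‖(t : ℚ_[l])‖) hN
    have hm1 : ‖((γ.a.den * γ.b.den * γ.c.den : ℕ) : ℚ_[l])‖ = 1 := by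
      rw [← PadicInt.isUnit_iff.1 hm, PadicInt.norm_def, PadicInt.coe_natCast]
    simp only [eq_intCast, Rat.cast_intCast, Rat.cast_mul, Rat.cast_pow, Rat.cast_natCast, norm_mul, norm_pow, hm1, one_pow, one_mul] at hN'
    have h5 : ‖(γ.N : ℚ_[l])‖ < 1 := by rw [← hN']; exact (Padic.norm_intCast_lt_one_iff).2 hl
    rw [Cub.N_map, Cub.N_map, norm_sub_rev] at h4
    have := Padic.nonarchimedean ((PadicInt.Coe.ringHom u.N : ℚ_[l]) - (γ.N : ℚ_[l])) (γ.N : ℚ_[l])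
    rw [sub_add_cancel, show ‖(PadicInt.Coe.ringHom u.N : ℚ_[l])‖ = 1 from hu1] at this
    exact absurd this (not_le.2 (max_lt h4 h5))
section
variable {K : Type*} [Field K] [NumberField K]
theorem ct_zero {v : HeightOneSpectrum (𝓞 K)} {t : 𝓞 K} (h : t ∉ v.asIdeal) {x : Kˣ} (hx : algebraMap (𝓞 K) K t = x) : ct v x = 0 := by
  have ht : t ≠ 0 := fun h0 => h (h0 ▸ v.asIdeal.zero_mem)
  have hs : Ideal.span {t} ≠ 0 := by simpa using ht
  rw [ct, coe_toPrincipalIdeal, ← hx, ← FractionalIdeal.coeIdeal_span_singleton, FractionalIdeal.count_coe K v hs]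
  by_contra hc
  refine h (Ideal.dvd_span_singleton.1 ((Associates.count_ne_zero_iff_dvd hs v.irreducible).1 fun h0 => hc ?_))
  exact_mod_cast h0
theorem exists_l (v : HeightOneSpectrum (𝓞 K)) : ∃ l : ℕ, l.Prime ∧ (l : 𝓞 K) ∈ v.asIdeal := by
  classical
  have h0 : ∃ n : ℕ, n ≠ 0 ∧ (n : 𝓞 K) ∈ v.asIdeal :=
    ⟨_, fun h => v.ne_bot (Ideal.absNorm_eq_zero_iff.1 h), Ideal.absNorm_mem v.asIdeal⟩
  obtain ⟨h1, h2⟩ := Nat.find_spec h0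
  set n := Nat.find h0 with hn
  have hn1 : n ≠ 1 := fun h => v.isPrime.ne_top ((Ideal.eq_top_iff_one _).2 (by rw [h] at h2; simpa using h2))
  refine ⟨n.minFac, Nat.minFac_prime hn1, ?_⟩
  obtain ⟨m, hm⟩ := n.minFac_dvd
  rw [hm] at h2; push_cast at h2
  refine (v.isPrime.mem_or_mem h2).resolve_right fun h3 => ?_
  have hm0 : m ≠ 0 := fun h => h1 (by rw [hm, h, mul_zero])
  have := Nat.find_min' h0 ⟨hm0, h3⟩
  have h4 := (Nat.minFac_prime hn1).two_le
  rw [← hn] at this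
  nlinarith [Nat.pos_of_ne_zero hm0]
end
theorem Hg_fin (hf : ∀ x : ℚ, x ^ 3 + A * x + B ≠ 0) {e : ℝ} (he : e ^ 3 + A * e + B = 0) {d : ℤ} {N : ℕ} (hN : N ≠ 0) :
    (Sq A B).relIndex (Hg he d N) ≠ 0 := by
  letI := cubField hf
  haveI := cub_numberField hf
  refine fin_gen (K := Cub ℚ A B) hN (Hg he d N) fun u hu v hv => ?_
  obtain ⟨l, hl, hlv⟩ := exists_l v
  haveI : Fact l.Prime := ⟨hl⟩
  have hcop : ∀ n : ℤ, ¬ (l : ℤ) ∣ n → (n : 𝓞 (Cub ℚ A B)) ∉ v.asIdeal := fun n hn hm => by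
    obtain ⟨a, b, h⟩ := (Nat.prime_iff_prime_int.1 hl).coprime_iff_not_dvd.2 hn
    refine v.isPrime.ne_top ((Ideal.eq_top_iff_one _).2 ?_)
    have := congrArg (Int.cast : ℤ → 𝓞 (Cub ℚ A B)) h
    push_cast at this
    rw [← this]
    exact v.asIdeal.add_mem (v.asIdeal.mul_mem_left _ hlv) (v.asIdeal.mul_mem_left _ hm)
  have hlN : ¬ l ∣ N := fun ⟨k, hk⟩ => hv (by rw [hk]; push_cast; exact v.asIdeal.mul_mem_right _ hlv)
  obtain ⟨z, m, s, h1, h2, h3⟩ := UF.rat (hu.unr l hlN)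
  have ho := cub_ord hf
  let t : 𝓞 (Cub ℚ A B) := ⟨_, ho.int s⟩
  let t' : 𝓞 (Cub ℚ A B) := ⟨_, ho.int s.adj⟩
  have ht : t ∉ v.asIdeal := fun h => hcop s.N h2 (by
    have : t * t' = (s.N : 𝓞 (Cub ℚ A B)) := RingOfIntegers.ext (by
      change Cub.map (Int.castRingHom ℚ) s * Cub.map (Int.castRingHom ℚ) s.adj = _
      rw [← map_mul, Cub.mul_adj, Cub.map_of]
      simp)
    rw [← this]; exact v.asIdeal.mul_mem_right _ h)
  have hm := hcop m (by exact_mod_cast h1)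
  have hs0 : Cub.map (Int.castRingHom ℚ) s ≠ 0 := fun h0 => ht (by
    have : t = 0 := RingOfIntegers.ext h0
    rw [this]; exact v.asIdeal.zero_mem)
  have hz0 : z ≠ 0 := fun h0 => hs0 (by rw [h3, h0]; ring)
  have hm0 : (m : Cub ℚ A B) ≠ 0 := fun h0 => hs0 (by rw [h3, h0, zero_mul])
  have key : Units.mk0 _ hs0 = Units.mk0 _ hm0 * (u * (Units.mk0 z hz0 * Units.mk0 z hz0)) := Units.ext (by
    rw [Units.val_mul, Units.val_mul, Units.val_mul, Units.val_mk0, h3, pow_two]; rfl)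
  have k1 := ct_zero ht (x := Units.mk0 _ hs0) rfl
  have k2 := ct_zero hm (x := Units.mk0 _ hm0) (by simp)
  rw [key, ct_mul, ct_mul, ct_mul, k2] at k1
  grind
end Ono

namespace Ono
variable {A B : ℤ} {e : ℝ} {d : ℤ} {N : ℕ}
theorem point_HH {D : ℤ} {X Y : ℚ} (h : Y ^ 2 = X ^ 3 + D ^ 2 * A * X + D ^ 3 * B) (hY : Y ≠ 0) (hpos : 0 < (X : ℝ) - D * e)
    (hloc : ∀ (l : ℕ) [Fact l.Prime], l ∣ N → ∀ α : Cub ℚ A B, Loc ℚ_[l] D α → Loc ℚ_[l] d α)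
    (hunr : ∀ (l : ℕ) [Fact l.Prime], ¬ l ∣ N → (¬ (l : ℤ) ∣ Dis A B ∧ ¬ (l : ℤ) ∣ D) ∨
      ((l : ℤ) ∣ D ∧ ¬ (l : ℤ) * l ∣ D ∧ ∀ r : ZMod l, r ^ 3 + A * r + B ≠ 0)) :
    HH d e N (Cub.of A B X - Cub.of A B (D : ℚ) * Cub.θ) where
  sq := ⟨Y, hY, by rw [h]; simp [Cub.N]; ring⟩
  pos := by simp only [vl, Cub.map_a, Cub.map_b, Cub.map_c]; simpa using hpos
  loc l _ hl := hloc l hl _ ⟨X, 1, isUnit_one, by simp [Cub.map_of, Cub.map_θ]⟩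
  unr l _ hl := by
    have := UF.point (A := A) (B := B) (p := l) (X := X) (Y := Y) (D := D) (by exact_mod_cast congrArg (Rat.cast : ℚ → ℚ_[l]) h) (by exact_mod_cast hY) (hunr l hl)
    simpa [Cub.map_of, Cub.map_θ] using this
theorem sqf_part {q : ℚ} (hq : 0 < q) : ∃ (d : ℤ) (w : ℚ), 0 < d ∧ Squarefree d ∧ w ≠ 0 ∧ q = d * w ^ 2 := by
  obtain ⟨a, b, h, hs⟩ := Nat.sq_mul_squarefree (q.num.toNat * q.den)
  have hn : (q.num.toNat : ℤ) = q.num := Int.toNat_of_nonneg (Rat.num_nonneg.2 hq.le)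
  have h' : (b : ℚ) ^ 2 * a = q.num * q.den := by rw [← hn]; exact_mod_cast h
  have hd : (q.den : ℚ) ≠ 0 := by exact_mod_cast q.den_ne_zero
  have e : q = (a : ℤ) * (b / q.den) ^ 2 := by
    have := Rat.mul_den_eq_num q
    push_cast; grind
  refine ⟨a, b / q.den, ?_, Int.squarefree_natCast.2 hs, ?_, e⟩
  · exact_mod_cast Nat.pos_of_ne_zero hs.ne_zero
  grind
theorem roots_pos (hD : 0 < Dis A B) : ∃ e₁ e₂ e₃ : ℝ, e₁ < e₂ ∧ e₂ < e₃ ∧ e₁ + e₂ + e₃ = 0 ∧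
    (∀ x : ℝ, x ^ 3 + A * x + B = (x - e₁) * (x - e₂) * (x - e₃)) := by
  have hD' : (0 : ℝ) < -4 * A ^ 3 - 27 * B ^ 2 := by rw [Dis] at hD; exact_mod_cast hD
  have hA : (A : ℝ) < 0 := by
    by_contra h; push Not at h
    have : (0 : ℝ) ≤ A ^ 3 := pow_nonneg h 3
    nlinarith [sq_nonneg (B : ℝ)]
  obtain ⟨s, hs, hsA⟩ : ∃ s : ℝ, 0 < s ∧ (A : ℝ) = -3 * s ^ 2 := ⟨Real.sqrt (-A / 3), Real.sqrt_pos.2 (by linarith), by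
    grind⟩
  have hB : |(B : ℝ)| < 2 * s ^ 3 := by
    refine abs_lt_of_sq_lt_sq ?_ (by positivity)
    rw [hsA] at hD'; nlinarith
  obtain ⟨hB1, hB2⟩ := abs_lt.1 hB
  have hc : ContinuousOn (fun x : ℝ => x ^ 3 + A * x + B) (Set.Icc (-s) s) := by fun_prop
  obtain ⟨r, ⟨hr1, hr2⟩, hr⟩ := intermediate_value_Ioo' (by linarith : -s ≤ s) hc (show (0 : ℝ) ∈ Set.Ioo _ _ from
    ⟨by rw [hsA]; linarith, by rw [hsA]; linarith⟩)
  simp only at hr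
  have hr3 : r ^ 2 < s ^ 2 := sq_lt_sq.2 (by grind)
  obtain ⟨q, hq, hq2⟩ : ∃ q : ℝ, 0 ≤ q ∧ q ^ 2 = -3 * r ^ 2 - 4 * A := ⟨Real.sqrt (-3 * r ^ 2 - 4 * A), Real.sqrt_nonneg _,
    Real.sq_sqrt (by rw [hsA]; nlinarith)⟩
  have h3 : |3 * r| < q := abs_lt_of_sq_lt_sq (by grind) hq
  obtain ⟨h4, h5⟩ := abs_lt.1 h3
  refine ⟨(-r - q) / 2, r, (-r + q) / 2, by linarith, by linarith, by ring, fun x => ?_⟩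
  grind
theorem root_neg (hD : Dis A B < 0) : ∃ e : ℝ, 0 < 3 * e ^ 2 + A ∧ ∀ x : ℝ, ∃ t > 0, x ^ 3 + A * x + B = (x - e) * t := by
  have hD' : (-4 * A ^ 3 - 27 * B ^ 2 : ℝ) < 0 := by rw [Dis] at hD; exact_mod_cast hD
  set M : ℝ := 1 + |(A : ℝ)| + |(B : ℝ)| with hM
  have hA1 := neg_abs_le (A : ℝ)
  have hB1 := neg_abs_le (B : ℝ)
  have hA2 := le_abs_self (A : ℝ)
  have hB2 := le_abs_self (B : ℝ)
  have hA0 := abs_nonneg (A : ℝ)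
  have hB0 := abs_nonneg (B : ℝ)
  have hM1 : 1 ≤ M := by linarith
  have hMM : M ≤ M ^ 2 := by nlinarith
  have h0 : 0 ≤ M ^ 3 + A * M - |(B : ℝ)| := by nlinarith
  have hc : ContinuousOn (fun x : ℝ => x ^ 3 + A * x + B) (Set.Icc (-M) M) := by fun_prop
  obtain ⟨e, -, he⟩ := intermediate_value_Icc (by linarith : -M ≤ M) hc (show (0 : ℝ) ∈ Set.Icc _ _ from
    ⟨by nlinarith, by linarith⟩)
  simp only at he
  have hB : (B : ℝ) = -e ^ 3 - A * e := by linarith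
  have hq : 0 < 3 * e ^ 2 + 4 * A := by
    by_contra h; push Not at h
    rw [hB] at hD'
    nlinarith [mul_nonneg (sub_nonneg.2 h) (sq_nonneg (3 * e ^ 2 + A : ℝ))]
  refine ⟨e, by nlinarith [sq_nonneg e], fun x => ⟨x ^ 2 + e * x + e ^ 2 + A, by nlinarith [sq_nonneg (2 * x + e)], by rw [hB]; ring⟩⟩
theorem end_neg (hfr : ∀ x : ℚ, x ^ 3 + A * x + B ≠ 0) (he : e ^ 3 + A * e + B = 0) (hf : 0 < 3 * e ^ 2 + A) (hD : Dis A B < 0) :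
    ∀ n d N, Adm A B d N → (Sq A B).relIndex (Hg he d N) ≤ n → ∃ d N, Adm A B d N ∧ Hg he d N ≤ Sq A B := by
  intro n
  induction n with
  | zero => intro d N hA h; exact absurd (Nat.le_zero.1 h) (Hg_fin hfr he hA.N0)
  | succ n ih =>
    intro d N hA h
    by_cases hS : Hg he d N ≤ Sq A B
    · grind
    obtain ⟨d', N', hA', hlt⟩ := kill_transp hfr he hf hD hA hS
    refine ih d' N' hA' ?_
    have h1 := Subgroup.relIndex_mul_relIndex _ _ _ (Sq_le he (d := d') (N := N')) hlt.le
    have h2 := Hg_fin hfr he hA.N0 (d := d)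
    have h3 : (Hg he d' N').relIndex (Hg he d N) ≠ 1 := fun h => hlt.not_ge (Subgroup.relIndex_eq_one.1 h)
    rw [← h1] at h2 h
    have h4 := left_ne_zero_of_mul h2
    have h5 := right_ne_zero_of_mul h2
    have h6 : 2 ≤ (Hg he d' N').relIndex (Hg he d N) := by lia
    have h7 := Nat.mul_le_mul_left ((Sq A B).relIndex (Hg he d' N')) h6
    lia
theorem end_pos (hfr : ∀ x : ℚ, x ^ 3 + A * x + B ≠ 0) (he : e ^ 3 + A * e + B = 0) (hf : 0 < 3 * e ^ 2 + A) (hD : Dis A B ≠ 0) :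
    ∀ n d N, Adm A B d N → 0 < d → (Sq A B).relIndex (Hg he d N) = 4 ^ n → ∃ d N, Adm A B d N ∧ 0 < d ∧ Hg he d N ≤ Sq A B := by
  intro n
  induction n with
  | zero => intro d N hA hd h; exact ⟨d, N, hA, hd, Subgroup.relIndex_eq_one.1 h⟩
  | succ n ih =>
    intro d N hA hd h
    have : ¬ Hg he d N ≤ Sq A B := fun h0 => by
      rw [Subgroup.relIndex_eq_one.2 h0, pow_succ] at h; lia
    obtain ⟨u, hu, hus⟩ := SetLike.not_le_iff_exists.1 this
    obtain ⟨v, hv, hvs, huv⟩ : ∃ v ∈ Hg he d N, v ∉ Sq A B ∧ u * v ∉ Sq A B := by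
      by_contra hc
      push Not at hc
      have := index2 (L := Sq A B) (K := Hg he d N) (χ := fun u => u ∈ Sq A B) (fun _ _ => Iff.rfl) hu fun b hb =>
        ⟨fun h1 h2 => hus ((Subgroup.mul_mem_cancel_left _ h2).1 h1), fun h1 => by grind⟩
      grind
    obtain ⟨d', N', hA', hd', hle, h4⟩ := kill_split hfr he hf hD hA hd hu hv hus hvs huv
    refine ih d' N' hA' hd' ?_
    have h1 := Subgroup.relIndex_mul_relIndex _ _ _ (Sq_le he (d := d') (N := N')) hle
    grind
theorem pow_two_index (hfr : ∀ x : ℚ, x ^ 3 + A * x + B ≠ 0) (he : e ^ 3 + A * e + B = 0) (hN : N ≠ 0) :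
    ∃ r, (Sq A B).relIndex (Hg he d N) = 2 ^ r := by
  have hp : IsPGroup 2 (Hg he d N ⧸ (Sq A B).subgroupOf (Hg he d N)) := fun q => ⟨1, by
    induction q using QuotientGroup.induction_on with
    | H z => exact (QuotientGroup.eq_one_iff _).2 ⟨z, by simp⟩⟩
  have := Hg_fin hfr he hN (d := d)
  haveI : Finite (Hg he d N ⧸ (Sq A B).subgroupOf (Hg he d N)) := by
    haveI : ((Sq A B).subgroupOf (Hg he d N)).FiniteIndex := ⟨this⟩
    infer_instance
  exact IsPGroup.iff_card.1 hp
end Ono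

namespace Ono
variable {A B : ℤ}
theorem Adm.start {d : ℤ} (hd : Squarefree d) (hD : Dis A B ≠ 0) : Adm A B d (2 * (Dis A B).natAbs * d.natAbs) where
  N0 := by simp [hD, hd.ne_zero]
  two := ⟨_, mul_assoc _ _ _⟩
  dis := by push_cast; exact (((dvd_abs _ _).2 dvd_rfl).mul_left _).mul_right _
  dvd := by push_cast; exact ((dvd_abs _ _).2 dvd_rfl).mul_left _
  sqf := hd
theorem Adm.unr {d : ℤ} {N l : ℕ} (h : Adm A B d N) (hl : ¬ l ∣ N) : ¬ (l : ℤ) ∣ Dis A B ∧ ¬ (l : ℤ) ∣ d :=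
  ⟨fun h1 => hl (by exact_mod_cast h1.trans h.dis), fun h1 => hl (by exact_mod_cast h1.trans h.dvd)⟩
theorem mul3 {a b c : ℝ} (ha : a ≤ 0) (hb : b ≤ 0) (hc : c ≤ 0) : a * b * c ≤ 0 :=
  mul_nonpos_of_nonneg_of_nonpos (mul_nonneg_of_nonpos_of_nonpos ha hb) hc
theorem sel (hfr : ∀ x : ℚ, x ^ 3 + A * x + B ≠ 0) (hD : Dis A B ≠ 0) :
    ∃ (e : ℝ) (he : e ^ 3 + A * e + B = 0) (d : ℤ) (N : ℕ) (η : ℤ), (η = 1 ∨ (0 < Dis A B ∧ η = -1)) ∧ Adm A B d N ∧ Hg he d N ≤ Sq A B ∧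
      ∀ D : ℤ, 0 < D * (η * d) → ∀ X Y : ℝ, Y ≠ 0 → Y ^ 2 = X ^ 3 + D ^ 2 * A * X + D ^ 3 * B → 0 < X - D * e := by
  rcases lt_or_gt_of_ne hD with hD1 | hD1
  · obtain ⟨e, hf, ht⟩ := root_neg hD1
    have he : e ^ 3 + A * e + B = 0 := by obtain ⟨t, -, h⟩ := ht e; grind
    obtain ⟨d, N, hA, hS⟩ := end_neg hfr he hf hD1 _ _ _ (Adm.start (d := 1) squarefree_one hD) le_rfl
    refine ⟨e, he, d, N, 1, Or.inl rfl, hA, hS, fun D hDd X Y hY h => ?_⟩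
    have hD0 : (D : ℝ) ≠ 0 := by rintro h0; rw [Int.cast_eq_zero] at h0; simp [h0] at hDd
    obtain ⟨t, ht0, ht⟩ := ht (X / D)
    have h1 : Y ^ 2 = (D ^ 2 * t) * (X - D * e) := by
      grind
    exact pos_of_mul_pos_right (by rw [← h1]; positivity) (by positivity : (0 : ℝ) ≤ D ^ 2 * t)
  · obtain ⟨e₁, e₂, e₃, h12, h23, hsum, hx⟩ := roots_pos hD1
    have r1 : e₁ ^ 3 + A * e₁ + B = 0 := by rw [hx]; ring
    have r2 : e₂ ^ 3 + A * e₂ + B = 0 := by rw [hx]; ring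
    have r3 : e₃ ^ 3 + A * e₃ + B = 0 := by rw [hx]; ring
    obtain ⟨vA, -, v3⟩ := vieta r1 r2 h12.ne' hsum
    have f1 : 0 < 3 * e₁ ^ 2 + A := by
      have := mul_pos (sub_pos.2 h12) (sub_pos.2 (h12.trans h23)); rw [v3] at this; rw [vA]; linarith
    have f3 : 0 < 3 * e₃ ^ 2 + A := by
      have := mul_pos (sub_pos.2 h23) (sub_pos.2 (h12.trans h23)); rw [v3] at this; rw [vA, v3]; linarith
    have hF : ∀ D X : ℝ, X ^ 3 + D ^ 2 * A * X + D ^ 3 * B = (X - D * e₁) * (X - D * e₂) * (X - D * e₃) := fun D X => by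
      grind
    obtain ⟨x, hx1, hx2⟩ := exists_rat_btwn h12
    have hpos : 0 < x ^ 3 + A * x + B := by
      have h1 := hx x
      have : (0 : ℝ) < (x - e₁) * (x - e₂) * (x - e₃) := by
        rw [mul_assoc]
        exact mul_pos (by linarith) (mul_pos_of_neg_of_neg (by linarith) (by linarith))
      rw [← h1] at this; exact_mod_cast this
    obtain ⟨d, w, hd, hds, hw, hdw⟩ := sqf_part hpos
    have hA := Adm.start hds hD
    set N := 2 * (Dis A B).natAbs * d.natAbs
    have hdR : (0 : ℝ) < d := by exact_mod_cast hd
    have hH : HH d e₁ N (Cub.of A B (d * x) - Cub.of A B (d : ℚ) * Cub.θ) := by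
      refine point_HH (Y := d ^ 2 * w) ?_ (by positivity) ?_ (fun _ _ _ _ h => h) fun l _ hl => Or.inl (hA.unr hl)
      · grind
      · push_cast; rw [← mul_sub]; exact mul_pos hdR (by linarith)
    obtain ⟨u, hu⟩ := hH.isUnit
    obtain ⟨r, hr⟩ := pow_two_index hfr r1 hA.N0 (d := d)
    rcases Nat.even_or_odd' r with ⟨k, rfl | rfl⟩
    · obtain ⟨d', N', hA', hd', hS⟩ := end_pos hfr r1 f1 hD k d N hA hd (by rw [hr, pow_mul]; norm_num)
      refine ⟨e₁, r1, d', N', 1, Or.inl rfl, hA', hS, fun D hDd X Y hY h => ?_⟩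
      have hD0 : (0 : ℝ) < D := by rw [one_mul] at hDd; exact_mod_cast pos_of_mul_pos_left hDd hd'.le
      by_contra hc; push Not at hc
      have h1 := mul_lt_mul_of_pos_left h12 hD0
      have h2 := mul_lt_mul_of_pos_left h23 hD0
      have := mul3 hc (by linarith : X - D * e₂ ≤ 0) (by linarith : X - D * e₃ ≤ 0)
      rw [← hF, ← h] at this
      exact absurd this (not_le.2 (by positivity))
    · obtain ⟨hle, h2⟩ := flip (d := d) r1 r2 r3 h12 h23 hsum hA.two (s := u) (by rw [mem_Hg, hu]; exact hH) (by
        rw [hu]; simp only [vl, Cub.map_a, Cub.map_b, Cub.map_c]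
        have := mul_lt_mul_of_pos_left hx2 hdR
        simp; linarith)
      have h1 := Subgroup.relIndex_mul_relIndex _ _ _ (Sq_le r3) hle
      rw [hr, h2, pow_succ, pow_mul] at h1
      obtain ⟨d', N', hA', hd', hS⟩ := end_pos hfr r3 f3 hD k d N hA hd (by simpa using h1)
      refine ⟨e₃, r3, d', N', -1, Or.inr ⟨hD1, rfl⟩, hA', hS, fun D hDd X Y hY h => ?_⟩
      have hD0 : (D : ℝ) < 0 := by
        have : D * d' < 0 := by linarith
        exact_mod_cast neg_of_mul_neg_left this hd'.le
      by_contra hc; push Not at hc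
      have h1 := mul_lt_mul_of_neg_left h12 hD0
      have h2 := mul_lt_mul_of_neg_left h23 hD0
      have := mul3 (by linarith : X - D * e₁ ≤ 0) (by linarith : X - D * e₂ ≤ 0) hc
      rw [← hF, ← h] at this
      exact absurd this (not_le.2 (by positivity))
end Ono

namespace Ono
variable {A B : ℤ} {d : ℤ} {N : ℕ}
structure Tw (A B d : ℤ) (N : ℕ) (D : ℤ) : Prop where
  sqf : Squarefree D
  loc : ∀ (l : ℕ) [Fact l.Prime], l ∣ N → ∀ α : Cub ℚ A B, Loc ℚ_[l] D α → Loc ℚ_[l] d α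
  unr : ∀ (l : ℕ) [Fact l.Prime], ¬ l ∣ N → (l : ℤ) ∣ D → ∀ r : ZMod l, r ^ 3 + A * r + B ≠ 0
theorem Tw.next {D : ℤ} (hA : Adm A B d N) (h : Tw A B d N D) {η : ℤ} {p : ℕ} (hη : η = 1 ∨ η = -1) (hp : Inert A B η N p)
    (hpD : ¬ (p : ℤ) ∣ D) : Tw A B d N (p * (η * D)) := by
  obtain ⟨pp, hpN, hc, hnf⟩ := hp
  have hu : IsUnit η := Int.isUnit_iff.2 hη
  refine ⟨?_, fun l _ hl α hα => h.loc l hl α ((loc_twist pp hpN hA.N0 hA.two hl hc).1 hα), fun l hl hlN hlD => ?_⟩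
  · have hp' := Nat.prime_iff_prime_int.1 pp
    rw [squarefree_mul_iff]
    refine ⟨(hp'.irreducible.coprime_iff_not_dvd.2 fun h => hpD ?_).isRelPrime, hp'.irreducible.squarefree, ?_⟩
    · exact (hu.dvd_mul_left).1 h
    · rcases hη with rfl | rfl
      · simpa using h.sqf
      · exact fun x hx => h.sqf x (by simpa using hx)
  · rcases (Nat.prime_iff_prime_int.1 hl.out).dvd_or_dvd hlD with h1 | h1
    · obtain rfl := (Nat.prime_dvd_prime_iff_eq hl.out pp).1 (by exact_mod_cast h1)
      intro r hr
      rw [nf_eq, Finset.card_eq_zero] at hnf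
      have := mem_rts.2 hr
      grind
    · exact h.unr l hlN ((hu.dvd_mul_left).1 h1)
theorem Tw.fin {e : ℝ} {he : e ^ 3 + A * e + B = 0} {D : ℤ} (hfr : ∀ x : ℚ, x ^ 3 + A * x + B ≠ 0) (hD : Dis A B ≠ 0) (hA : Adm A B d N)
    (hS : Hg he d N ≤ Sq A B) (hpos : ∀ X Y : ℝ, Y ≠ 0 → Y ^ 2 = X ^ 3 + D ^ 2 * A * X + D ^ 3 * B → 0 < X - D * e) (h : Tw A B d N D) :
    {X : ℚ | ∃ Y, Y ^ 2 = X ^ 3 + D ^ 2 * A * X + D ^ 3 * B}.Finite := by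
  refine finite_of_image_trivial (fun h0 => hD (by rw [Dis]; linarith)) hfr h.sqf.ne_zero fun X Y hXY => ?_
  have hD0 : (D : ℚ) ≠ 0 := by exact_mod_cast h.sqf.ne_zero
  have hY : Y ≠ 0 := fun h0 => hfr (X / D) (by
    grind)
  have hH : HH d e N (Cub.of A B X - Cub.of A B (D : ℚ) * Cub.θ) := by
    refine point_HH hXY hY (hpos X Y (by exact_mod_cast hY) (by exact_mod_cast congrArg (Rat.cast : ℚ → ℝ) hXY)) h.loc fun l hl hlN => ?_
    by_cases hlD : (l : ℤ) ∣ D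
    · exact Or.inr ⟨hlD, fun h2 => (Nat.prime_iff_prime_int.1 hl.out).not_unit (h.sqf _ h2), h.unr l hlN hlD⟩
    · exact Or.inl ⟨(hA.unr hlN).1, hlD⟩
  obtain ⟨u, hu⟩ := hH.isUnit
  obtain ⟨v, hv⟩ := mem_Sq.1 (hS (show u ∈ Hg he d N by rw [mem_Hg, hu]; exact hH))
  exact ⟨v, by rw [← hu, ← hv, Units.val_pow_eq_pow_val]⟩
theorem Inert.mono {M p : ℕ} (hM : M ≠ 0) (h : N ∣ M) (hp : Inert A B 1 M p) : Inert A B 1 N p :=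
  ⟨hp.1, fun h1 => hp.2.1 (h1.trans h), ⟨hp.2.2.1.1, fun q hq => hp.2.2.1.2 q (Nat.primeFactors_mono h hM hq)⟩, hp.2.2.2⟩
open scoped Classical in
theorem main_int (hfr : ∀ x : ℚ, x ^ 3 + A * x + B ≠ 0) (hD : Dis A B ≠ 0) :
    ∃ (D : ℤ) (P : ℕ → Prop) (κ : ℝ), D ≠ 0 ∧ 0 < κ ∧ HasD (fun p => if P p then 1 else 0) κ ∧ ∀ n : ℕ, Gd P n →
      Squarefree (D * n) ∧ {X : ℚ | ∃ Y, Y ^ 2 = X ^ 3 + (D * n : ℤ) ^ 2 * A * X + (D * n : ℤ) ^ 3 * B}.Finite := by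
  obtain ⟨e, he, d, N, η, hη, hA, hS, hpos⟩ := sel hfr hD
  obtain ⟨D, M, hM0, hNM, hDM, hDd, hT⟩ : ∃ (D : ℤ) (M : ℕ), M ≠ 0 ∧ N ∣ M ∧ D ∣ M ∧ 0 < D * (η * d) ∧ Tw A B d N D := by
    have h0 : Tw A B d N d := ⟨hA.sqf, fun _ _ _ _ h => h, fun l _ h1 h2 => absurd h2 (hA.unr h1).2⟩
    have hdd : 0 < d * d := mul_self_pos.2 hA.sqf.ne_zero
    rcases hη with rfl | ⟨h1, rfl⟩
    · exact ⟨d, N, hA.N0, dvd_rfl, hA.dvd, by simpa using hdd, h0⟩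
    · obtain ⟨q, hq, hqN, hqp⟩ := (inert_hasD hfr (Or.inr ⟨h1, rfl⟩) hA.N0 hD hA.dis hA.two).exists_pos (by positivity) N hA.N0
      have hI : Inert A B (-1) N q := by grind
      refine ⟨q * (-1 * d), N * q, mul_ne_zero hA.N0 hq.ne_zero, ⟨q, rfl⟩, ?_, ?_, h0.next hA (Or.inr rfl) hI (hA.unr hqN).2⟩
      · obtain ⟨k, hk⟩ := hA.dvd
        exact ⟨-k, by grind⟩
      · have : (0 : ℤ) < q := by exact_mod_cast hq.pos
        have := mul_pos this hdd
        linarith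
  have hT' : ∀ n : ℕ, Gd (Inert A B 1 M) n → Tw A B d N (D * n) := by
    intro n
    induction n using induction_on_primes with
    | zero => intro h; exact absurd h.1 not_squarefree_zero
    | one => intro _; simpa using hT
    | prime_mul p a hp ih =>
      rintro ⟨h1, h2⟩
      obtain ⟨hc, -, ha⟩ := Nat.squarefree_mul_iff.1 h1
      have hI := h2 p hp ⟨a, rfl⟩
      have := (ih ⟨ha, fun q hq hqa => h2 q hq (hqa.mul_left _)⟩).next hA (Or.inl rfl) (hI.mono hM0 hNM) (fun hdv => by
        rcases (Nat.prime_iff_prime_int.1 hp).dvd_or_dvd hdv with h3 | h3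
        · exact hI.2.1 (by exact_mod_cast h3.trans hDM)
        · exact (hp.coprime_iff_not_dvd.1 hc) (by exact_mod_cast h3))
      grind
  refine ⟨D, Inert A B 1 M, _, fun h => by simp [h] at hDd, by positivity,
    inert_hasD hfr (Or.inl rfl) hM0 hD (hA.dis.trans (by exact_mod_cast hNM)) (hA.two.trans hNM), fun n hn => ⟨(hT' n hn).sqf, ?_⟩⟩
  refine (hT' n hn).fin hfr hD hA hS fun X Y hY h => hpos _ ?_ X Y hY h
  have : (0 : ℤ) < n := by exact_mod_cast Nat.pos_of_ne_zero hn.1.ne_zero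
  have := mul_pos this hDd
  linarith
end Ono

namespace Ono
theorem to_int (A B : ℚ) (hΔ : 4 * A ^ 3 + 27 * B ^ 2 ≠ 0) (hroot : ¬∃ x : ℚ, x ^ 3 + A * x + B = 0) :
    ∃ (a b : ℤ), (∀ x : ℚ, x ^ 3 + a * x + b ≠ 0) ∧ Dis a b ≠ 0 ∧ ∀ D : ℤ,
      {X : ℚ | ∃ Y, Y ^ 2 = X ^ 3 + D ^ 2 * a * X + D ^ 3 * b}.Finite → Finite (quadTwist A B D).Point := by
  have hA0 : (A.den : ℚ) ≠ 0 := by exact_mod_cast A.den_ne_zero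
  have hB0 : (B.den : ℚ) ≠ 0 := by exact_mod_cast B.den_ne_zero
  obtain ⟨t, ht, htd⟩ : ∃ t : ℚ, t ≠ 0 ∧ t = A.den * B.den := ⟨_, mul_ne_zero hA0 hB0, rfl⟩
  have ha : ((A.num * A.den ^ 3 * B.den ^ 4 : ℤ) : ℚ) = A * t ^ 4 := by
    rw [htd]; push_cast; linear_combination -(A.den ^ 3 * B.den ^ 4 : ℚ) * Rat.mul_den_eq_num A
  have hb : ((B.num * B.den ^ 5 * A.den ^ 6 : ℤ) : ℚ) = B * t ^ 6 := by
    rw [htd]; push_cast; linear_combination -(B.den ^ 5 * A.den ^ 6 : ℚ) * Rat.mul_den_eq_num B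
  refine ⟨A.num * A.den ^ 3 * B.den ^ 4, B.num * B.den ^ 5 * A.den ^ 6, fun x hx => hroot ⟨x / t ^ 2, ?_⟩, fun h => hΔ ?_, fun D hD => ?_⟩
  · rw [ha, hb] at hx
    field_simp; linear_combination hx
  · have h' := congrArg (Int.cast : ℤ → ℚ) h
    rw [Dis, Int.cast_sub, Int.cast_mul, Int.cast_mul, Int.cast_pow, Int.cast_pow, ha, hb] at h'
    grind
  · refine finite_point A B D ((hD.preimage (f := fun X => t ^ 2 * X) fun x _ y _ h => mul_left_cancel₀ (pow_ne_zero 2 ht) h).subset ?_)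
    rintro X ⟨Y, hY⟩
    refine ⟨t ^ 3 * Y, ?_⟩
    grind
open scoped Classical in
theorem count_le {P : ℕ → Prop} {D : ℤ} (hD : D ≠ 0) {S : Set ℤ} {X X' : ℝ} (hX' : 0 ≤ X') (hXX : |(D : ℝ)| * X' < X)
    (hS : ∀ d ∈ S, |(d : ℝ)| < X) (h : ∀ n : ℕ, Gd P n → |((D * n : ℤ) : ℝ)| < X → D * n ∈ S) : NC P X' ≤ (Nat.card S : ℝ) := by
  have hfin : S.Finite := (Set.finite_Icc (-⌈X⌉) ⌈X⌉).subset fun d hd => by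
    have := abs_lt.1 (hS d hd)
    have h1 := Int.le_ceil X
    constructor
    · have : (-⌈X⌉ : ℝ) ≤ d := by linarith
      exact_mod_cast this
    · have : (d : ℝ) ≤ ⌈X⌉ := by linarith
      exact_mod_cast this
  rw [NC, Nat.card_coe_set_eq, Set.ncard_eq_toFinset_card S hfin]
  norm_cast
  refine Finset.card_le_card_of_injOn (fun n : ℕ => D * n) (fun n hn => ?_) fun a _ b _ hab => ?_
  · simp only [Finset.coe_filter, Finset.mem_Icc, Set.mem_ofPred_eq] at hn
    simp only [Set.Finite.coe_toFinset]
    refine h n hn.2 ?_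
    have h1 : (n : ℝ) ≤ X' := (Nat.le_floor_iff hX').1 hn.1.2
    push_cast
    rw [abs_mul, Nat.abs_cast]
    exact (mul_le_mul_of_nonneg_left h1 (abs_nonneg _)).trans_lt hXX
  · exact_mod_cast mul_left_cancel₀ hD hab
end Ono

/-- **Ono (algebraic rank part).** For an elliptic curve `E : y² = x³ + Ax + B` over `ℚ`
with `E(ℚ)[2] = 0` (i.e. the cubic has no rational root), there is `α ∈ (0,1)` such that
the number of squarefree `d` with `|d| < X` whose quadratic twist `E⁽ᵈ⁾` has finite
Mordell–Weil group is `≫ X / (log X)^{1-α}`. -/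
theorem ono_rank_zero_twists (A B : ℚ) (hΔ : 4 * A ^ 3 + 27 * B ^ 2 ≠ 0)
    (hroot : ¬∃ x : ℚ, x ^ 3 + A * x + B = 0) :
    ∃ α : ℝ, α ∈ Set.Ioo (0 : ℝ) 1 ∧ ∃ c : ℝ, 0 < c ∧ ∃ X₀ : ℝ, 0 < X₀ ∧
      ∀ X : ℝ, X₀ ≤ X →
        c * X / (Real.log X) ^ (1 - α) ≤
          (Nat.card {d : ℤ | Squarefree d ∧ |(d : ℝ)| < X ∧
            Finite (WeierstrassCurve.Affine.Point (quadTwist A B d))} : ℝ) := by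
  classical
  obtain ⟨a, b, hfr, hD, hfin⟩ := Ono.to_int A B hΔ hroot
  obtain ⟨D, P, κ, hD0, hκ, hP, hn⟩ := Ono.main_int hfr hD
  obtain ⟨β, hβ0, hβ1, c, hc, hcount⟩ := Ono.count_lower hκ hP
  have hDp : (0 : ℝ) < |(D : ℝ)| := abs_pos.2 (by exact_mod_cast hD0)
  have hD1 : (1 : ℝ) ≤ |(D : ℝ)| := by exact_mod_cast Int.one_le_abs hD0
  refine ⟨1 - β, ⟨by linarith, by linarith⟩, c / (2 * |(D : ℝ)|) * 2 ^ (-β), by positivity, 3 * |(D : ℝ)|, by positivity, fun X hX => ?_⟩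
  rw [sub_sub_cancel]
  have hX3 : 3 ≤ X := by linarith
  have hX' : 1 ≤ X / (2 * |(D : ℝ)|) := by rw [le_div_iff₀ (by positivity)]; linarith
  have hXle : X / (2 * |(D : ℝ)|) ≤ X := div_le_self (by linarith) (by linarith)
  have hlog : 1 ≤ Real.log X := by
    rw [Real.le_log_iff_exp_le (by linarith)]
    exact (Real.exp_one_lt_three.le).trans hX3
  have h1 := hcount _ hX'
  have h2 : 1 + Real.log (X / (2 * |(D : ℝ)|)) ≤ 2 * Real.log X := by
    have := Real.log_le_log (by linarith) hXle
    linarith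
  have h3 : 0 ≤ Real.log (X / (2 * |(D : ℝ)|)) := Real.log_nonneg hX'
  have h4 := Real.rpow_le_rpow_of_nonpos (z := -β) (by linarith) h2 (by linarith)
  rw [Real.mul_rpow (by norm_num) (by linarith)] at h4
  have h5 := mul_le_mul_of_nonneg_left h4 (by positivity : 0 ≤ c * (X / (2 * |(D : ℝ)|)))
  have h6 := Ono.count_le (P := P) hD0 (S := {d : ℤ | Squarefree d ∧ |(d : ℝ)| < X ∧
            Finite (WeierstrassCurve.Affine.Point (quadTwist A B d))}) (X := X) (X' := X / (2 * |(D : ℝ)|)) (by positivity)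
    (by field_simp; linarith) (fun d hd => hd.2.1) fun n hn' hlt => ⟨(hn n hn').1, hlt, hfin _ (hn n hn').2⟩
  refine le_trans (le_of_eq ?_) (h5.trans (h1.trans h6))
  rw [div_eq_mul_inv (_ * X), ← Real.rpow_neg (by linarith)]
  ring
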